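/- Let Y ⊆ ℙ^r (over ℂ) be smooth and nondegenerate with dim(Y) > (2/3)(r − 1). Then Y is non-projectable and has the irreducible secant cone (ISC) property. -/

import Mathlib

/- Background for [Lopez-Ran, "On the irreducibility of secant cones, and an application
to linear normality"]: a concrete model of complex projective geometry.  Projective space
`ℙ^r(ℂ)` is the projectivization of `ℂ^{r+1}`, equipped with the Zariski topology;
subvarieties are (closed, irreducible) subsets; tangent spaces, smoothness, the invariant
`σ(Y)`, secant varieties/cones, generic linear projections and their double loci, and
linear normality are all defined from first principles below. -/

open MvPolynomial Set

noncomputable section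

/-- Complex projective space of lines in `ℂⁿ` (so of projective dimension `n - 1`). -/
abbrev PrV (n : ℕ) : Type := Projectivization ℂ (Fin n → ℂ)

/-- `ℙ^r` over `ℂ`. -/
abbrev Pr (r : ℕ) : Type := PrV (r + 1)

/-- The vanishing locus in projective space of a polynomial, defined via all nonzero lifts
(for a homogeneous polynomial this is the usual projective zero locus). -/
def pZero {n : ℕ} (f : MvPolynomial (Fin n) ℂ) : Set (PrV n) :=
  {x | ∀ v : Fin n → ℂ, ∀ hv : v ≠ 0, Projectivization.mk ℂ v hv = x → eval v f = 0}

/-- The Zariski topology on complex projective space. -/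
instance prTop (n : ℕ) : TopologicalSpace (PrV n) :=
  TopologicalSpace.generateFrom {U | ∃ f : MvPolynomial (Fin n) ℂ, U = (pZero f)ᶜ}

/-- The Zariski topology on the affine space `ℂ^σ`. -/
def affTop (σ : Type) : TopologicalSpace (σ → ℂ) :=
  TopologicalSpace.generateFrom {U | ∃ f : MvPolynomial σ ℂ, U = {v | eval v f ≠ 0}}

/-- A property holds generically (on a dense Zariski-open set) on the affine space `ℂ^σ`. -/
def GenericAff {σ : Type} (P : (σ → ℂ) → Prop) : Prop :=
  ∃ U : Set (σ → ℂ), @IsOpen _ (affTop σ) U ∧ @Dense _ (affTop σ) U ∧ ∀ v ∈ U, P v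

/-- The projective line through two points (their linear span); for `x = y` this is `{x}`. -/
def lineThrough {n : ℕ} (x y : PrV n) : Set (PrV n) :=
  {z | z.rep ∈ Submodule.span ℂ ({x.rep, y.rep} : Set (Fin n → ℂ))}

/-- The projective linear subspace associated to a linear subspace `W ⊆ ℂⁿ`. -/
def projSub {n : ℕ} (W : Submodule ℂ (Fin n → ℂ)) : Set (PrV n) := {x | x.rep ∈ W}

/-- The secant variety of `Y`: the (closure of the) union of all lines spanned by pairs of
distinct points of `Y`, i.e. the union of all secant lines of `Y`. -/
def secantVariety {n : ℕ} (Y : Set (PrV n)) : Set (PrV n) :=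
  closure (⋃ x ∈ Y, ⋃ y ∈ Y, ⋃ _ : x ≠ y, lineThrough x y)

/-- `Y` is projectable if its secant variety is not all of projective space. -/
def Projectable {n : ℕ} (Y : Set (PrV n)) : Prop := secantVariety Y ≠ Set.univ

/-- Hyperplanes in projective space. -/
def IsHyperplane {n : ℕ} (H : Set (PrV n)) : Prop :=
  ∃ φ : (Fin n → ℂ) →ₗ[ℂ] ℂ, φ ≠ 0 ∧ H = {x | φ x.rep = 0}

/-- A set in projective space is nondegenerate if it is contained in no hyperplane. -/
def NondegenerateSet {n : ℕ} (Y : Set (PrV n)) : Prop :=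
  ∀ H : Set (PrV n), IsHyperplane H → ¬ Y ⊆ H

/-- Dimension of a subset of projective space: the Krull dimension of the subspace
topology. -/
def pdim {n : ℕ} (S : Set (PrV n)) : WithBot ℕ∞ := topologicalKrullDim S

/-- The homogeneous ideal of `Y` (as a set): all polynomials all of whose lifts vanish on
the affine cone of `Y`. -/
def homIdeal {n : ℕ} (Y : Set (PrV n)) : Set (MvPolynomial (Fin n) ℂ) := {f | Y ⊆ pZero f}

/-- The differential of a polynomial at a point of `ℂⁿ`, as a linear form. -/
def jacLin {n : ℕ} (f : MvPolynomial (Fin n) ℂ) (v : Fin n → ℂ) : (Fin n → ℂ) →ₗ[ℂ] ℂ :=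
  ∑ i, eval v (pderiv i f) • LinearMap.proj i

/-- The affine tangent space of the cone over `Y` at `v`: the common kernel of the
differentials of all elements of the homogeneous ideal of `Y`. -/
def affTangent {n : ℕ} (Y : Set (PrV n)) (v : Fin n → ℂ) : Submodule ℂ (Fin n → ℂ) :=
  ⨅ f ∈ homIdeal Y, LinearMap.ker (jacLin f v)

/-- The embedded projective tangent space `T_x Y ⊆ ℙⁿ⁻¹`. -/
def projTangent {n : ℕ} (Y : Set (PrV n)) (x : PrV n) : Set (PrV n) :=
  projSub (affTangent Y x.rep)

/-- `x` is a smooth point of `Y` if the affine tangent space of the cone has the expected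
dimension `dim Y + 1`. -/
def IsSmoothPt {n : ℕ} (Y : Set (PrV n)) (x : PrV n) : Prop :=
  ((Module.finrank ℂ (affTangent Y x.rep) : ℕ∞) : WithBot ℕ∞) = pdim Y + 1

/-- The smooth locus `Y_smooth` of `Y`. -/
def smoothLocus {n : ℕ} (Y : Set (PrV n)) : Set (PrV n) := {x ∈ Y | IsSmoothPt Y x}

/-- The singular locus of `Y`. -/
def singLocus {n : ℕ} (Y : Set (PrV n)) : Set (PrV n) := Y \ smoothLocus Y

/-- `Y` is smooth if every point of `Y` is a smooth point. -/
def IsSmoothSet {n : ℕ} (Y : Set (PrV n)) : Prop := ∀ x ∈ Y, IsSmoothPt Y x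

/-- A divisor on `Y`: an irreducible closed subvariety of `Y` of codimension one. -/
def IsDivisorOn {n : ℕ} (W Y : Set (PrV n)) : Prop :=
  W ⊆ Y ∧ IsIrreducible W ∧ closure W ∩ Y = W ∧ pdim W + 1 = pdim Y

/-- `σ(Y)`: the maximal dimension of a subvariety `Z` of the smooth locus of `Y` which
contains a generic point of some divisor on `Y` (i.e. is dense in some divisor), and such
that all embedded tangent spaces `T_y Y`, `y ∈ Z`, lie in a fixed hyperplane. -/
def sigmaY {n : ℕ} (Y : Set (PrV n)) : WithBot ℕ∞ :=
  sSup { d | ∃ Z : Set (PrV n), Z ⊆ smoothLocus Y ∧ IsIrreducible Z ∧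
      (∃ W, IsDivisorOn W Y ∧ W ⊆ closure (Z ∩ W)) ∧
      (∃ H, IsHyperplane H ∧ ∀ y ∈ Z, projTangent Y y ⊆ H) ∧ pdim Z = d }

/-- The ideal of polynomials vanishing (in all lifts) on the affine cone over `Y`. -/
def idealOf {n : ℕ} (Y : Set (PrV n)) : Ideal (MvPolynomial (Fin n) ℂ) where
  carrier := homIdeal Y
  add_mem' := by
    intro f g hf hg x hx v hv hvx
    have h1 := hf hx v hv hvx
    have h2 := hg hx v hv hvx
    simp [map_add, h1, h2]
  zero_mem' := by intro x hx v hv hvx; simp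
  smul_mem' := by
    intro c f hf x hx v hv hvx
    have h1 := hf hx v hv hvx
    simp [smul_eq_mul, map_mul, h1]

instance kerEvalPrime {n : ℕ} (v : Fin n → ℂ) :
    (RingHom.ker ((aeval v : MvPolynomial (Fin n) ℂ →ₐ[ℂ] ℂ) :
      MvPolynomial (Fin n) ℂ →+* ℂ)).IsPrime :=
  RingHom.ker_isPrime _

/-- The local ring of the affine space `ℂⁿ` at the point `v`. -/
abbrev polyAtPoint {n : ℕ} (v : Fin n → ℂ) : Type :=
  Localization.AtPrime (RingHom.ker ((aeval v : MvPolynomial (Fin n) ℂ →ₐ[ℂ] ℂ) :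
    MvPolynomial (Fin n) ℂ →+* ℂ))

/-- The local ring of the affine cone over `Y` at a (nonzero) point `v` of the cone. -/
abbrev coneLocalRing {n : ℕ} (Y : Set (PrV n)) (v : Fin n → ℂ) : Type :=
  polyAtPoint v ⧸
    (Ideal.map (algebraMap (MvPolynomial (Fin n) ℂ) (polyAtPoint v)) (idealOf Y))

/-- A normal (irreducible, closed) subvariety of projective space: all local rings of its
affine cone at points of the punctured cone are integrally closed domains. -/
def IsNormalVariety {n : ℕ} (Y : Set (PrV n)) : Prop :=
  IsClosed Y ∧ IsIrreducible Y ∧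
    ∀ x ∈ Y, IsDomain (coneLocalRing Y x.rep) ∧ IsIntegrallyClosed (coneLocalRing Y x.rep)

/-- The scheme-theoretic double locus of the projection of `Y` away from the projective
linear subspace `ℙ(W)`: points `y ∈ Y` such that the fibre of the projection through `y`
(the span of `ℙ(W)` and `y`) meets `Y` in a subscheme different from the single reduced
point `y`: either it contains a second point of `Y`, or it is tangent to `Y` at `y`. -/
def doubleLocus {r : ℕ} (Y : Set (Pr r)) (W : Submodule ℂ (Fin (r+1) → ℂ)) : Set (Pr r) :=
  {y | y ∈ Y ∧
    ((∃ y' ∈ Y, y' ≠ y ∧ y'.rep ∈ W ⊔ Submodule.span ℂ {y.rep}) ∨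
      affTangent Y y.rep ⊓ (W ⊔ Submodule.span ℂ {y.rep}) ≠ Submodule.span ℂ {y.rep})}

/-- The linear subspace spanned by a `(k+1)`-tuple of vectors of `ℂ^{r+1}` (used to
parametrize generic linear subspaces of projective dimension `k`). -/
def spanOfTuple {r k : ℕ} (v : Fin (k+1) × Fin (r+1) → ℂ) :
    Submodule ℂ (Fin (r+1) → ℂ) :=
  Submodule.span ℂ (Set.range fun i : Fin (k+1) => fun j => v (i, j))

/-- The secant cone of `Y` at `z`: the closure of the union of all secant lines of `Y`
passing through `z`. -/
def secantCone {r : ℕ} (Y : Set (Pr r)) (z : Pr r) : Set (Pr r) :=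
  closure (⋃ x ∈ Y, ⋃ y ∈ Y, ⋃ _ : x ≠ y, ⋃ _ : z ∈ lineThrough x y, lineThrough x y)

/-- `Y` has the irreducible secant cone (ISC) property: the secant cone of `Y` at a generic
point of `ℙ^r` (equivalently, the generic fibre of `f : I_Y → ℙ^r`) is irreducible. -/
def ISC {r : ℕ} (Y : Set (Pr r)) : Prop :=
  ∃ U : Set (Pr r), IsOpen U ∧ Dense U ∧ ∀ z ∈ U, IsIrreducible (secantCone Y z)

/-- The outer (Segre) product of two vectors. -/
def outerVec {a b : ℕ} (v : Fin a → ℂ) (w : Fin b → ℂ) : Fin (a * b) → ℂ :=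
  fun k => v (finProdFinEquiv.symm k).1 * w (finProdFinEquiv.symm k).2
lemma outerVec_ne_zero {a b : ℕ} {v : Fin a → ℂ} {w : Fin b → ℂ}
    (hv : v ≠ 0) (hw : w ≠ 0) : outerVec v w ≠ 0 := by
  obtain ⟨i, hi⟩ := Function.ne_iff.mp hv
  obtain ⟨j, hj⟩ := Function.ne_iff.mp hw
  intro h
  have h2 := congrFun h (finProdFinEquiv (i, j))
  simp only [outerVec, Equiv.symm_apply_apply, Pi.zero_apply] at h2
  rcases mul_eq_zero.mp h2 with h3 | h3
  · exact hi h3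
  · exact hj h3

/-- The Segre embedding of a product of projective spaces. -/
def segre {a b : ℕ} (p : PrV a × PrV b) : PrV (a * b) :=
  Projectivization.mk ℂ (outerVec p.1.rep p.2.rep)
    (outerVec_ne_zero p.1.rep_nonzero p.2.rep_nonzero)

/-- The Zariski topology on a product of two projective spaces (induced via the Segre
embedding). -/
def pairTop (r : ℕ) : TopologicalSpace (Pr r × Pr r) :=
  TopologicalSpace.induced segre (prTop ((r+1) * (r+1)))

/-- Zariski closure in the product of two projective spaces. -/
def closureP {r : ℕ} (S : Set (Pr r × Pr r)) : Set (Pr r × Pr r) :=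
  segre ⁻¹' closure (segre '' S)

/-- Zariski irreducibility of a subset of the product of two projective spaces. -/
def IsIrreducibleP {r : ℕ} (S : Set (Pr r × Pr r)) : Prop :=
  IsIrreducible (closure (segre '' S))

/-- Zariski connectedness of a subset of the product of two projective spaces. -/
def IsConnectedP {r : ℕ} (S : Set (Pr r × Pr r)) : Prop :=
  IsConnected (segre '' S)

/-- Dimension of a subset of the product of two projective spaces. -/
def pdimP {r : ℕ} (S : Set (Pr r × Pr r)) : WithBot ℕ∞ := pdim (segre '' S)

/-- The (ordered-pairs model of the) fibre of `f : I_Y → ℙ^r` over `z ∈ ℙ^r`: pairs of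
distinct points of `Y` whose secant line passes through `z`, together with limits of such
(the secant cone of `Y` at `z`, upstairs). -/
def secPairs {r : ℕ} (Y : Set (Pr r)) (z : Pr r) : Set (Pr r × Pr r) :=
  {p | p.1 ∈ Y ∧ p.2 ∈ Y ∧ p.1 ≠ p.2 ∧ z ∈ lineThrough p.1 p.2}

/-- The fibre of `f : I_Y → ℙ^r` over `z` (with its limit points). -/
def secFiber {r : ℕ} (Y : Set (Pr r)) (z : Pr r) : Set (Pr r × Pr r) :=
  closureP (secPairs Y z)

/-- The linear map `ℂ^b → ℂ^a` given by a matrix of coefficients. -/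
def matLin {a b : ℕ} (w : Fin a × Fin b → ℂ) : (Fin b → ℂ) →ₗ[ℂ] (Fin a → ℂ) :=
  Matrix.mulVecLin (Matrix.of fun i j => w (i, j))

/-- The image of a subset of `ℙ^{b-1}` under the linear projection `ℙ^{b-1} ⇢ ℙ^{a-1}`
given by a matrix. -/
def projImage {a b : ℕ} (w : Fin a × Fin b → ℂ) (Z : Set (PrV b)) : Set (PrV a) :=
  {z | ∃ x ∈ Z, ∃ c : ℂ, c ≠ 0 ∧ z.rep = c • matLin w x.rep}

/-- `X ⊆ ℙ^N` is the image of `X̃ ⊆ ℙ^{N+1}` under a bijective projection from a point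
`Q ∉ X̃` (the centre `Q` being the projectivized kernel of the surjective linear map `L`). -/
def IsBijectiveProjectionOf {N : ℕ} (X : Set (Pr N)) (Xt : Set (Pr (N+1))) : Prop :=
  ∃ L : (Fin (N+2) → ℂ) →ₗ[ℂ] (Fin (N+1) → ℂ), Function.Surjective L ∧
    (∀ x ∈ Xt, L x.rep ≠ 0) ∧
    X = {z | ∃ x ∈ Xt, ∃ c : ℂ, c ≠ 0 ∧ z.rep = c • L x.rep} ∧
    (∀ x ∈ Xt, ∀ y ∈ Xt, (∃ c : ℂ, L x.rep = c • L y.rep) → x = y)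

/-- `X ⊆ ℙ^N` is linearly normal if it is not the image, under a bijective projection from
a point, of a nondegenerate subvariety of `ℙ^{N+1}`. -/
def LinearlyNormal {N : ℕ} (X : Set (Pr N)) : Prop :=
  ¬ ∃ Xt : Set (Pr (N+1)), IsClosed Xt ∧ IsIrreducible Xt ∧ NondegenerateSet Xt ∧
      IsBijectiveProjectionOf X Xt

/-- Extension by zero `ℂ^a → ℂ^b` (for `a ≤ b`). -/
def padMap (a b : ℕ) : (Fin a → ℂ) →ₗ[ℂ] (Fin b → ℂ) where
  toFun v := fun j => if h : (j : ℕ) < a then v ⟨j, h⟩ else 0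
  map_add' v w := by funext j; by_cases h : (j : ℕ) < a <;> simp [h]
  map_smul' c v := by funext j; by_cases h : (j : ℕ) < a <;> simp [h]
lemma padMap_ne_zero {a b : ℕ} (hab : a ≤ b) {v : Fin a → ℂ} (hv : v ≠ 0) :
    padMap a b v ≠ 0 := by
  obtain ⟨i, hi⟩ := Function.ne_iff.mp hv
  intro h
  have h2 := congrFun h ⟨i, lt_of_lt_of_le i.isLt hab⟩
  simp only [padMap, LinearMap.coe_mk, AddHom.coe_mk, Pi.zero_apply] at h2
  rw [dif_pos i.isLt] at h2
  exact hi (by simpa using h2)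

/-- A point of `ℙ^{a-1}` viewed in `ℙ^{b-1}` via the inclusion of the first `a`
coordinates. -/
def embPt {a b : ℕ} (hab : a ≤ b) (x : PrV a) : PrV b :=
  Projectivization.mk ℂ (padMap a b x.rep) (padMap_ne_zero hab x.rep_nonzero)

/-- The join of two subsets of projective space: the union of all lines joining a point of
`A` to a point of `B`. -/
def joinSets {n : ℕ} (A B : Set (PrV n)) : Set (PrV n) :=
  ⋃ x ∈ A, ⋃ y ∈ B, lineThrough x y


section
open Algebra Cardinal
lemma exists_trdeg_nat {k S : Type} [Field k] [CommRing S] [Algebra k S] [FiniteType k S] :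
    ∃ n : ℕ, trdeg k S = n :=
  Cardinal.lt_aleph0.mp (trdeg_lt_aleph0_of_finiteType (R := k) (S := S))
lemma exists_basis_of_trdeg {k S : Type} [Field k] [CommRing S] [IsDomain S] [Algebra k S] {n : ℕ}
    (h : trdeg k S = n) : ∃ x : Fin n → S, IsTranscendenceBasis k x := by
  obtain ⟨ι, x, hx⟩ := exists_isTranscendenceBasis' k S
  have h1 := hx.cardinalMk_eq_trdeg
  rw [h] at h1
  obtain ⟨e⟩ : Nonempty (ι ≃ Fin n) := by
    rw [← Cardinal.eq]; simp [h1]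
  exact ⟨x ∘ e.symm, (isTranscendenceBasis_equiv e.symm).mpr hx⟩
lemma trdeg_quot_lt {k S : Type} [Field k] [CommRing S] [IsDomain S] [Algebra k S] [FiniteType k S]
    (q : Ideal S) [q.IsPrime] (hq : q ≠ ⊥) : trdeg k (S ⧸ q) + 1 ≤ trdeg k S := by
  obtain ⟨a, ha⟩ := exists_trdeg_nat (k := k) (S := S ⧸ q)
  obtain ⟨b, hb⟩ := exists_trdeg_nat (k := k) (S := S)
  rw [ha, hb]
  norm_cast
  by_contra hlt
  obtain ⟨x, hx⟩ := exists_basis_of_trdeg ha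
  choose y hy using fun i => Ideal.Quotient.mk_surjective (x i)
  have hxy : x = (Ideal.Quotient.mkₐ k q) ∘ y := by funext i; simp [hy]
  have hi : AlgebraicIndependent k y := by
    have := hx.1
    rw [hxy] at this
    exact AlgebraicIndependent.of_comp _ this
  have hB : IsTranscendenceBasis k y := by
    apply AlgebraicIndependent.isTranscendenceBasis_of_trdeg_le_of_finite hi
    rw [hb]; simp; omega
  have halg := hB.isAlgebraic
  obtain ⟨z, hz, hz0⟩ := Submodule.exists_mem_ne_zero_of_ne_bot hq
  have := Ideal.comap_ne_bot_of_algebraic_mem hz0 hz (halg.isAlgebraic z)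
  apply this
  rw [eq_bot_iff]
  intro p hp
  obtain ⟨p, hp'⟩ := p
  rw [Algebra.adjoin_range_eq_range_aeval] at hp'
  obtain ⟨P, rfl⟩ := hp'
  have h0 : (Ideal.Quotient.mkₐ k q) (aeval y P) = 0 := Ideal.Quotient.eq_zero_iff_mem.mpr hp
  have h1 : aeval x P = 0 := by
    rw [hxy, ← h0]; rw [aeval_def, aeval_def]; simp [MvPolynomial.eval₂_comp_left, Function.comp_def]
  have := hx.1.eq_zero_of_aeval_eq_zero P h1
  subst this
  apply Subtype.ext
  simp
lemma trdeg_of_isIntegral {k A S : Type} [Field k] [CommRing A] [CommRing S] [IsDomain S] [Algebra k S] [Algebra k A]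
    (f : A →ₐ[k] S) (hf : Function.Injective f) (hi : f.IsIntegral) : trdeg k S = trdeg k A := by
  algebraize [f.toRingHom]
  have : FaithfulSMul A S := (faithfulSMul_iff_algebraMap_injective _ _).mpr hf
  have : IsDomain A := hf.isDomain f.toRingHom
  have key := trdeg_add_eq k A (A := S)
  have : Algebra.IsIntegral A S := ⟨hi⟩
  rw [← key, _root_.trdeg_eq_zero (R := A) (A := S), add_zero]
lemma trdeg_quot_span_singleton {k : Type} [Field k] {s : ℕ} (g : MvPolynomial (Fin s) k)
    (hg0 : g ≠ 0) (hg : ¬ IsUnit g) :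
    (s : Cardinal) ≤ trdeg k (MvPolynomial (Fin s) k ⧸ Ideal.span {g}) + 1 := by
  have hgC : ∃ i, degreeOf i g ≠ 0 := by
    by_contra! h
    apply hg
    have hv : g.vars = ∅ := by
      ext i
      simp only [Finset.notMem_empty, iff_false]
      intro hi
      have := h i
      rw [degreeOf_def, Multiset.count_eq_zero] at this
      exact this (by simpa [vars_def] using hi)
    have := (mem_supported_vars g)
    rw [hv] at this
    simp only [Finset.coe_empty, supported_empty] at this
    obtain ⟨c, rfl⟩ := Algebra.mem_bot.mp this
    have hc : c ≠ 0 := by rintro rfl; simp at hg0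
    exact (IsUnit.mk0 c hc).map _
  obtain ⟨i, hi⟩ := hgC
  cases s with
  | zero => exact i.elim0
  | succ s =>
  have hind : AlgebraicIndependent k (fun j : Fin s =>
      (Ideal.Quotient.mk (Ideal.span {g}) (X (i.succAbove j)))) := by
    rw [algebraicIndependent_iff]
    intro p hp
    have h1 : aeval (fun j : Fin s =>
      (Ideal.Quotient.mk (Ideal.span {g}) (X (i.succAbove j)))) p
        = Ideal.Quotient.mkₐ k (Ideal.span {g}) (rename i.succAbove p) := by
      have : aeval (fun j : Fin s => (Ideal.Quotient.mk (Ideal.span {g}) (X (i.succAbove j))))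
          = (Ideal.Quotient.mkₐ k (Ideal.span {g})).comp (rename i.succAbove) := by
        ext j; simp
      rw [this]; rfl
    rw [h1] at hp
    have h2 : rename i.succAbove p ∈ Ideal.span {g} := Ideal.Quotient.eq_zero_iff_mem.mp hp
    rw [Ideal.mem_span_singleton] at h2
    obtain ⟨h, hh⟩ := h2
    by_contra hp0
    have hr0 : rename i.succAbove p ≠ 0 := by
      intro h; exact hp0 (rename_injective _ Fin.succAbove_right_injective (by simpa using h))
    have hh0 : h ≠ 0 := by rintro rfl; simp [hr0] at hh
    have h3 := congrArg (degreeOf i) hh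
    rw [degreeOf_mul_eq hg0 hh0] at h3
    have h4 : degreeOf i (rename i.succAbove p) = 0 := by
      rw [degreeOf_def, Multiset.count_eq_zero]
      intro hm
      have : i ∈ (rename i.succAbove p).vars := by simpa [vars_def] using hm
      obtain ⟨j, -, hj⟩ := mem_vars_rename _ _ this
      exact Fin.succAbove_ne i j hj
    omega
  have := hind.cardinalMk_le_trdeg
  simp at this
  push_cast
  gcongr
lemma pit {k S : Type} [Field k] [CommRing S] [IsDomain S] [Algebra k S] [FiniteType k S]
    (x : S) (Q : Ideal S) (hQ : Q ∈ (Ideal.span {x}).minimalPrimes) :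
    trdeg k S ≤ trdeg k (S ⧸ Q) + 1 := by
  have hQp : Q.IsPrime := hQ.isPrime
  by_cases hQ0 : Q = ⊥
  · subst hQ0
    have : trdeg k S = trdeg k (S ⧸ (⊥ : Ideal S)) := (AlgEquiv.quotientBot k S).symm.trdeg_eq
    rw [this]; exact le_self_add
  have : IsNoetherianRing S := Algebra.FiniteType.isNoetherianRing k S
  have hQ1 := Ideal.height_le_one_of_isPrincipal_of_mem_minimalPrimes _ Q hQ
  obtain ⟨s, g, hinj, hint⟩ := exists_integral_inj_algHom_of_fg k S
  have h1 := trdeg_of_isIntegral g hinj hint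
  rw [MvPolynomial.trdeg_of_isDomain] at h1
  simp at h1
  algebraize [g.toRingHom]
  have : FaithfulSMul (MvPolynomial (Fin s) k) S := (faithfulSMul_iff_algebraMap_injective _ _).mpr hinj
  have : Algebra.IsIntegral (MvPolynomial (Fin s) k) S := ⟨hint⟩
  set p := Q.under (MvPolynomial (Fin s) k) with hp
  have : p.IsPrime := inferInstance
  have hp1 : p.height ≤ 1 := by
    have := Ideal.height_eq_height_add_of_liesOver_of_hasGoingDown p Q
    rw [this] at hQ1
    exact le_self_add.trans hQ1
  have hp0 : p ≠ ⊥ := by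
    intro h
    exact hQ0 (Ideal.eq_bot_of_comap_eq_bot h)
  have hp2 : p.height = 1 := by
    apply le_antisymm hp1
    rw [Order.one_le_iff_ne_zero]
    intro h
    exact hp0 (Ideal.height_eq_zero_iff_eq_bot.mp h)
  obtain ⟨f, hf⟩ := UniqueFactorizationMonoid.isPrincipal_of_height_eq_one hp2
  have hf' : p = Ideal.span {f} := hf
  have hf0 : f ≠ 0 := by rintro rfl; simp at hf'; exact hp0 hf'
  have hfu : ¬ IsUnit f := by
    intro h
    have := Ideal.span_singleton_eq_top.mpr h
    rw [← hf'] at this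
    exact Ideal.IsPrime.ne_top' this
  have h2 := trdeg_quot_span_singleton f hf0 hfu
  rw [← hf'] at h2
  have h3 : trdeg k (MvPolynomial (Fin s) k ⧸ p) ≤ trdeg k (S ⧸ Q) := by
    let φ : (MvPolynomial (Fin s) k ⧸ p) →ₐ[k] (S ⧸ Q) := Ideal.quotientMapₐ Q g le_rfl
    exact trdeg_le_of_injective φ (Ideal.quotientMap_injective)
  rw [h1]
  exact h2.trans (by gcongr)
lemma pit_iter {k : Type} [Field k] (m : ℕ) : ∀ {S : Type} [CommRing S] [IsDomain S] [Algebra k S] [FiniteType k S]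
    (x : Fin m → S) (Q : Ideal S) (_ : Q ∈ (Ideal.span (range x)).minimalPrimes),
    trdeg k S ≤ trdeg k (S ⧸ Q) + m := by
  induction m with
  | zero =>
    intro S _ _ _ _ x Q hQ
    have : Q ∈ (Ideal.span {(0 : S)}).minimalPrimes := by simpa using hQ
    have hQ' : Q = ⊥ := by
      have := hQ.2 ⟨Ideal.isPrime_bot, by simp⟩ bot_le
      exact le_bot_iff.mp this
    subst hQ'
    have : trdeg k S = trdeg k (S ⧸ (⊥ : Ideal S)) := (AlgEquiv.quotientBot k S).symm.trdeg_eq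
    rw [this]; simp
  | succ m ih =>
    intro S _ _ _ _ x Q hQ
    have hQp : Q.IsPrime := hQ.isPrime
    have hxQ : ∀ i, x i ∈ Q := fun i => hQ.1.2 (Ideal.subset_span ⟨i, rfl⟩)
    obtain ⟨P, hP, hPQ⟩ := Ideal.exists_minimalPrimes_le (I := Ideal.span (range (fun i : Fin m => x i.castSucc))) (J := Q)
      (by rw [Ideal.span_le]; rintro _ ⟨i, rfl⟩; exact hxQ _)
    have hPp : P.IsPrime := hP.isPrime
    have h1 := ih _ P hP
    have h2 := pit (k := k) (Ideal.Quotient.mk P (x (Fin.last m))) (Q.map (Ideal.Quotient.mk P)) (by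
      refine ⟨⟨Ideal.map_isPrime_of_surjective Ideal.Quotient.mk_surjective (by simpa using hPQ), ?_⟩, ?_⟩
      · rw [Ideal.span_le]; simpa using Ideal.mem_map_of_mem (Ideal.Quotient.mk P) (hxQ _)
      · rintro q ⟨hq, hxq⟩ hqQ
        rw [Ideal.map_le_iff_le_comap]
        apply hQ.2 ⟨hq.comap _, ?_⟩
        · refine (Ideal.comap_mono hqQ).trans ?_
          rw [Ideal.comap_map_of_surjective _ Ideal.Quotient.mk_surjective]
          rw [← RingHom.ker_eq_comap_bot, Ideal.mk_ker]; exact sup_le le_rfl hPQ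
        · rw [Ideal.span_le]
          rintro _ ⟨i, rfl⟩
          refine Fin.lastCases ?_ (fun j => ?_) i
          · exact hxq (Ideal.subset_span rfl)
          · have : x j.castSucc ∈ P := hP.1.2 (Ideal.subset_span ⟨j, rfl⟩)
            have h0 := Ideal.Quotient.eq_zero_iff_mem.mpr this
            simp [h0])
    have h3 : trdeg k ((S ⧸ P) ⧸ Q.map (Ideal.Quotient.mk P)) = trdeg k (S ⧸ Q) :=
      (DoubleQuot.quotQuotEquivQuotOfLEₐ k hPQ).trdeg_eq
    rw [h3] at h2
    refine h1.trans ?_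
    push_cast
    rw [add_comm (m : Cardinal) 1, ← add_assoc]
    gcongr

abbrev Po (n : ℕ) : Type := MvPolynomial (Fin n) ℂ
abbrev Hmg {n : ℕ} (I : Ideal (Po n)) : Prop := ∀ f ∈ I, ∀ k, homogeneousComponent k f ∈ I
def Zl {σ : Type} (I : Ideal (MvPolynomial σ ℂ)) : Set (σ → ℂ) := {a | ∀ f ∈ I, eval a f = 0}
lemma mem_of_Zl {σ : Type} [Finite σ] {I : Ideal (MvPolynomial σ ℂ)} [I.IsPrime] {f : MvPolynomial σ ℂ}
    (h : ∀ a ∈ Zl I, eval a f = 0) : f ∈ I := by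
  rw [← IsPrime.vanishingIdeal_zeroLocus (K := ℂ) I]
  intro a ha
  rw [aeval_eq_eval]
  exact h a (fun g hg => by have := ha g hg; rwa [aeval_eq_eval] at this)
lemma mem_radical_of_Zl {σ : Type} [Finite σ] {I : Ideal (MvPolynomial σ ℂ)} {f : MvPolynomial σ ℂ}
    (h : ∀ a ∈ Zl I, eval a f = 0) : f ∈ I.radical := by
  rw [← vanishingIdeal_zeroLocus_eq_radical (K := ℂ) I]
  intro a ha
  rw [aeval_eq_eval]
  exact h a (fun g hg => by have := ha g hg; rwa [aeval_eq_eval] at this)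
def dv {n : ℕ} (v : Fin n → ℂ) : Derivation ℂ (Po n) (Po n) := mkDerivation ℂ (fun i => C (v i))
lemma der_apply {n : ℕ} {A : Type} [AddCommGroup A] [Module ℂ A] [Module (Po n) A] [IsScalarTower ℂ (Po n) A]
    (δ : Derivation ℂ (Po n) A) (f : Po n) :
    δ f = ∑ i, pderiv i f • δ (X i) := by
  induction f using MvPolynomial.induction_on with
  | C c => simp [derivation_C]
  | add p q hp hq => simp [hp, hq, add_smul, Finset.sum_add_distrib]
  | mul_X p j hp =>
    simp only [Derivation.leibniz, hp, pderiv_X, add_smul, Finset.sum_add_distrib, smul_eq_mul, mul_smul,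
      Finset.smul_sum]
    congr 1
    rw [Finset.sum_eq_single j]
    · simp
    · intro b _ hb; simp [hb.symm]
    · simp
lemma dv_apply {n : ℕ} (v : Fin n → ℂ) (f : Po n) : dv v f = ∑ i, pderiv i f * C (v i) := by
  rw [der_apply]; simp [dv]
lemma eval_dv {n : ℕ} (v a : Fin n → ℂ) (f : Po n) :
    eval a (dv v f) = ∑ i, eval a (pderiv i f) * v i := by
  rw [dv_apply]; simp
lemma eval_der {n : ℕ} (δ : Derivation ℂ (Po n) (Po n)) (a : Fin n → ℂ) (f : Po n) :
    eval a (δ f) = eval a (dv (fun i => eval a (δ (X i))) f) := by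
  rw [eval_dv, der_apply]; simp
def Tan {n : ℕ} (I : Ideal (Po n)) (a : Fin n → ℂ) : Submodule ℂ (Fin n → ℂ) where
  carrier := {v | ∀ f ∈ I, eval a (dv v f) = 0}
  add_mem' := by
    intro v w hv hw f hf
    have h1 := hv f hf; have h2 := hw f hf
    rw [eval_dv] at *
    simp only [Pi.add_apply, mul_add, Finset.sum_add_distrib, h1, h2, add_zero]
  zero_mem' := by intro f hf; rw [eval_dv]; simp
  smul_mem' := by
    intro c v hv f hf
    have h1 := hv f hf
    rw [eval_dv] at *
    simp only [Pi.smul_apply, smul_eq_mul, mul_left_comm _ c, ← Finset.mul_sum, h1, mul_zero]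
def lin {n : ℕ} (s : Fin n → ℂ) : Po n := ∑ i, C (s i) * X i
lemma pderiv_lin {n : ℕ} (s : Fin n → ℂ) (j : Fin n) : pderiv j (lin s) = C (s j) := by
  simp [lin, pderiv_X, Pi.single_apply]
lemma isHomogeneous_lin {n : ℕ} (s : Fin n → ℂ) : (lin s).IsHomogeneous 1 := by
  apply IsHomogeneous.sum
  intro i _
  exact isHomogeneous_C_mul_X _ _
lemma eval_lin {n : ℕ} (s a : Fin n → ℂ) : eval a (lin s) = ∑ i, s i * a i := by
  simp [lin]

structure Good {n : ℕ} (d : ℕ) (I : Ideal (Po n)) : Prop where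
  prime : I.IsPrime
  hom : Hmg I
  smooth : ∀ a ∈ Zl I, a ≠ 0 → Module.finrank ℂ (Tan I a) = d
  nondeg : ∀ s : Fin n → ℂ, lin s ∈ I → s = 0
  dim : (d : Cardinal) ≤ trdeg ℂ (Po n ⧸ I)
def DD {n : ℕ} (I : Ideal (Po n)) : Set (Derivation ℂ (Po n) (Po n)) := {δ | ∀ f ∈ I, δ f ∈ I}
lemma finrank_ker_rows {n : ℕ} (R : Matrix (Fin n) (Fin n) ℂ) (hR : R.det ≠ 0) (S : Finset (Fin n)) :
    ∀ T : Submodule ℂ (Fin n → ℂ), (∀ v, v ∈ T ↔ ∀ i ∈ S, R.mulVec v i = 0) →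
    Module.finrank ℂ T + S.card = n := by
  intro T hT
  let φ : (Fin n → ℂ) →ₗ[ℂ] (S → ℂ) := (LinearMap.funLeft ℂ ℂ (Subtype.val : S → Fin n)) ∘ₗ R.mulVecLin
  have hk : LinearMap.ker φ = T := by
    ext v
    rw [hT, LinearMap.mem_ker]
    constructor
    · intro h i hi
      exact congrFun h ⟨i, hi⟩
    · intro h
      ext ⟨i, hi⟩
      exact h i hi
  have hs : Function.Surjective φ := by
    refine Function.Surjective.comp (g := LinearMap.funLeft ℂ ℂ (Subtype.val : S → Fin n)) (f := R.mulVecLin) (LinearMap.funLeft_surjective_of_injective ℂ ℂ _ Subtype.val_injective) ?_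
    intro w
    refine ⟨R⁻¹.mulVec w, ?_⟩
    simp [Matrix.mulVec_mulVec, Matrix.mul_nonsing_inv R (Ne.isUnit hR)]
  have := LinearMap.finrank_range_add_finrank_ker φ
  rw [hk, LinearMap.range_eq_top.mpr hs] at this
  simp at this
  omega
lemma exists_rows {n : ℕ} (G B0 : Set (Fin n → ℂ)) (hB : B0 ⊆ G) (hB0 : LinearIndepOn ℂ id B0) :
    ∃ (S : Finset (Fin n)) (R : Matrix (Fin n) (Fin n) ℂ), R.det ≠ 0 ∧ (∀ i ∈ S, R i ∈ G) ∧
      (∀ x ∈ B0, ∃ i ∈ S, R i = x) ∧ ∀ g ∈ G, g ∈ Submodule.span ℂ (R '' S) := by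
  classical
  obtain ⟨B, hBG, hBB, hsp, hli⟩ := exists_linearIndepOn_id_extension hB0 hB
  obtain ⟨B', -, hBB', hsp', hli'⟩ := exists_linearIndepOn_id_extension hli (subset_univ B)
  let b : Module.Basis B' ℂ (Fin n → ℂ) := Module.Basis.mk hli' (by
    intro x _; simpa using hsp' (mem_univ x))
  have : Fintype B' := @Fintype.ofFinite _ (Module.Finite.finite_basis b)
  have hc : Fintype.card B' = n := by
    rw [← Module.finrank_eq_card_basis b]; simp
  let e : Fin n ≃ B' := (Fintype.equivFinOfCardEq hc).symm
  let R : Matrix (Fin n) (Fin n) ℂ := fun i => (e i : Fin n → ℂ)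
  have hR : LinearIndependent ℂ R := hli'.comp e e.injective
  refine ⟨Finset.univ.filter (fun i => R i ∈ B), R, ?_, ?_, ?_, ?_⟩
  · intro h
    have := (Matrix.isUnit_iff_isUnit_det R).mp (Matrix.linearIndependent_rows_iff_isUnit.mp hR)
    rw [h] at this
    simp at this
  · intro i hi; exact hBG (by simpa using hi)
  · intro x hx
    refine ⟨e.symm ⟨x, hBB' (hBB hx)⟩, ?_, ?_⟩ <;> simp [R, hBB hx]
  · intro g hg
    refine Submodule.span_mono ?_ (hsp hg)
    intro x hx
    refine ⟨e.symm ⟨x, hBB' hx⟩, ?_, ?_⟩ <;> simp [R, hx]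
def kerRows {n : ℕ} (R : Matrix (Fin n) (Fin n) ℂ) (S : Finset (Fin n)) : Submodule ℂ (Fin n → ℂ) :=
  ⨅ i ∈ S, LinearMap.ker ((LinearMap.proj i : (Fin n → ℂ) →ₗ[ℂ] ℂ) ∘ₗ R.mulVecLin)
lemma mem_kerRows {n : ℕ} (R : Matrix (Fin n) (Fin n) ℂ) (S : Finset (Fin n)) (v : Fin n → ℂ) :
    v ∈ kerRows R S ↔ ∀ i ∈ S, R.mulVec v i = 0 := by
  simp [kerRows, Submodule.mem_iInf]
lemma eval_dv_eq_sum_hom {n : ℕ} (f : Po n) (a v : Fin n → ℂ) :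
    eval a (dv v f) = ∑ k ∈ Finset.range (f.totalDegree + 1), eval a (dv v (homogeneousComponent k f)) := by
  conv_lhs => rw [← sum_homogeneousComponent f]
  simp [map_sum]
def jac {n : ℕ} (g : Fin n → Po n) : Matrix (Fin n) (Fin n) (Po n) := Matrix.of fun i j => pderiv j (g i)
lemma fields {n d : ℕ} {I : Ideal (Po n)} (hI : Good d I) {a0 : Fin n → ℂ} (ha0 : a0 ∈ Zl I) (ha : a0 ≠ 0)
    (Bs : Set (Fin n → ℂ)) (hBs : LinearIndepOn ℂ id Bs)
    (hBT : ∀ s ∈ Bs, ∀ v ∈ Tan I a0, ∑ i, s i * v i = 0) :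
    ∃ (S : Finset (Fin n)) (g : Fin n → Po n) (e : Fin n → ℕ), (∀ i, (g i).IsHomogeneous (e i + 1)) ∧
      (∀ i ∈ S, g i ∈ I ∨ ∃ s ∈ Bs, g i = lin s) ∧ (∀ i ∉ S, ∃ s, g i = lin s) ∧ (∀ i ∉ S, e i = 0) ∧ S.card + d = n ∧
      ((jac g).map (eval a0)).det ≠ 0 ∧ (∀ s ∈ Bs, ∃ i ∈ S, g i = lin s) := by
  classical
  let Gr : Set (Fin n → ℂ) := {w | ∃ f ∈ I, ∃ e, f.IsHomogeneous (e + 1) ∧ w = fun j => eval a0 (pderiv j f)}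
  obtain ⟨S, R, hR, hS, hBS, hsp⟩ := exists_rows (Bs ∪ Gr) Bs subset_union_left hBs
  have key : ∀ i, ∃ (g : Po n) (e : ℕ), g.IsHomogeneous (e + 1) ∧ (i ∈ S → (g ∈ I ∨ ∃ s ∈ Bs, g = lin s)) ∧
      (i ∉ S → e = 0 ∧ ∃ s, g = lin s) ∧ (∀ j, eval a0 (pderiv j g) = R i j) ∧ (R i ∈ Bs → g = lin (R i)) := by
    intro i
    by_cases h : i ∉ S ∨ R i ∈ Bs
    · refine ⟨lin (R i), 0, by simpa using isHomogeneous_lin _, fun hi => Or.inr ⟨R i, ?_, rfl⟩, fun _ => ⟨rfl, _, rfl⟩, ?_, fun _ => rfl⟩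
      · tauto
      · intro j; simp [pderiv_lin]
    · push Not at h
      obtain ⟨f, hf, e, he, hw⟩ := (hS i h.1).resolve_left h.2
      refine ⟨f, e, he, fun _ => Or.inl hf, fun hi => absurd h.1 hi, fun j => by rw [hw], fun hi => absurd hi h.2⟩
  choose g e hge hgS heS hgR hgB using key
  refine ⟨S, g, e, hge, hgS, fun i hi => (heS i hi).2, fun i hi => (heS i hi).1, ?_, ?_, ?_⟩
  · have := finrank_ker_rows R hR S (Tan I a0) (by
      intro v
      constructor
      · intro hv i hi
        rcases hS i hi with h | h
        · simpa [Matrix.mulVec, dotProduct] using hBT _ h v hv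
        · obtain ⟨f, hf, e, he, hw⟩ := h
          have := hv f hf
          rw [eval_dv] at this
          simpa [Matrix.mulVec, dotProduct, hw] using this
      · intro hv f hf
        rw [eval_dv_eq_sum_hom]
        apply Finset.sum_eq_zero
        intro k _
        rcases k with _ | k
        · rw [homogeneousComponent_zero]; simp [derivation_C]
        · have h1 := hsp _ (Or.inr ⟨_, hI.hom f hf (k+1), k, homogeneousComponent_isHomogeneous _ _, rfl⟩)
          rw [eval_dv]
          have h2 : ∀ w ∈ Submodule.span ℂ (R '' S), ∑ i, w i * v i = 0 := by
            intro w hw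
            induction hw using Submodule.span_induction with
            | mem x hx => obtain ⟨i, hi, rfl⟩ := hx; exact hv i hi
            | zero => simp
            | add x y _ _ hx hy => simp [add_mul, Finset.sum_add_distrib, hx, hy]
            | smul c x _ hx => simp [mul_assoc, ← Finset.mul_sum, hx]
          exact h2 _ h1)
    rw [hI.smooth a0 ha0 ha] at this
    omega
  · have : (jac g).map (eval a0) = R := by
      ext i j; simp [jac, hgR]
    rwa [this]
  · intro s hs
    obtain ⟨i, hi, rfl⟩ := hBS s hs
    exact ⟨i, hi, hgB i hs⟩
lemma tan_of_rows {n d : ℕ} {I : Ideal (Po n)} (hI : Good d I) {a : Fin n → ℂ} (ha0 : a ∈ Zl I) (ha : a ≠ 0)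
    (S : Finset (Fin n)) (hS : S.card + d = n) (R : Matrix (Fin n) (Fin n) ℂ) (hR : R.det ≠ 0)
    (hRT : ∀ i ∈ S, ∀ v ∈ Tan I a, R.mulVec v i = 0) (v : Fin n → ℂ) (hv : ∀ i ∈ S, R.mulVec v i = 0) :
    v ∈ Tan I a := by
  have h1 := finrank_ker_rows R hR S _ (mem_kerRows R S)
  have h2 : Tan I a ≤ kerRows R S := fun v hv => (mem_kerRows R S v).mpr (fun i hi => hRT i hi v hv)
  have h3 := hI.smooth a ha0 ha
  rw [Submodule.eq_of_le_of_finrank_eq h2 (by omega)]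
  exact (mem_kerRows R S v).mpr hv
lemma isHomogeneous_jac_adj {n : ℕ} (g : Fin n → Po n) (e : Fin n → ℕ) (hg : ∀ i, (g i).IsHomogeneous (e i + 1))
    (i : Fin n) (hi : e i = 0) (k : Fin n) : ((jac g).adjugate k i).IsHomogeneous (∑ j, e j) := by
  rw [Matrix.adjugate_apply, Matrix.det_apply]
  apply IsHomogeneous.sum
  intro σ _
  rw [Units.smul_def, zsmul_eq_mul]
  have : (((Equiv.Perm.sign σ : ℤˣ) : ℤ) : Po n) = C (((Equiv.Perm.sign σ : ℤˣ) : ℤ) : ℂ) := by simp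
  rw [this]
  apply IsHomogeneous.C_mul
  have hs : ∑ j, e j = ∑ j, e (σ j) := (Equiv.sum_comp σ e).symm
  rw [hs]
  apply IsHomogeneous.prod
  intro j _
  by_cases h : σ j = i
  · rw [h, hi, Matrix.updateRow_self]
    by_cases h' : j = k
    · subst h'; simp [isHomogeneous_one]
    · rw [Pi.single_apply, if_neg h']; exact isHomogeneous_zero _ _ _
  · rw [Matrix.updateRow_ne h]
    simpa [jac] using (hg (σ j)).pderiv (i := j)
lemma eval_jac_mulVec {n : ℕ} (g : Fin n → Po n) (a v : Fin n → ℂ) (i : Fin n) :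
    ((jac g).map (eval a)).mulVec v i = eval a (dv v (g i)) := by
  rw [eval_dv]; simp [Matrix.mulVec, dotProduct, jac]
lemma eval_jac_det {n : ℕ} (g : Fin n → Po n) (a : Fin n → ℂ) :
    ((jac g).map (eval a)).det = eval a (jac g).det := by
  rw [RingHom.map_det]; rfl
lemma pair {n d : ℕ} {I : Ideal (Po n)} (hI : Good d I) {a0 : Fin n → ℂ} (ha0 : a0 ∈ Zl I) (ha : a0 ≠ 0)
    (v : Fin n → ℂ) : ∃ (E : ℕ) (Δ : Po n) (θ : Derivation ℂ (Po n) (Po n)), θ ∈ DD I ∧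
      (∀ i, (θ (X i)).IsHomogeneous E) ∧ eval a0 Δ ≠ 0 ∧
      ∀ i, Δ * C (v i) - θ (X i) ∈ Ideal.span ((fun f => dv v f) '' I) := by
  classical
  have := hI.prime
  obtain ⟨S, g, e, hg, hgS, hgS', heS, hcard, hdet, -⟩ := fields hI ha0 ha ∅ (by simp) (by simp)
  have hgI : ∀ i ∈ S, g i ∈ I := fun i hi => by simpa using hgS i hi
  let M := jac g
  let u : Fin n → Po n := fun i => if i ∈ S then 0 else dv v (g i)
  let θ := mkDerivation ℂ (M.adjugate.mulVec u)
  have hMu : ∀ i, ∑ j, M i j * θ (X j) = M.det * u i := by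
    intro i
    have : M.mulVec (M.adjugate.mulVec u) = M.det • u := by
      rw [Matrix.mulVec_mulVec, Matrix.mul_adjugate, Matrix.smul_mulVec, Matrix.one_mulVec]
    have := congrFun this i
    simpa [Matrix.mulVec, dotProduct, θ] using this
  refine ⟨∑ j, e j, M.det, θ, ?_, ?_, ?_, ?_⟩
  · intro f hf
    obtain ⟨l, hl⟩ := Function.ne_iff.mp ha
    have h1 : θ f * M.det * X l ∈ I := by
      apply mem_of_Zl
      intro a haI
      rw [eval_mul, eval_mul]
      by_cases hΔ : eval a M.det = 0
      · simp [hΔ]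
      by_cases haz : a = 0
      · simp [haz]
      have : (fun i => eval a (θ (X i))) ∈ Tan I a := by
        apply tan_of_rows hI haI haz S hcard (M.map (eval a)) (by rwa [eval_jac_det])
        · intro i hi v hv
          rw [eval_jac_mulVec]
          exact hv _ (hgI i hi)
        · intro i hi
          have := congrArg (eval a) (hMu i)
          simp only [map_sum, eval_mul, u, if_pos hi, mul_zero, map_zero] at this
          simpa [Matrix.mulVec, dotProduct] using this
      have := this f hf
      rw [← eval_der] at this
      simp [this]
    rcases Ideal.IsPrime.mem_or_mem ‹_› h1 with h2 | h2
    · rcases Ideal.IsPrime.mem_or_mem ‹_› h2 with h3 | h3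
      · exact h3
      · exact absurd (ha0 _ h3) (by rwa [← eval_jac_det])
    · exact absurd (ha0 _ h2) (by simpa using hl)
  · intro k
    simp only [θ, mkDerivation_X, Matrix.mulVec, dotProduct]
    apply IsHomogeneous.sum
    intro i _
    by_cases hi : i ∈ S
    · simp [u, hi, isHomogeneous_zero]
    · obtain ⟨s, hs⟩ := hgS' i hi
      simp only [u, hi, if_false, hs, dv_apply, pderiv_lin]
      have : ∑ j, (C (s j) : Po n) * C (v j) = C (∑ j, s j * v j) := by simp
      rw [this, mul_comm]
      exact (isHomogeneous_jac_adj g e hg i (heS i hi) k).C_mul _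
  · rwa [← eval_jac_det]
  · intro k
    have h1 : M.det * C (v k) = ∑ i, M.adjugate k i * dv v (g i) := by
      have : M.adjugate.mulVec (M.mulVec (fun j => C (v j))) = M.det • (fun j => C (v j)) := by
        rw [Matrix.mulVec_mulVec, Matrix.adjugate_mul, Matrix.smul_mulVec, Matrix.one_mulVec]
      have := (congrFun this k).symm
      simp only [Pi.smul_apply, smul_eq_mul] at this
      rw [this]
      simp only [Matrix.mulVec, dotProduct]
      apply Finset.sum_congr rfl
      intro i _
      rw [dv_apply]; rfl
    have h2 : θ (X k) = ∑ i, M.adjugate k i * u i := by simp [θ, Matrix.mulVec, dotProduct]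
    rw [h1, h2, ← Finset.sum_sub_distrib]
    apply Ideal.sum_mem
    intro i _
    by_cases hi : i ∈ S
    · simp only [u, hi, if_true, mul_zero, sub_zero]
      exact Ideal.mul_mem_left _ _ (Ideal.subset_span ⟨_, hgI i hi, rfl⟩)
    · simp [u, hi]
def Mx {n : ℕ} (a : Fin n → ℂ) : Ideal (Po n) := RingHom.ker (eval a)
lemma mem_Mx {n : ℕ} {a : Fin n → ℂ} {f : Po n} : f ∈ Mx a ↔ eval a f = 0 := RingHom.mem_ker
lemma der_pow {R : Type} [CommRing R] [Algebra ℂ R] (δ : Derivation ℂ R R) (m : Ideal R) (j : ℕ) :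
    ∀ x ∈ m ^ (j+1), δ x ∈ m ^ j := by
  induction j with
  | zero => intro x _; simp
  | succ j ih =>
    intro x hx
    rw [pow_succ (n := j+1)] at hx
    induction hx using Submodule.mul_induction_on' with
    | mem_mul_mem x hx y hy =>
      rw [Derivation.leibniz, smul_eq_mul, smul_eq_mul]
      refine Ideal.add_mem _ (Ideal.mul_mem_right _ _ hx) ?_
      rw [mul_comm, pow_succ]
      exact Ideal.mul_mem_mul (ih x hx) hy
    | add x _ y _ hx hy => rw [map_add]; exact Ideal.add_mem _ hx hy
lemma der_pow' {R : Type} [CommRing R] [Algebra ℂ R] (η : Derivation ℂ R R) (m : Ideal R) (hη : ∀ x, η x ∈ m) (j : ℕ) :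
    ∀ x ∈ m ^ j, η x ∈ m ^ j := by
  induction j with
  | zero => intro x _; simp
  | succ j ih =>
    intro x hx
    rw [pow_succ] at hx
    induction hx using Submodule.mul_induction_on' with
    | mem_mul_mem x hx y hy =>
      rw [Derivation.leibniz, smul_eq_mul, smul_eq_mul, pow_succ]
      refine Ideal.add_mem _ (Ideal.mul_mem_mul hx (hη y)) ?_
      rw [mul_comm y]
      exact Ideal.mul_mem_mul (ih x hx) hy
    | add x _ y _ hx hy => rw [map_add]; exact Ideal.add_mem _ hx hy
lemma der_iter {R : Type} [CommRing R] [Algebra ℂ R] (δ : Derivation ℂ R R) (m : Ideal R) (i : ℕ) :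
    ∀ j, ∀ x ∈ m ^ (i + j), δ^[i] x ∈ m ^ j := by
  induction i with
  | zero => intro j x hx; simpa using hx
  | succ i ih =>
    intro j x hx
    rw [Function.iterate_succ_apply']
    apply der_pow
    apply ih
    convert hx using 2; omega
lemma der_iter_sub {R : Type} [CommRing R] [Algebra ℂ R] (δ δ' : Derivation ℂ R R) (m : Ideal R)
    (hη : ∀ x, (δ - δ') x ∈ m) (i : ℕ) :
    ∀ j, ∀ x ∈ m ^ (i + j), δ^[i] x - δ'^[i] x ∈ m ^ (j + 1) := by
  induction i with
  | zero => intro j x hx; simp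
  | succ i ih =>
    intro j x hx
    have e : i + 1 + j = i + (j + 1) := by omega
    rw [e] at hx
    rw [Function.iterate_succ_apply', Function.iterate_succ_apply']
    have h1 := der_pow δ m _ _ (ih (j+1) x hx)
    have h2 := der_pow' (δ - δ') m hη _ _ (der_iter δ' m i (j+1) x hx)
    have := Ideal.add_mem _ h1 h2
    simpa using this
lemma der_mem_of_X {n : ℕ} (η : Derivation ℂ (Po n) (Po n)) (m : Ideal (Po n)) (h : ∀ i, η (X i) ∈ m) (f : Po n) :
    η f ∈ m := by
  rw [der_apply]
  exact Ideal.sum_mem _ fun i _ => Ideal.mul_mem_left _ _ (h i)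
lemma dv_hom {n : ℕ} {F : Po n} {j : ℕ} (hF : F.IsHomogeneous (j+1)) (v : Fin n → ℂ) : (dv v F).IsHomogeneous j := by
  rw [dv_apply]
  apply IsHomogeneous.sum
  intro i _
  rw [mul_comm]
  exact (hF.pderiv (i := i)).C_mul _
lemma dv_iter_hom {n : ℕ} (v : Fin n → ℂ) (j : ℕ) : ∀ {F : Po n}, F.IsHomogeneous j →
    (dv v)^[j] F = C (j.factorial * eval v F) := by
  induction j with
  | zero =>
    intro F hF
    have h := totalDegree_eq_zero_iff_eq_C.mp (Nat.le_zero.mp hF.totalDegree_le)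
    rw [h]; simp
  | succ j ih =>
    intro F hF
    rw [Function.iterate_succ_apply, ih (dv_hom hF v)]
    congr 1
    have := congrArg (eval v) hF.sum_X_mul_pderiv
    rw [eval_dv, Nat.factorial_succ]
    simp at this
    simp_rw [mul_comm _ (v _)]
    rw [this]; push_cast; ring
lemma dv_smul_iter {n : ℕ} (v : Fin n → ℂ) (c : ℂ) (j : ℕ) (f : Po n) :
    ((c • dv v : Derivation ℂ (Po n) (Po n)))^[j] f = c ^ j • (dv v)^[j] f := by
  induction j with
  | zero => simp
  | succ j ih => rw [Function.iterate_succ_apply', ih, Function.iterate_succ_apply']; simp [pow_succ, smul_smul, mul_comm]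
lemma Mx_zero {n : ℕ} : Mx (0 : Fin n → ℂ) = idealOfVars (Fin n) ℂ := by
  ext f
  rw [mem_Mx, ← pow_one (idealOfVars (Fin n) ℂ), mem_pow_idealOfVars_iff']
  have : eval (0 : Fin n → ℂ) f = coeff 0 f := by
    rw [← constantCoeff_eq]; rw [← eval_zero]
  rw [this]
  constructor
  · intro h x hx
    have : x = 0 := by
      rw [← Finsupp.degree_eq_zero_iff]; omega
    rw [this, h]
  · intro h; exact h 0 (by simp)
lemma ofNull0 {n : ℕ} (j : ℕ) (f : Po n) (hf : f ∈ (Mx (0 : Fin n → ℂ))^j) (h : ∀ v, eval 0 ((dv v)^[j] f) = 0) :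
    f ∈ (Mx (0 : Fin n → ℂ))^(j+1) := by
  have h1 : f - homogeneousComponent j f ∈ (Mx (0 : Fin n → ℂ))^(j+1) := by
    rw [Mx_zero, mem_pow_idealOfVars_iff'] at *
    intro x hx
    rw [coeff_sub, coeff_homogeneousComponent]
    split_ifs with h
    · simp
    · rw [sub_zero]
      apply hf
      omega
  have h2 : homogeneousComponent j f = 0 := by
    apply MvPolynomial.funext
    intro v
    have h3 := der_iter (dv v) _ j 1 _ h1
    rw [pow_one, mem_Mx] at h3
    have h4 : (dv v)^[j] (f - homogeneousComponent j f) = (dv v)^[j] f - (dv v)^[j] (homogeneousComponent j f) :=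
      iterate_map_sub (dv v) j _ _
    rw [h4, map_sub, h, dv_iter_hom v j (homogeneousComponent_isHomogeneous j f)] at h3
    simp [Nat.factorial_ne_zero] at h3
    simpa using h3
  rwa [h2, sub_zero] at h1
def tr {n : ℕ} (a : Fin n → ℂ) : Po n →ₐ[ℂ] Po n := aeval (fun i => X i + C (a i))
lemma tr_tr {n : ℕ} (a b : Fin n → ℂ) (hab : a + b = 0) (f : Po n) : tr a (tr b f) = f := by
  have : (tr a).comp (tr b) = AlgHom.id ℂ (Po n) := by
    ext i
    simp only [tr, AlgHom.comp_apply, aeval_X, map_add, AlgHom.id_apply]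
    have := congrFun hab i
    simp only [Pi.add_apply, Pi.zero_apply] at this
    rw [← algebraMap_eq, AlgHom.commutes, add_assoc, ← map_add, this]; simp
  exact DFunLike.congr_fun this f
lemma eval_aev {n : ℕ} {σ : Type} (p : σ → Po n) (c : Fin n → ℂ) (f : MvPolynomial σ ℂ) :
    eval c (aeval p f) = eval (fun i => eval c (p i)) f := by
  induction f using MvPolynomial.induction_on with
  | C c => rw [aeval_C]; simp
  | add p q hp hq => rw [map_add, map_add, hp, hq, map_add]
  | mul_X f i hf => rw [map_mul, map_mul, hf, aeval_X, map_mul, eval_X]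
lemma eval_tr {n : ℕ} (a c : Fin n → ℂ) (f : Po n) : eval c (tr a f) = eval (c + a) f := by
  rw [tr, eval_aev]; congr 2; ext i; simp
lemma dv_aeval {n : ℕ} (p : Fin n → Po n) (v w : Fin n → ℂ) (h : ∀ i, dv v (p i) = C (w i)) (f : Po n) :
    dv v (aeval p f) = aeval p (dv w f) := by
  induction f using MvPolynomial.induction_on with
  | C c => simp [derivation_C]
  | add p q hp hq => simp only [map_add, hp, hq]
  | mul_X f i hf =>
    have : dv w (X i) = C (w i) := by simp [dv]
    rw [map_mul, aeval_X, Derivation.leibniz, Derivation.leibniz, hf, h, this]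
    simp only [smul_eq_mul, map_add, map_mul, aeval_X, aeval_C, algebraMap_eq]
lemma tr_pow {n : ℕ} (a c : Fin n → ℂ) (j : ℕ) (f : Po n) (hf : f ∈ (Mx (c + a))^j) : tr a f ∈ (Mx c)^j := by
  have h1 : (Mx (c + a)).map (tr a) ≤ Mx c := by
    rw [Ideal.map_le_iff_le_comap]
    intro f hf
    rw [Ideal.mem_comap, mem_Mx, eval_tr]
    exact mem_Mx.mp hf
  have h2 := Ideal.mem_map_of_mem (tr a) hf
  rw [Ideal.map_pow] at h2
  exact Ideal.pow_right_mono h1 j h2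
lemma ofNull {n : ℕ} (a : Fin n → ℂ) (j : ℕ) (f : Po n) (hf : f ∈ (Mx a)^j) (h : ∀ v, eval a ((dv v)^[j] f) = 0) :
    f ∈ (Mx a)^(j+1) := by
  have h1 := ofNull0 j (tr a f) (tr_pow a 0 j f (by rwa [zero_add])) (by
    intro v
    have h2 : (dv v)^[j] (tr a f) = tr a ((dv v)^[j] f) := by
      have : Function.Semiconj (tr a) (dv v) (dv v) := fun f => (dv_aeval _ v v (by intro i; simp [dv, derivation_C]) f).symm
      exact (this.iterate_right j f).symm
    rw [h2, eval_tr, zero_add, h])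
  have h2 := tr_pow (-a) a (j+1) (tr a f) (by simpa using h1)
  rwa [tr_tr _ _ (by simp)] at h2
lemma alg_sub_mem {n : ℕ} (π : Po n →ₐ[ℂ] Po n) (J : Ideal (Po n)) (h : ∀ i, X i - π (X i) ∈ J) (f : Po n) : f - π f ∈ J := by
  have : (Ideal.Quotient.mkₐ ℂ J) = (Ideal.Quotient.mkₐ ℂ J).comp π := by
    ext i
    exact Ideal.Quotient.eq.mpr (h i)
  exact Ideal.Quotient.eq.mp (DFunLike.congr_fun this f)
lemma alg_sub_pow {n : ℕ} (π : Po n →ₐ[ℂ] Po n) (J m : Ideal (Po n)) (h : ∀ i, X i - π (X i) ∈ J)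
    (hm : ∀ f ∈ m, π f ∈ m) (j : ℕ) : ∀ f ∈ m ^ (j+1), f - π f ∈ J * m ^ j := by
  have hmp : ∀ j, ∀ f ∈ m ^ j, π f ∈ m ^ j := by
    intro j f hf
    have h1 : m.map π ≤ m := by
      rw [Ideal.map_le_iff_le_comap]; intro f hf; exact hm f hf
    have h2 := Ideal.mem_map_of_mem π hf
    rw [Ideal.map_pow] at h2
    exact Ideal.pow_right_mono h1 j h2
  induction j with
  | zero => intro f _; simpa using alg_sub_mem π J h f
  | succ j ih =>
    intro f hf
    rw [pow_succ (n := j+1)] at hf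
    induction hf using Submodule.mul_induction_on' with
    | mem_mul_mem x hx y hy =>
      have e : x * y - π (x * y) = (x - π x) * y + (y - π y) * π x := by rw [map_mul]; ring
      rw [e]
      refine Ideal.add_mem _ ?_ (Ideal.mul_mem_mul (alg_sub_mem π J h y) (hmp _ x hx))
      rw [pow_succ, ← mul_assoc]
      exact Ideal.mul_mem_mul (ih x hx) hy
    | add x _ y _ hx hy => 
      rw [map_add, add_sub_add_comm]; exact Ideal.add_mem _ hx hy
lemma ann_grad {n : ℕ} (I : Ideal (Po n)) (a ℓ : Fin n → ℂ) (h : ∀ v ∈ Tan I a, ∑ i, ℓ i * v i = 0) :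
    ∃ f ∈ I, ∀ i, eval a (pderiv i f) = ℓ i := by
  let W : Submodule ℂ (Fin n → ℂ) :=
    { carrier := {w | ∃ f ∈ I, ∀ i, eval a (pderiv i f) = w i}
      add_mem' := by
        rintro w w' ⟨f, hf, h⟩ ⟨f', hf', h'⟩
        exact ⟨f + f', I.add_mem hf hf', fun i => by simp [h, h']⟩
      zero_mem' := ⟨0, I.zero_mem, fun i => by simp⟩
      smul_mem' := by
        rintro c w ⟨f, hf, h⟩
        exact ⟨C c * f, I.mul_mem_left _ hf, fun i => by simp [h, derivation_C, Derivation.leibniz]⟩ }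
  by_contra hne
  have hW : ℓ ∉ W := hne
  obtain ⟨φ, hφ, hφW⟩ := Submodule.exists_le_ker_of_notMem hW
  have hφs : ∀ w, φ w = ∑ i, w i * φ (Pi.single i 1) := by
    intro w
    conv_lhs => rw [pi_eq_sum_univ' w]
    simp
  apply hφ
  rw [hφs]
  apply h
  intro f hf
  rw [eval_dv]
  have : (fun i => eval a (pderiv i f)) ∈ LinearMap.ker φ := hφW ⟨f, hf, fun i => rfl⟩
  rw [LinearMap.mem_ker, hφs] at this
  exact this
lemma lemmaO {n : ℕ} (I : Ideal (Po n)) (a : Fin n → ℂ) (ha : a ∈ Zl I) (j : ℕ) (h : Po n) (hh : h ∈ Mx a ^ (j+1))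
    (hv : ∀ v ∈ Tan I a, eval a ((dv v)^[j+1] h) = 0) : h ∈ I ⊔ Mx a ^ (j+2) := by
  obtain ⟨P, hP1, hP2⟩ : ∃ P : (Fin n → ℂ) →ₗ[ℂ] (Fin n → ℂ), (∀ v, P v ∈ Tan I a) ∧ ∀ v ∈ Tan I a, P v = v := by
    obtain ⟨p, hp⟩ := (Tan I a).subtype.exists_leftInverse_of_injective (by simp)
    refine ⟨(Tan I a).subtype ∘ₗ p, fun v => by simp, fun v hv => ?_⟩
    have := LinearMap.congr_fun hp ⟨v, hv⟩
    simpa using congrArg Subtype.val this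
  let q : Fin n → Po n := fun i => C (a i) + ∑ k, C (P (Pi.single k 1) i) * (X k - C (a k))
  let π : Po n →ₐ[ℂ] Po n := aeval q
  have hq : ∀ v i, dv v (q i) = C (P v i) := by
    intro v i
    have : P v = ∑ k, v k • P (Pi.single k 1) := by
      conv_lhs => rw [pi_eq_sum_univ' v]
      simp
    rw [this]
    simp only [q, map_add, map_sum, Derivation.leibniz, dv, derivation_C, map_sub, mkDerivation_X]
    simp [mul_comm]
  have hqa : ∀ i, eval a (q i) = a i := by intro i; simp [q]
  have hπm : ∀ f ∈ Mx a, π f ∈ Mx a := by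
    intro f hf
    rw [mem_Mx, eval_aev, funext hqa]; exact hf
  have hXm : ∀ i, X i - π (X i) ∈ I ⊔ Mx a ^ 2 := by
    intro i
    let g := X i - π (X i)
    obtain ⟨f, hfI, hf⟩ := ann_grad I a (fun k => eval a (pderiv k g)) (by
      intro v hv
      rw [← eval_dv]
      have : dv v g = 0 := by
        simp only [g, map_sub, π, aeval_X, hq, hP2 v hv]
        simp [dv]
      rw [this, map_zero])
    have h1 : g - f ∈ Mx a ^ 2 := by
      apply ofNull a 1
      · rw [pow_one, mem_Mx, map_sub, ha f hfI]; simp [g, π, hqa]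
      · intro v
        simp only [Function.iterate_one, map_sub]
        rw [eval_dv v a f, eval_dv v a g]
        simp [hf]
    have : X i - π (X i) = f + (g - f) := by simp [g]
    rw [this]
    exact Submodule.add_mem_sup hfI h1
  have h1 := alg_sub_pow π _ _ hXm hπm j h hh
  have h2 : π h ∈ Mx a ^ (j+2) := by
    apply ofNull
    · have := hh
      have h1 : (Mx a).map π ≤ Mx a := by
        rw [Ideal.map_le_iff_le_comap]; intro f hf; exact hπm f hf
      have h2 := Ideal.mem_map_of_mem π hh
      rw [Ideal.map_pow] at h2
      exact Ideal.pow_right_mono h1 _ h2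
    · intro v
      have : Function.Semiconj π (dv (P v)) (dv v) := fun f => (dv_aeval _ v (P v) (hq v) f).symm
      rw [← this.iterate_right (j+1) h, eval_aev, funext hqa]
      exact hv _ (hP1 v)
  have h3 : h = (h - π h) + π h := by ring
  rw [h3]
  refine Ideal.add_mem _ ?_ (Ideal.mem_sup_right h2)
  rw [Ideal.sup_mul] at h1
  have h4 : I * Mx a ^ j ⊔ Mx a ^ 2 * Mx a ^ j ≤ I ⊔ Mx a ^ (j + 2) := by
    apply sup_le_sup Ideal.mul_le_left
    rw [← pow_add]; exact Ideal.pow_le_pow_right (by omega)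
  exact h4 h1
lemma hcore {n : ℕ} (P : Ideal (Po n)) (hP : P.IsPrime) :
    ∃ P' : Ideal (Po n), P' ≤ P ∧ P'.IsPrime ∧ Hmg P' ∧ ∀ f ∈ P, ∀ k, f.IsHomogeneous k → f ∈ P' := by
  let _ := MvPolynomial.gradedAlgebra (σ := Fin n) (R := ℂ)
  refine ⟨(P.homogeneousCore (homogeneousSubmodule (Fin n) ℂ)).toIdeal, Ideal.toIdeal_homogeneousCore_le _ _,
    hP.homogeneousCore, ?_, ?_⟩
  · intro f hf k
    exact homogeneousComponent_mem_of_mem (P.homogeneousCore _).isHomogeneous hf k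
  · intro f hf k hk
    exact Ideal.mem_homogeneousCore_of_homogeneous_of_mem ⟨k, hk⟩ hf
lemma hmg_of_comp {n : ℕ} {I : Ideal (Po n)} {f : Po n} (h : ∀ k, homogeneousComponent k f ∈ I) : f ∈ I := by
  rw [← sum_homogeneousComponent f]
  exact Ideal.sum_mem _ fun k _ => h k
lemma integral_const {F : Type} [Field F] [Algebra ℂ F] (y : F) (h : IsIntegral ℂ y) : ∃ c : ℂ, y = algebraMap ℂ F c := by
  obtain ⟨c, hc⟩ := (IsAlgClosed.algebraMap_bijective_of_isIntegral (k := ℂ) (K := integralClosure ℂ F)).2 ⟨y, h⟩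
  exact ⟨c, (congrArg Subtype.val hc).symm⟩
lemma trdeg_le_gen {k S : Type} [Field k] [CommRing S] [IsDomain S] [Algebra k S] (s G : Set S) (hG : adjoin k G = ⊤)
    (h : ∀ g ∈ G, IsAlgebraic (adjoin k s) g) : trdeg k S ≤ #s := by
  have : Algebra.IsAlgebraic (adjoin k s) S := by
    constructor
    intro x
    have h1 : adjoin k G ≤ (Subalgebra.algebraicClosure (adjoin k s) S).restrictScalars k :=
      Algebra.adjoin_le fun g hg => h g hg
    rw [hG] at h1
    exact h1 (Algebra.mem_top (x := x))
  exact IsAlgebraic.trdeg_le_cardinalMk k s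
lemma adjoin_quot {n : ℕ} (Q : Ideal (Po n)) : adjoin ℂ (range fun l => Ideal.Quotient.mk Q (X l)) = ⊤ := by
  rw [_root_.eq_top_iff]
  intro x _
  obtain ⟨f, rfl⟩ := Ideal.Quotient.mk_surjective x
  have h2 : (Ideal.Quotient.mkₐ ℂ Q) f ∈ (adjoin ℂ (range (X : Fin n → Po n))).map (Ideal.Quotient.mkₐ ℂ Q) := by
    rw [adjoin_range_X]; exact ⟨f, Algebra.mem_top, rfl⟩
  rw [AlgHom.map_adjoin, ← range_comp] at h2
  exact h2
lemma isAlg_of_mem {k S : Type} [Field k] [CommRing S] [IsDomain S] [Algebra k S] {A : Subalgebra k S} {x : S} (h : x ∈ A) :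
    IsAlgebraic A x := isAlgebraic_algebraMap (⟨x, h⟩ : A)
lemma negdeg0 {n : ℕ} {F : Type} [Field F] [Algebra ℂ F] (φ : Po n →ₐ[ℂ] F) (Q : Ideal (Po n))
    (hφ : ∀ f, φ f = 0 ↔ f ∈ Q) (N : Fin n → Po n) (q p K : ℕ)
    (hN : ∀ i, (N i).IsHomogeneous q) (hq : q + p = K) (hp : 1 ≤ p)
    (hrel : ∀ i l, N i * X l ^ K - N l * X i ^ K ∈ Q) (i0 : Fin n) (hi0 : X i0 ∉ Q) (hN0 : N i0 ∉ Q) :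
    ∃ c : Fin n → ℂ, ∀ l, X l ^ p - C (c l) * X i0 ^ p ∈ Q := by
  have hX0 : φ (X i0) ≠ 0 := by rwa [Ne, hφ]
  have hN0' : φ (N i0) ≠ 0 := by rwa [Ne, hφ]
  have hrel' : ∀ l, φ (N i0) * φ (X l) ^ K = φ (N l) * φ (X i0) ^ K := by
    intro l
    have := (hφ _).mpr (hrel i0 l)
    rw [map_sub, sub_eq_zero] at this
    simpa using this
  have key : ∀ l : Fin n, ∃ c : ℂ, φ (N i0 * X l ^ p) = algebraMap ℂ F c * φ (X i0 ^ K) := by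
    intro l
    let M : Submodule ℂ F := (homogeneousSubmodule (Fin n) ℂ (n * K)).map φ.toLinearMap
    have hM1 : M ≠ ⊥ := by
      rw [Submodule.ne_bot_iff]
      refine ⟨φ (X i0 ^ (n * K)), ⟨_, ?_, rfl⟩, ?_⟩
      · exact isHomogeneous_X_pow _ _
      · rw [map_pow]; exact pow_ne_zero _ hX0
    have hM2 : M.FG := by
      apply Submodule.FG.map
      exact homogeneousSubmodule_fg _ _ _
    obtain ⟨c, hc⟩ := integral_const (φ (N i0 * X l ^ p) / φ (X i0 ^ K)) (by
      refine isIntegral_of_smul_mem_submodule M hM1 hM2 _ ?_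
      rintro _ ⟨f, hf, rfl⟩
      change _ * φ f ∈ M
      have hf' : f.IsHomogeneous (n * K) := hf
      rw [f.as_sum, map_sum, Finset.mul_sum]
      apply Submodule.sum_mem
      intro x hx
      have hdeg := hf' (mem_support_iff.mp hx)
      have hK : 1 ≤ K := by omega
      obtain ⟨i, hi⟩ : ∃ i, K ≤ x i := by
        by_contra hcon
        push Not at hcon
        have h1 : ∑ i, x i < ∑ i : Fin n, K := Finset.sum_lt_sum_of_nonempty ⟨i0, Finset.mem_univ _⟩ (fun i _ => hcon i)
        rw [Finsupp.weight_apply, Finsupp.sum_fintype _ _ (by simp)] at hdeg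
        simp at hdeg h1
        omega
      let c := coeff x f
      have hle : Finsupp.single i K ≤ x := by simpa using hi
      have hx1 : x = Finsupp.single i K + (x - Finsupp.single i K) := (add_tsub_cancel_of_le hle).symm
      have hmon : monomial x c = X i ^ K * monomial (x - Finsupp.single i K) c := by
        rw [X_pow_eq_monomial, monomial_mul, one_mul, ← hx1]
      refine ⟨N i * X l ^ p * monomial (x - Finsupp.single i K) c, ?_, ?_⟩
      · have e : n * K = q + p + (n * K - K) := by
          have : K ≤ n * K := Nat.le_mul_of_pos_left K i0.pos
          omega
        rw [e]
        refine ((hN i).mul (isHomogeneous_X_pow _ _)).mul (isHomogeneous_monomial _ ?_)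
        rw [Finsupp.weight_apply, Finsupp.sum_fintype _ _ (by simp)] at hdeg
        have h2 : Finsupp.degree x = n * K := by rw [Finsupp.degree_eq_sum]; simpa using hdeg
        rw [hx1, map_add, Finsupp.degree_single] at h2
        omega
      · change φ _ = _ * φ (monomial x c)
        rw [hmon]
        simp only [map_mul, map_pow]
        have := hrel' i
        field_simp
        linear_combination (-(φ (X l) ^ p * φ (monomial (x - Finsupp.single i K) c))) * this)
    refine ⟨c, ?_⟩
    rw [← hc, div_mul_cancel₀]
    rw [map_pow]; exact pow_ne_zero _ hX0
  choose c hc using key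
  have hc0 : c i0 ≠ 0 := by
    intro h
    have := hc i0
    rw [h, map_zero, zero_mul, map_mul, map_pow] at this
    exact (mul_ne_zero hN0' (pow_ne_zero _ hX0)) this
  refine ⟨fun l => c l / c i0, fun l => ?_⟩
  · rw [← hφ]
    have h1 := hc l
    have h2 := hc i0
    simp only [map_mul, map_pow] at h1 h2
    have h3 : φ (C (c l / c i0)) = algebraMap ℂ F (c l) / algebraMap ℂ F (c i0) := by
      rw [← algebraMap_eq, AlgHom.commutes, map_div₀]
    have hc0' : algebraMap ℂ F (c i0) ≠ 0 := by simpa using hc0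
    have hz : φ (N i0) * (algebraMap ℂ F (c i0) * φ (X l) ^ p - algebraMap ℂ F (c l) * φ (X i0) ^ p) = 0 := by
      linear_combination algebraMap ℂ F (c i0) * h1 - algebraMap ℂ F (c l) * h2
    have hz' := (mul_eq_zero.mp hz).resolve_left hN0'
    rw [map_sub, map_mul, h3, map_pow, map_pow]
    field_simp
    linear_combination hz'
lemma exists_field_hom {n : ℕ} (Q : Ideal (Po n)) [Q.IsPrime] : ∃ (F : Type) (_ : Field F) (_ : Algebra ℂ F) (φ : Po n →ₐ[ℂ] F),
    ∀ f, φ f = 0 ↔ f ∈ Q := by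
  refine ⟨FractionRing (Po n ⧸ Q), inferInstance, inferInstance,
    (IsScalarTower.toAlgHom ℂ (Po n ⧸ Q) (FractionRing (Po n ⧸ Q))).comp (Ideal.Quotient.mkₐ ℂ Q), ?_⟩
  intro f
  rw [← Ideal.Quotient.eq_zero_iff_mem]
  exact map_eq_zero_iff _ (IsFractionRing.injective (Po n ⧸ Q) (FractionRing (Po n ⧸ Q)))
lemma trdeg_le_one {S ι : Type} [CommRing S] [IsDomain S] [Algebra ℂ S] (x : ι → S) (hx : adjoin ℂ (range x) = ⊤) (i0 : ι) (p : ℕ)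
    (hp : 1 ≤ p) (c : ι → ℂ) (h : ∀ l, x l ^ p = algebraMap ℂ S (c l) * x i0 ^ p) : trdeg ℂ S ≤ 1 := by
  have h1 := trdeg_le_gen (k := ℂ) {x i0} (range x) hx (by
    rintro _ ⟨l, rfl⟩
    apply IsAlgebraic.of_pow (n := p) (by omega)
    rw [h]
    apply isAlg_of_mem
    exact Subalgebra.mul_mem _ (Subalgebra.algebraMap_mem _ (c l)) (Subalgebra.pow_mem _ (subset_adjoin (mem_singleton _)) _))
  rwa [mk_singleton] at h1
lemma negdeg {n : ℕ} (Q : Ideal (Po n)) [Q.IsPrime] (htd : (2 : Cardinal) ≤ trdeg ℂ (Po n ⧸ Q)) (N : Fin n → Po n) (q p K : ℕ)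
    (hN : ∀ i, (N i).IsHomogeneous q) (hq : q + p = K) (hp : 1 ≤ p)
    (hrel : ∀ i l, N i * X l ^ K - N l * X i ^ K ∈ Q) (i0 : Fin n) (hi0 : X i0 ∉ Q) : N i0 ∈ Q := by
  by_contra hN0
  obtain ⟨F, _, _, φ, hφ⟩ := exists_field_hom Q
  obtain ⟨c, hc⟩ := negdeg0 φ Q hφ N q p K hN hq hp hrel i0 hi0 hN0
  have h1 : trdeg ℂ (Po n ⧸ Q) ≤ 1 := by
    refine trdeg_le_one _ (adjoin_quot Q) i0 p hp c ?_
    intro l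
    have h2 := Ideal.Quotient.eq.mpr (hc l)
    rw [map_pow, map_mul, map_pow] at h2
    exact h2
  exact absurd (htd.trans h1) (by norm_num)
lemma trdeg_comap {n : ℕ} {p Q : Ideal (Po n)} (h : p ≤ Q) : trdeg ℂ (Po n ⧸ Q) = trdeg ℂ ((Po n ⧸ p) ⧸ Q.map (Ideal.Quotient.mkₐ ℂ p)) :=
  (DoubleQuot.quotQuotEquivQuotOfLEₐ ℂ h).trdeg_eq.symm
lemma trdeg_quot_mono {n : ℕ} {p Q : Ideal (Po n)} (h : p ≤ Q) : trdeg ℂ (Po n ⧸ Q) ≤ trdeg ℂ (Po n ⧸ p) :=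
  trdeg_le_of_surjective (Ideal.Quotient.factorₐ ℂ h) (Ideal.Quotient.factor_surjective h)
lemma pit_poly {n m : ℕ} (p P : Ideal (Po n)) [p.IsPrime] [P.IsPrime] (hpP : p ≤ P) (x : Fin m → Po n) (hx : ∀ i, x i ∈ P) :
    ∃ Q : Ideal (Po n), Q.IsPrime ∧ p ≤ Q ∧ Q ≤ P ∧ (∀ i, x i ∈ Q) ∧ trdeg ℂ (Po n ⧸ p) ≤ trdeg ℂ (Po n ⧸ Q) + m := by
  let π := Ideal.Quotient.mkₐ ℂ p
  have hπ : Function.Surjective π := Ideal.Quotient.mkₐ_surjective ℂ p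
  have hker : RingHom.ker π ≤ P := by
    intro f hf; exact hpP (Ideal.Quotient.eq_zero_iff_mem.mp hf)
  have hP' : (P.map π).IsPrime := Ideal.map_isPrime_of_surjective hπ hker
  obtain ⟨Q', hQ', hle⟩ := Ideal.exists_minimalPrimes_le (I := Ideal.span (range fun i => π (x i))) (J := P.map π) (by
    rw [Ideal.span_le]; rintro _ ⟨i, rfl⟩; exact Ideal.mem_map_of_mem π (hx i))
  have hQp := hQ'.1.1
  have hcm : (Q'.comap π).map π = Q' := Ideal.map_comap_of_surjective π hπ Q'
  have hpc : p ≤ Q'.comap π := by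
    intro f hf
    rw [Ideal.mem_comap]
    have : π f = 0 := Ideal.Quotient.eq_zero_iff_mem.mpr hf
    rw [this]; exact Q'.zero_mem
  refine ⟨Q'.comap π, Ideal.IsPrime.comap π, hpc, ?_, ?_, ?_⟩
  · intro f hf
    have := hle (Ideal.mem_comap.mp hf)
    have h2 : f ∈ (P.map π).comap π := this
    rw [Ideal.comap_map_of_surjective π hπ] at h2
    exact (sup_le le_rfl hker : _ ≤ P) h2
  · intro i; exact hQ'.1.2 (Ideal.subset_span ⟨i, rfl⟩)
  · have h1 := pit_iter (k := ℂ) m (fun i => π (x i)) Q' hQ'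
    rw [trdeg_comap hpc]
    have e : trdeg ℂ ((Po n ⧸ p) ⧸ Ideal.map (Ideal.Quotient.mkₐ ℂ p) (Ideal.comap π Q')) = trdeg ℂ ((Po n ⧸ p) ⧸ Q') := by
      rw [show Ideal.map (Ideal.Quotient.mkₐ ℂ p) (Ideal.comap π Q') = Q' from hcm]
    rw [e]; exact h1

instance Mx_prime {n : ℕ} (a : Fin n → ℂ) : (Mx a).IsPrime := RingHom.ker_isPrime _
lemma dv_lin {n : ℕ} (v s : Fin n → ℂ) : dv v (lin s) = C (∑ i, s i * v i) := by
  rw [dv_apply]; simp [pderiv_lin]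
lemma kfield {n d c : ℕ} {I p : Ideal (Po n)} (hI : Good d I) [p.IsPrime] (hp : Hmg p) (hIp : I ≤ p) (s : Fin n → ℂ) (hs0 : s ≠ 0)
    (hs : ∀ a ∈ Zl p, a ≠ 0 → ∀ v ∈ Tan I a, ∑ i, s i * v i = 0) (hc : c + d = n) (htd : ((c + 1 : ℕ) : Cardinal) ≤ trdeg ℂ (Po n ⧸ p))
    (a0 : Fin n → ℂ) (ha0 : a0 ∈ Zl p) (ha : a0 ≠ 0) (v : Fin n → ℂ) (hv : v ∈ Tan I a0) :
    ∃ Q : Ideal (Po n), Q.IsPrime ∧ Hmg Q ∧ p ≤ Q ∧ Q ≤ Mx a0 ∧ (2 : Cardinal) ≤ trdeg ℂ (Po n ⧸ Q) ∧ ∀ f ∈ I, dv v f ∈ Q := by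
  classical
  have haI : a0 ∈ Zl I := fun f hf => ha0 f (hIp hf)
  obtain ⟨S, g, e, hg, hgS, hgS', heS, hcard, hdet, hBs⟩ := fields hI haI ha {s} (.singleton hs0)
    (by rintro _ rfl; exact hs a0 ha0 ha)
  obtain ⟨i0, hi0, hgi0⟩ := hBs s rfl
  have hsv : ∑ i, s i * v i = 0 := hs a0 ha0 ha v hv
  have hgv : ∀ i ∈ S, dv v (g i) ∈ Mx a0 := by
    intro i hi
    rcases hgS i hi with h | ⟨_, rfl, h⟩
    · exact hv _ h
    · rw [h, dv_lin, hsv]; simp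
  have hc1 : (S.erase i0).card = c - 1 := by rw [Finset.card_erase_of_mem hi0]; omega
  have hcpos : 1 ≤ c := by have := Finset.card_pos.mpr ⟨i0, hi0⟩; omega
  let eq := (S.erase i0).equivFinOfCardEq hc1
  let x : Fin (c-1) → Po n := fun i => dv v (g (eq.symm i : Fin n))
  obtain ⟨Q', hQ'p, hpQ', hQ'M, hxQ', htd'⟩ := pit_poly p (Mx a0) ha0 x (by
    intro i
    exact hgv _ (Finset.mem_of_mem_erase (eq.symm i).2))
  obtain ⟨Q, hQQ', hQp, hQh, hQc⟩ := hcore Q' hQ'p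
  have hpQ : p ≤ Q := fun f hf => hmg_of_comp fun k => hQc _ (hpQ' (hp f hf k)) k (homogeneousComponent_isHomogeneous _ _)
  have hgQ : ∀ i ∈ S, dv v (g i) ∈ Q := by
    intro i hi
    by_cases h : i = i0
    · rw [h, hgi0, dv_lin, hsv]; simp
    · have := hxQ' (eq ⟨i, Finset.mem_erase.mpr ⟨h, hi⟩⟩)
      simp only [x, Equiv.symm_apply_apply] at this
      exact hQc _ this _ (dv_hom (hg i) v)
  refine ⟨Q, hQp, hQh, hpQ, hQQ'.trans hQ'M, ?_, ?_⟩
  · have h1 := htd.trans (htd'.trans (add_le_add_left (trdeg_quot_mono hQQ') _))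
    have h2 : ((c + 1 : ℕ) : Cardinal) = 2 + ((c-1 : ℕ) : Cardinal) := by
      have : c + 1 = 2 + (c - 1) := by omega
      rw [this]; push_cast; rfl
    rw [h2] at h1
    exact (Cardinal.add_le_add_iff_of_lt_aleph0 (Cardinal.natCast_lt_aleph0 (n := c-1))).mp h1
  · intro f hf
    obtain ⟨l, hl⟩ := Function.ne_iff.mp ha
    have h1 : dv v f * (jac g).det * X l ∈ Q := by
      apply mem_of_Zl
      intro a haQ
      rw [eval_mul, eval_mul]
      by_cases hΔ : eval a (jac g).det = 0
      · simp [hΔ]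
      by_cases haz : a = 0
      · simp [haz]
      have hap : a ∈ Zl p := fun f hf => haQ f (hpQ hf)
      have : v ∈ Tan I a := by
        apply tan_of_rows hI (fun f hf => haQ f (hpQ (hIp hf))) haz S hcard ((jac g).map (eval a)) (by rwa [eval_jac_det])
        · intro i hi v hv
          rw [eval_jac_mulVec]
          rcases hgS i hi with h | ⟨_, rfl, h⟩
          · exact hv _ h
          · rw [h, dv_lin, hs a hap haz v hv]; simp
        · intro i hi
          rw [eval_jac_mulVec]
          exact haQ _ (hgQ i hi)
      simp [this f hf]
    rcases Ideal.IsPrime.mem_or_mem hQp h1 with h2 | h2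
    · rcases Ideal.IsPrime.mem_or_mem hQp h2 with h3 | h3
      · exact h3
      · exact absurd (hQ'M (hQQ' h3)) (by rw [mem_Mx]; rwa [← eval_jac_det])
    · exact absurd (hQ'M (hQQ' h2)) (by rw [mem_Mx]; simpa using hl)
def comp {n : ℕ} (k : ℕ) (θ : Derivation ℂ (Po n) (Po n)) : Derivation ℂ (Po n) (Po n) :=
  mkDerivation ℂ (fun i => homogeneousComponent k (θ (X i)))
lemma comp_X {n : ℕ} (k : ℕ) (θ : Derivation ℂ (Po n) (Po n)) (i : Fin n) : comp k θ (X i) = homogeneousComponent k (θ (X i)) := by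
  simp [comp]
lemma hc_mul {n : ℕ} {f : Po n} {e : ℕ} (hf : f.IsHomogeneous e) (k : ℕ) (g : Po n) :
    homogeneousComponent (e + k) (f * g) = f * homogeneousComponent k g := by
  conv_lhs => rw [← sum_homogeneousComponent g]
  rw [Finset.mul_sum, map_sum]
  have h1 : ∀ i, homogeneousComponent (e + k) (f * homogeneousComponent i g) = if i = k then f * homogeneousComponent k g else 0 := by
    intro i
    have := homogeneousComponent_of_mem (m := e + k) (n := e + i) (hf.mul (homogeneousComponent_isHomogeneous i g))
    rw [this]
    by_cases h : i = k
    · simp [h]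
    · rw [if_neg h, if_neg]; omega
  rw [Finset.sum_congr rfl (fun i _ => h1 i), Finset.sum_ite_eq']
  split_ifs with h
  · rfl
  · rw [homogeneousComponent_eq_zero, mul_zero]; simp at h; omega
lemma comp_hom {n : ℕ} (k e : ℕ) (θ : Derivation ℂ (Po n) (Po n)) (f : Po n) (hf : f.IsHomogeneous (e+1)) :
    comp k θ f = homogeneousComponent (e + k) (θ f) := by
  rw [der_apply, der_apply θ, map_sum]
  apply Finset.sum_congr rfl
  intro i _
  rw [comp_X, smul_eq_mul, smul_eq_mul]
  exact (hc_mul (by simpa using hf.pderiv (i := i)) k _).symm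
lemma comp_DD {n : ℕ} {I : Ideal (Po n)} (hI : Hmg I) (k : ℕ) {θ : Derivation ℂ (Po n) (Po n)} (hθ : θ ∈ DD I) : comp k θ ∈ DD I := by
  intro f hf
  rw [← sum_homogeneousComponent f, map_sum]
  apply Ideal.sum_mem
  rintro (_ | e) _
  · rw [homogeneousComponent_zero, derivation_C]; exact I.zero_mem
  · rw [comp_hom k e θ _ (homogeneousComponent_isHomogeneous _ _)]
    exact hI _ (hθ _ (hI _ hf _)) _
lemma bfield {n d : ℕ} {I Q : Ideal (Po n)} (hI : Good d I) (hQ : Hmg Q) (hIQ : I ≤ Q) (v : Fin n → ℂ) (hv : ∀ f ∈ I, dv v f ∈ Q) :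
    ∃ (k : ℕ) (θ : Fin n → Derivation ℂ (Po n) (Po n)), (∀ i, θ i ∈ DD I) ∧ (∀ i l, (θ i (X l)).IsHomogeneous (k+1)) ∧
      ∀ i l, θ i (X l) - X i ^ (k+1) * C (v l) ∈ Q := by
  let b : Ideal (Po n) :=
    { carrier := {ρ | ∃ θ ∈ DD I, ∀ l, θ (X l) - ρ * C (v l) ∈ Q}
      add_mem' := by
        rintro ρ ρ' ⟨θ, hθ, h⟩ ⟨θ', hθ', h'⟩
        refine ⟨θ + θ', fun f hf => I.add_mem (hθ f hf) (hθ' f hf), fun l => ?_⟩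
        have := Q.add_mem (h l) (h' l)
        rw [Derivation.add_apply]
        convert this using 1; ring
      zero_mem' := ⟨0, fun f hf => by simp, fun l => by simp⟩
      smul_mem' := by
        rintro x ρ ⟨θ, hθ, h⟩
        refine ⟨x • θ, fun f hf => I.mul_mem_left _ (hθ f hf), fun l => ?_⟩
        have := Q.mul_mem_left x (h l)
        rw [Derivation.smul_apply]
        convert this using 1; simp only [smul_eq_mul]; ring }
  have hQb : Q ≤ b := fun ρ hρ => ⟨0, fun f hf => by simp, fun l => by
    simpa using Q.mul_mem_right _ hρ⟩
  have hrad : ∀ i : Fin n, X i ∈ b.radical := by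
    intro i
    apply mem_radical_of_Zl
    intro a hab
    by_cases ha : a = 0
    · simp [ha]
    obtain ⟨E, Δ, θ, hθ, -, hΔ, h⟩ := pair hI (a0 := a) (fun f hf => hab f (hQb (hIQ hf))) ha v
    refine absurd (hab Δ ⟨θ, hθ, fun l => ?_⟩) hΔ
    have h1 : Ideal.span ((fun f => dv v f) '' I) ≤ Q := by
      rw [Ideal.span_le]; rintro _ ⟨f, hf, rfl⟩; exact hv f hf
    have := Q.neg_mem (h1 (h l))
    convert this using 1; ring
  choose k hk using hrad
  have : ∀ i, ∃ θ : Derivation ℂ (Po n) (Po n), θ ∈ DD I ∧ (∀ l, (θ (X l)).IsHomogeneous (∑ i, k i+1)) ∧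
      ∀ l, θ (X l) - X i ^ (∑ i, k i+1) * C (v l) ∈ Q := by
    intro i
    have h1 : (X i : Po n) ^ (∑ i, k i+1) ∈ b := by
      apply Ideal.pow_mem_of_pow_mem _ (hk i)
      have := Finset.single_le_sum (f := k) (fun j _ => Nat.zero_le _) (Finset.mem_univ i)
      omega
    obtain ⟨θ, hθ, h⟩ := h1
    refine ⟨comp (∑ i, k i+1) θ, comp_DD hI.hom _ hθ, fun l => ?_, fun l => ?_⟩
    · rw [comp_X]; exact homogeneousComponent_isHomogeneous _ _
    · have := hQ _ (h l) (∑ i, k i+1)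
      rw [map_sub] at this
      rw [comp_X]
      convert this using 2
      rw [homogeneousComponent_eq_self]
      rw [mul_comm]
      exact (isHomogeneous_X_pow _ _).C_mul _
  choose θ h1 h2 h3 using this
  exact ⟨_, θ, h1, h2, h3⟩
lemma iter_hom {n : ℕ} (θ : Derivation ℂ (Po n) (Po n)) (k : ℕ) (h : ∀ l, (θ (X l)).IsHomogeneous (k+1)) (f : Po n)
    (hf : f.IsHomogeneous 1) (j : ℕ) : (θ^[j] f).IsHomogeneous (j * k + 1) := by
  induction j with
  | zero => simpa using hf
  | succ j ih =>
    rw [Function.iterate_succ_apply', der_apply]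
    apply IsHomogeneous.sum
    intro i _
    have := (ih.pderiv (i := i)).mul (h i)
    rw [smul_eq_mul]
    convert this using 1
    rw [Nat.add_sub_cancel]; ring
lemma iter_DD {n : ℕ} {I : Ideal (Po n)} {θ : Derivation ℂ (Po n) (Po n)} (hθ : θ ∈ DD I) (j : ℕ) {f : Po n} (hf : f ∈ I) :
    θ^[j] f ∈ I := by
  induction j with
  | zero => exact hf
  | succ j ih => rw [Function.iterate_succ_apply']; exact hθ _ ih
lemma tstep {n d c : ℕ} {I p : Ideal (Po n)} (hI : Good d I) [p.IsPrime] (hp : Hmg p) (hIp : I ≤ p) (s : Fin n → ℂ) (hs0 : s ≠ 0)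
    (hs : ∀ a ∈ Zl p, a ≠ 0 → ∀ v ∈ Tan I a, ∑ i, s i * v i = 0) (hc : c + d = n) (htd : ((c + 1 : ℕ) : Cardinal) ≤ trdeg ℂ (Po n ⧸ p))
    (j : ℕ) (hj : ∀ a ∈ Zl p, a ≠ 0 → lin s ∈ I ⊔ Mx a ^ (j+2)) (a0 : Fin n → ℂ) (ha0 : a0 ∈ Zl p) (ha : a0 ≠ 0) :
    lin s ∈ I ⊔ Mx a0 ^ (j+3) := by
  obtain ⟨g0, hg0, h0, hh0, hgh⟩ := Submodule.mem_sup.mp (hj a0 ha0 ha)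
  suffices h : h0 ∈ I ⊔ Mx a0 ^ (j+3) by
    rw [← hgh]; exact Ideal.add_mem _ (Ideal.mem_sup_left hg0) h
  apply lemmaO I a0 (fun f hf => ha0 f (hIp hf)) (j+1) h0 hh0
  intro v hv
  obtain ⟨Q, hQp, hQh, hpQ, hQM, hQ2, hQv⟩ := kfield hI hp hIp s hs0 hs hc htd a0 ha0 ha v hv
  obtain ⟨k, θ, hθI, hθh, hθQ⟩ := bfield hI hQh (hIp.trans hpQ) v hQv
  let N : Fin n → Po n := fun i => (θ i)^[j+2] (lin s)
  have hN : ∀ a ∈ Zl Q, ∀ g ∈ I, ∀ h ∈ Mx a ^ (j+2), g + h = lin s → ∀ i,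
      eval a (N i) = (a i ^ (k+1)) ^ (j+2) * eval a ((dv v)^[j+2] h) := by
    intro a haQ g hg h hh hgh i
    simp only [N]
    rw [← hgh, iterate_map_add, map_add, haQ _ (hpQ (hIp (iter_DD (hθI i) _ hg))), zero_add]
    have h1 := der_iter_sub (θ i) ((a i ^ (k+1)) • dv v) (Mx a) (by
      apply der_mem_of_X
      intro l
      rw [mem_Mx]
      have := haQ _ (hθQ i l)
      rw [map_sub, sub_eq_zero] at this
      simp only [Derivation.sub_apply, Derivation.smul_apply, map_sub, this, dv, mkDerivation_X, smul_eval]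
      simp) (j+2) 0 h hh
    rw [pow_one, mem_Mx, map_sub, sub_eq_zero] at h1
    rw [h1, dv_smul_iter, smul_eval]
  obtain ⟨l, hl⟩ := Function.ne_iff.mp ha
  have hNQ : N l ∈ Q := by
    refine negdeg Q hQ2 N ((j+2) * k + 1) (j + 1) ((j+2)*(k+1)) (fun i => iter_hom _ k (hθh i) _ (isHomogeneous_lin s) _)
      (by ring) (by omega) ?_ l (fun h => hl (by simpa using mem_Mx.mp (hQM h)))
    intro i l
    apply mem_of_Zl
    intro a haQ
    by_cases haz : a = 0
    · simp [haz]
    obtain ⟨g, hg, h, hh, hgh⟩ := Submodule.mem_sup.mp (hj a (fun f hf => haQ f (hpQ hf)) haz)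
    have h1 := hN a haQ g hg h hh hgh
    simp only [map_sub, map_mul, map_pow, eval_X, h1]
    ring
  have h1 := mem_Mx.mp (hQM hNQ)
  rw [hN a0 hQM g0 hg0 h0 hh0 hgh l] at h1
  exact (mul_eq_zero.mp h1).resolve_left (pow_ne_zero _ (pow_ne_zero _ hl))
lemma self_tan {n : ℕ} {I : Ideal (Po n)} (hI : Hmg I) {a : Fin n → ℂ} (ha : a ∈ Zl I) : a ∈ Tan I a := by
  intro f hf
  rw [eval_dv_eq_sum_hom]
  apply Finset.sum_eq_zero
  intro k _
  have := congrArg (eval a) (homogeneousComponent_isHomogeneous k f).sum_X_mul_pderiv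
  rw [eval_dv]
  simp only [map_sum, map_mul, eval_X, map_nsmul, ha _ (hI f hf k)] at this
  rw [← Finset.sum_congr rfl (fun i _ => mul_comm _ _), this]; simp
theorem tangency {n d c : ℕ} {I p : Ideal (Po n)} (hI : Good d I) [hpp : p.IsPrime] (hp : Hmg p) (hIp : I ≤ p) (s : Fin n → ℂ) (hs0 : s ≠ 0)
    (hs : ∀ a ∈ Zl p, a ≠ 0 → ∀ v ∈ Tan I a, ∑ i, s i * v i = 0) (hc : c + d = n) (htd : ((c + 1 : ℕ) : Cardinal) ≤ trdeg ℂ (Po n ⧸ p)) :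
    False := by
  have hIprime := hI.prime
  have hN : ∀ j, ∀ a ∈ Zl p, a ≠ 0 → lin s ∈ I ⊔ Mx a ^ (j+2) := by
    intro j
    induction j with
    | zero =>
      intro a ha haz
      have haI : a ∈ Zl I := fun f hf => ha f (hIp hf)
      apply lemmaO I a haI 0
      · rw [zero_add, pow_one, mem_Mx, eval_lin]
        exact hs a ha haz a (self_tan hI.hom haI)
      · intro v hv
        simp only [zero_add, Function.iterate_one, dv_lin, eval_C]
        exact hs a ha haz v hv
    | succ j ih => intro a ha haz; exact tstep hI hp hIp s hs0 hs hc htd j ih a ha haz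
  obtain ⟨a, ha, haz⟩ : ∃ a ∈ Zl p, a ≠ 0 := by
    by_contra hcon
    push Not at hcon
    have hX : ∀ i, X i ∈ p := by
      intro i
      apply mem_of_Zl
      intro a ha
      rw [hcon a ha]; simp
    have h1 := trdeg_le_gen (k := ℂ) (S := Po n ⧸ p) ∅ _ (adjoin_quot p) (by
      rintro _ ⟨l, rfl⟩
      change IsAlgebraic _ (Ideal.Quotient.mk p (X l))
      rw [Ideal.Quotient.eq_zero_iff_mem.mpr (hX l)]
      exact isAlgebraic_zero)
    rw [Cardinal.mk_eq_zero] at h1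
    have := htd.trans h1
    simp at this
  apply hs0
  apply hI.nondeg
  let R := Po n ⧸ I
  have hM : (Mx a).map (Ideal.Quotient.mk I) ≠ ⊤ := by
    have : ((Mx a).map (Ideal.Quotient.mk I)).IsPrime :=
      Ideal.map_isPrime_of_surjective Ideal.Quotient.mk_surjective (by
        rw [Ideal.mk_ker]; intro f hf; exact ha f (hIp hf))
    exact this.ne_top
  have h1 := Ideal.iInf_pow_eq_bot_of_isDomain _ hM
  rw [← Ideal.Quotient.eq_zero_iff_mem, ← Ideal.mem_bot, ← h1, Ideal.mem_iInf]
  intro j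
  obtain ⟨g, hg, h, hh, hgh⟩ := Submodule.mem_sup.mp (hN j a ha haz)
  rw [← hgh, map_add, Ideal.Quotient.eq_zero_iff_mem.mpr hg, zero_add, ← Ideal.map_pow]
  exact Ideal.mem_map_of_mem _ (Ideal.pow_le_pow_right (by omega) hh)
theorem tangency' {n d c : ℕ} {I p : Ideal (Po n)} (hI : Good d I) [p.IsPrime] (hp : Hmg p) (hIp : I ≤ p) (s : Fin n → ℂ) (hs0 : s ≠ 0)
    (hs : ∀ θ ∈ DD I, ∀ E, (∀ i, (θ (X i)).IsHomogeneous E) → ∑ i, C (s i) * θ (X i) ∈ p)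
    (hc : c + d = n) (htd : ((c + 1 : ℕ) : Cardinal) ≤ trdeg ℂ (Po n ⧸ p)) : False := by
  refine tangency hI hp hIp s hs0 ?_ hc htd
  intro a ha haz v hv
  have haI : a ∈ Zl I := fun f hf => ha f (hIp hf)
  obtain ⟨E, Δ, θ, h1, h2, h3, h4⟩ := pair hI haI haz v
  have h5 : ∀ i, eval a (θ (X i)) = eval a Δ * v i := by
    intro i
    have : Ideal.span ((fun f => dv v f) '' (I : Set (Po n))) ≤ Mx a := by
      rw [Ideal.span_le]
      rintro _ ⟨f, hf, rfl⟩
      exact hv f hf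
    have := this (h4 i)
    rw [mem_Mx] at this
    simp only [map_sub, map_mul, eval_C] at this
    exact (sub_eq_zero.mp this).symm
  have h6 := ha _ (hs θ h1 E h2)
  simp only [map_sum, map_mul, eval_C, h5] at h6
  have h7 : eval a Δ * ∑ i, s i * v i = 0 := by
    rw [← h6, Finset.mul_sum]; exact Finset.sum_congr rfl (fun i _ => by ring)
  exact (mul_eq_zero.mp h7).resolve_left h3
lemma int_map {S S' : Type} [CommRing S] [CommRing S'] [Algebra ℂ S] [Algebra ℂ S'] (π : S →ₐ[ℂ] S') (U : Subalgebra ℂ S)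
    (V : Subalgebra ℂ S') (h : U.map π ≤ V) {x : S} (hx : IsIntegral U x) : IsIntegral V (π x) := by
  obtain ⟨p, hp, hpx⟩ := hx
  let ρ : U →+* V := ((π.comp U.val).codRestrict V (fun u => h ⟨u, u.2, rfl⟩)).toRingHom
  refine ⟨p.map ρ, hp.map _, ?_⟩
  rw [Polynomial.eval₂_map]
  have : (algebraMap V S').comp ρ = (π : S →+* S').comp (algebraMap U S) := by ext u; rfl
  rw [this, ← AlgHom.coe_toRingHom, ← Polynomial.hom_eval₂, hpx, map_zero]
lemma exists_pt {S : Type} [CommRing S] [IsDomain S] [Algebra ℂ S] [FiniteType ℂ S] (g : S) (hg : g ≠ 0) :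
    ∃ ev : S →ₐ[ℂ] ℂ, ev g ≠ 0 := by
  let L := Localization.Away g
  have hinj : Function.Injective (algebraMap S L) := IsLocalization.injective L (powers_le_nonZeroDivisors_of_noZeroDivisors hg)
  have : Nontrivial L := hinj.nontrivial
  obtain ⟨M, hM⟩ := Ideal.exists_maximal L
  let _ := Ideal.Quotient.field M
  have : FiniteType S L := IsLocalization.finiteType_of_monoid_fg (Submonoid.powers g) L
  have : FiniteType ℂ L := FiniteType.trans (S := S) inferInstance inferInstance
  have : FiniteType ℂ (L ⧸ M) := FiniteType.of_surjective (Ideal.Quotient.mkₐ ℂ M) (Ideal.Quotient.mkₐ_surjective _ _)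
  have : Module.Finite ℂ (L ⧸ M) := finite_of_finite_type_of_isJacobsonRing ℂ (L ⧸ M)
  let e := AlgEquiv.ofBijective (Algebra.ofId ℂ (L ⧸ M)) (IsAlgClosed.algebraMap_bijective_of_isIntegral (k := ℂ) (K := L ⧸ M))
  refine ⟨(e.symm : (L ⧸ M) →ₐ[ℂ] ℂ).comp ((Ideal.Quotient.mkₐ ℂ M).comp (IsScalarTower.toAlgHom ℂ S L)), ?_⟩
  have hu : IsUnit (algebraMap S L g) := IsLocalization.Away.algebraMap_isUnit g
  exact (hu.map ((e.symm : (L ⧸ M) →ₐ[ℂ] ℂ).comp (Ideal.Quotient.mkₐ ℂ M))).ne_zero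
lemma aeval_scale {σ : Type} {k : ℕ} {S : Type} [CommRing S] [Algebra ℂ S] {f : MvPolynomial σ ℂ} (hf : f.IsHomogeneous k) (c : S) (x : σ → S) :
    aeval (fun i => c * x i) f = c ^ k * aeval x f := by
  rw [aeval_def, aeval_def, eval₂_eq, eval₂_eq, Finset.mul_sum]
  refine Finset.sum_congr rfl fun m hm => ?_
  have h1 : ∑ i ∈ m.support, m i = k := by
    have := hf (mem_support_iff.mp hm)
    rw [← this]
    simp [Finsupp.weight_apply, Finsupp.sum]
  simp only [mul_pow, Finset.prod_mul_distrib, Finset.prod_pow_eq_pow_sum, h1]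
  ring
lemma aeval_hom {σ : Type} {S T : Type} [CommRing S] [Algebra ℂ S] [CommRing T] [Algebra ℂ T] (π : S →ₐ[ℂ] T) (x : σ → S) (f : MvPolynomial σ ℂ) :
    aeval (fun i => π (x i)) f = π (aeval x f) := (congrArg (fun g => g f) (comp_aeval x π)).symm
lemma trdeg_le_add_one {U S : Type} [CommRing S] [IsDomain S] [Algebra ℂ S] [CommRing U] [IsDomain U] [Algebra ℂ U] [Algebra U S]
    [IsScalarTower ℂ U S] [FaithfulSMul U S] (ε : S)
    (h : ∀ x : S, IsIntegral (adjoin U ({ε} : Set S)) x) : trdeg ℂ S ≤ trdeg ℂ U + 1 := by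
  rw [← _root_.trdeg_add_eq ℂ U (A := S)]
  gcongr
  have : Algebra.IsAlgebraic (adjoin U ({ε} : Set S)) S := ⟨fun x => (h x).isAlgebraic⟩
  calc trdeg U S ≤ #({ε} : Set S) := Algebra.IsAlgebraic.trdeg_le_cardinalMk _ _
    _ = 1 := by simp
lemma trdeg_le_add_zero {U S : Type} [CommRing S] [IsDomain S] [Algebra ℂ S] [CommRing U] [IsDomain U] [Algebra ℂ U] [Algebra U S]
    [IsScalarTower ℂ U S] [FaithfulSMul U S] (ε : S) (hε : IsAlgebraic U ε)
    (h : ∀ x : S, IsIntegral (adjoin U ({ε} : Set S)) x) : trdeg ℂ S ≤ trdeg ℂ U := by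
  rw [← _root_.trdeg_add_eq ℂ U (A := S)]
  have : Algebra.IsAlgebraic U (adjoin U ({ε} : Set S)) := by
    have hle : adjoin U ({ε} : Set S) ≤ Subalgebra.algebraicClosure U S :=
      Algebra.adjoin_le (by rintro _ rfl; exact hε)
    constructor
    rintro ⟨x, hx⟩
    have := hle hx
    exact (isAlgebraic_algebraMap_iff (A := S) Subtype.val_injective).mp this
  have : Algebra.IsAlgebraic (adjoin U ({ε} : Set S)) S := ⟨fun x => (h x).isAlgebraic⟩
  have : Algebra.IsAlgebraic U S := Algebra.IsAlgebraic.trans U (adjoin U ({ε} : Set S)) S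
  rw [_root_.trdeg_eq_zero (R := U) (A := S), add_zero]
lemma trdeg_adjoin_aeval {n : ℕ} {S : Type} [CommRing S] [Algebra ℂ S] (b : Fin n → S) :
    trdeg ℂ (adjoin ℂ (range b)) = trdeg ℂ (Po n ⧸ RingHom.ker (aeval b : Po n →ₐ[ℂ] S)) := by
  rw [Algebra.adjoin_range_eq_range_aeval]
  exact (Ideal.quotientKerEquivRange (aeval b : Po n →ₐ[ℂ] S)).trdeg_eq.symm
lemma key_end {n d c : ℕ} {I : Ideal (Po n)} (hI : Good d I) (hc : c + d = n) {S : Type} [CommRing S] [IsDomain S] [Algebra ℂ S]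
    (b : Fin n → S) (hb : ∀ f ∈ I, aeval b f = 0) (s : Fin n → ℂ) (hs0 : s ≠ 0)
    (hs : ∀ θ ∈ DD I, ∀ E, (∀ i, (θ (X i)).IsHomogeneous E) → ∑ i, algebraMap ℂ S (s i) * aeval b (θ (X i)) = 0)
    (htd : ((c + 1 : ℕ) : Cardinal) ≤ trdeg ℂ (adjoin ℂ (range b))) : False := by
  have hp : (RingHom.ker (aeval b : Po n →ₐ[ℂ] S)).IsPrime := RingHom.ker_isPrime _
  obtain ⟨p, hpP, hpp, hph, hpc⟩ := hcore (RingHom.ker (aeval b : Po n →ₐ[ℂ] S)) hp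
  rw [trdeg_adjoin_aeval] at htd
  refine tangency' hI hph ?_ s hs0 ?_ hc (htd.trans (trdeg_quot_mono hpP))
  · intro f hf
    apply hmg_of_comp
    intro k
    exact hpc _ (hb _ (hI.hom f hf k)) k (homogeneousComponent_isHomogeneous _ _)
  · intro θ hθ E hE
    refine hpc _ ?_ E (IsHomogeneous.sum _ _ _ fun i _ => (hE i).C_mul _)
    rw [RingHom.mem_ker]
    simpa [algebraMap_eq] using hs θ hθ E hE
lemma alg_eps {n k : ℕ} {U S F : Type} [CommRing S] [IsDomain S] [Algebra ℂ S] [Field F] [Algebra ℂ F] [CommRing U] [IsDomain U] [Algebra ℂ U]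
    [Algebra S F] [FaithfulSMul S F] [Algebra U F] [Algebra U S] [IsScalarTower U S F] [IsScalarTower ℂ S F] [IsScalarTower ℂ U S] [IsScalarTower ℂ U F]
    (b : Fin n → U) (ε : S) (z : Fin n → ℂ) (f : Po n) (hf : f.IsHomogeneous k) (hz : eval z f ≠ 0)
    (h : aeval (fun i => algebraMap U S (b i) - ε * algebraMap ℂ S (z i)) f = 0) : IsAlgebraic U ε := by
  by_cases hε : ε = 0
  · rw [hε]; exact isAlgebraic_zero
  have hinj := FaithfulSMul.algebraMap_injective S F
  have hε' : algebraMap S F ε ≠ 0 := by rwa [Ne, map_eq_zero_iff _ hinj]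
  rw [← isAlgebraic_algebraMap_iff (A := F) hinj]
  rw [← inv_inv (algebraMap S F ε)]
  apply IsAlgebraic.inv
  let q : Polynomial U := aeval (fun i => Polynomial.X * Polynomial.C (b i) - Polynomial.C (algebraMap ℂ U (z i))) f
  refine ⟨q, ?_, ?_⟩
  · intro h0
    have h1 : (Polynomial.aeval (0 : U)).restrictScalars ℂ q = 0 := by rw [h0, map_zero]
    rw [← aeval_hom] at h1
    have h2 : (fun i => ((Polynomial.aeval (0 : U)).restrictScalars ℂ) (Polynomial.X * Polynomial.C (b i) - Polynomial.C (algebraMap ℂ U (z i))))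
      = fun i => Algebra.ofId ℂ U ((-1) * z i) := by
      ext i; simp [Algebra.ofId_apply]
    rw [h2, aeval_hom] at h1
    have h3 := (map_eq_zero_iff _ (algebraMap ℂ U).injective).mp h1
    rw [aeval_scale hf, aeval_eq_eval] at h3
    rcases mul_eq_zero.mp h3 with h4 | h4
    · exact absurd h4 (by simp)
    · exact hz h4
  · have h1 : Polynomial.aeval (algebraMap S F ε)⁻¹ q = (Polynomial.aeval (algebraMap S F ε)⁻¹).restrictScalars ℂ q := rfl
    rw [h1, ← aeval_hom]
    have h2 : (fun i => ((Polynomial.aeval (algebraMap S F ε)⁻¹).restrictScalars ℂ) (Polynomial.X * Polynomial.C (b i) - Polynomial.C (algebraMap ℂ U (z i))))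
      = fun i => (algebraMap S F ε)⁻¹ * IsScalarTower.toAlgHom ℂ S F (algebraMap U S (b i) - ε * algebraMap ℂ S (z i)) := by
      ext i
      have h5 : algebraMap S F (algebraMap U S (b i)) = algebraMap U F (b i) := (IsScalarTower.algebraMap_apply U S F _).symm
      have h6 : algebraMap S F (algebraMap ℂ S (z i)) = algebraMap ℂ F (z i) := (IsScalarTower.algebraMap_apply ℂ S F _).symm
      have h7 : algebraMap U F (algebraMap ℂ U (z i)) = algebraMap ℂ F (z i) := (IsScalarTower.algebraMap_apply ℂ U F _).symm
      simp only [AlgHom.restrictScalars_apply, map_sub, map_mul, Polynomial.aeval_X, Polynomial.aeval_C, IsScalarTower.toAlgHom_apply, h5, h6, h7]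
      field_simp
    rw [h2, aeval_scale hf, aeval_hom, h, map_zero, mul_zero]
lemma fibre {S : Type} [CommRing S] [IsDomain S] [Algebra ℂ S] [FiniteType ℂ S] (W : Subalgebra ℂ S) [FiniteType ℂ W] (g : S) (hg : g ≠ 0) :
    ∃ (r : Ideal S), r.IsPrime ∧ g ∉ r ∧ trdeg ℂ S ≤ trdeg ℂ (S ⧸ r) + trdeg ℂ W ∧
      ∀ x, IsIntegral W x → ∃ c : ℂ, Ideal.Quotient.mk r x = algebraMap ℂ (S ⧸ r) c := by
  obtain ⟨N, t, ht, hti⟩ := exists_integral_inj_algHom_of_fg ℂ W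
  have hN : trdeg ℂ W = N := by
    rw [trdeg_of_isIntegral t ht hti]; simp
  obtain ⟨ev, hev⟩ := exists_pt g hg
  let x : Fin N → S := fun i => (t (X i) : S) - algebraMap ℂ S (ev (t (X i)))
  have hpr : (RingHom.ker ev).IsPrime := RingHom.ker_isPrime _
  obtain ⟨r, hr, hrM⟩ := Ideal.exists_minimalPrimes_le (I := Ideal.span (range x)) (J := RingHom.ker ev) (by
    rw [Ideal.span_le]; rintro _ ⟨i, rfl⟩; simp [x, RingHom.mem_ker])
  have hrp : r.IsPrime := hr.1.1
  refine ⟨r, hrp, fun h => hev (hrM h), ?_, ?_⟩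
  · rw [hN]; exact pit_iter N x r hr
  · have h1 : ∀ y, IsIntegral ℂ (Ideal.Quotient.mkₐ ℂ r y) → ∃ c : ℂ, Ideal.Quotient.mk r y = algebraMap ℂ (S ⧸ r) c := by
      intro y hy
      obtain ⟨c, hc⟩ := (IsAlgClosed.algebraMap_bijective_of_isIntegral (k := ℂ) (K := integralClosure ℂ (S ⧸ r))).2 ⟨_, hy⟩
      exact ⟨c, (congrArg Subtype.val hc).symm⟩
    have h2 : ∀ p : MvPolynomial (Fin N) ℂ, Ideal.Quotient.mk r (t p : S) ∈ (⊥ : Subalgebra ℂ (S ⧸ r)) := by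
      intro p
      have : (((Ideal.Quotient.mkₐ ℂ r).comp W.val).comp t) p ∈ (⊤ : Subalgebra ℂ (MvPolynomial (Fin N) ℂ)).map (((Ideal.Quotient.mkₐ ℂ r).comp W.val).comp t) :=
        ⟨p, Algebra.mem_top, rfl⟩
      rw [← adjoin_range_X, AlgHom.map_adjoin] at this
      refine (Algebra.adjoin_le ?_ : _ ≤ (⊥ : Subalgebra ℂ (S ⧸ r))) this
      rintro _ ⟨_, ⟨i, rfl⟩, rfl⟩
      rw [SetLike.mem_coe, Algebra.mem_bot]
      refine ⟨ev (t (X i)), ?_⟩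
      have := hr.1.2 (Ideal.subset_span ⟨i, rfl⟩)
      exact (Ideal.Quotient.eq.mpr this).symm
    intro y hy
    apply h1
    have h3 : W.map (Ideal.Quotient.mkₐ ℂ r) ≤ integralClosure ℂ (S ⧸ r) := by
      rintro _ ⟨u, hu, rfl⟩
      obtain ⟨p, hp, hpx⟩ := hti ⟨u, hu⟩
      have h4 : IsIntegral (⊥ : Subalgebra ℂ (S ⧸ r)) (Ideal.Quotient.mkₐ ℂ r u) := by
        let ρ : MvPolynomial (Fin N) ℂ →+* (⊥ : Subalgebra ℂ (S ⧸ r)) :=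
          ((((Ideal.Quotient.mkₐ ℂ r).comp W.val).comp t).codRestrict ⊥ h2).toRingHom
        refine ⟨p.map ρ, hp.map _, ?_⟩
        rw [Polynomial.eval₂_map]
        have h5 := congrArg ((Ideal.Quotient.mkₐ ℂ r).comp W.val) hpx
        rw [map_zero, ← AlgHom.coe_toRingHom, Polynomial.hom_eval₂] at h5
        exact h5
      exact isIntegral_trans (R := ℂ) (A := (⊥ : Subalgebra ℂ (S ⧸ r))) _ h4
    have h6 := int_map _ _ _ h3 hy
    exact isIntegral_trans (R := ℂ) (A := integralClosure ℂ (S ⧸ r)) _ h6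
lemma fibre' {S : Type} [CommRing S] [IsDomain S] [Algebra ℂ S] [FiniteType ℂ S] (W : Subalgebra ℂ S) [FiniteType ℂ W] (g : S) (hg : g ≠ 0) :
    ∃ (S' : Type) (_ : CommRing S') (_ : IsDomain S') (_ : Algebra ℂ S') (π : S →ₐ[ℂ] S'), Function.Surjective π ∧ π g ≠ 0 ∧
      trdeg ℂ S ≤ trdeg ℂ S' + trdeg ℂ W ∧ ∀ x, IsIntegral W x → ∃ c : ℂ, π x = algebraMap ℂ S' c := by
  obtain ⟨r, hrp, hgr, htr, hcon⟩ := fibre W g hg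
  exact ⟨S ⧸ r, inferInstance, inferInstance, inferInstance, Ideal.Quotient.mkₐ ℂ r, Ideal.Quotient.mkₐ_surjective _ _,
    fun h => hgr (Ideal.Quotient.eq_zero_iff_mem.mp h), htr, hcon⟩
lemma int_adj {U S S' : Type} [CommRing S] [CommRing S'] [Algebra ℂ S] [Algebra ℂ S'] (π : S →ₐ[ℂ] S') [CommRing U] [Algebra ℂ U]
    [Algebra U S'] [IsScalarTower ℂ U S'] (G : Set S) (e : S') (hG : ∀ y ∈ G, π y ∈ adjoin U ({e} : Set S')) {x : S}
    (hx : IsIntegral (adjoin ℂ G) x) : IsIntegral (adjoin U ({e} : Set S')) (π x) := by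
  have := int_map π _ ((adjoin U ({e} : Set S')).restrictScalars ℂ) (by
      rw [AlgHom.map_adjoin]
      apply Algebra.adjoin_le
      rintro _ ⟨y, hy, rfl⟩
      exact hG y hy) hx
  exact this
lemma key_fib {n d c : ℕ} {I : Ideal (Po n)} (hI : Good d I) (hc : c + d = n)
    {S : Type} [CommRing S] [IsDomain S] [Algebra ℂ S] [FiniteType ℂ S] (b w : Fin n → S) (ε : S)
    (hint : ∀ x : S, IsIntegral (adjoin ℂ (range b ∪ {ε} ∪ range w)) x)
    (hb : ∀ f ∈ I, aeval b f = 0) (hbw : ∀ f ∈ I, aeval (fun i => b i - ε * w i) f = 0)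
    (s : Fin n → S) (hsi : ∀ i, IsIntegral (adjoin ℂ (range w)) (s i))
    (hs : ∀ θ ∈ DD I, ∀ E, (∀ i, (θ (X i)).IsHomogeneous E) → ∑ i, s i * aeval b (θ (X i)) = 0)
    (g : S) (hg : g ≠ 0) (hg' : ∃ i, s i ∣ g) :
    ∃ u : ℕ, u ≤ c ∧ (trdeg ℂ S ≤ (u + 1 : ℕ) + trdeg ℂ (adjoin ℂ (range w))) ∧
      ∀ f0 ∈ I, ∀ k, f0.IsHomogeneous k → aeval w f0 ∣ g → trdeg ℂ S ≤ (u : ℕ) + trdeg ℂ (adjoin ℂ (range w)) := by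
  have hfW : FiniteType ℂ (adjoin ℂ (range w)) := by
    rw [← Subalgebra.fg_iff_finiteType]; exact ⟨(finite_range w).toFinset, by simp⟩
  obtain ⟨S', _, hdom, _, π, hπs, hgr, htr, hcon⟩ := fibre' (adjoin ℂ (range w)) g hg
  obtain ⟨i0, hi0⟩ := hg'
  choose cs hcs using fun i => hcon (s i) (hsi i)
  choose z hz using fun i => hcon (w i) (isIntegral_algebraMap (x := (⟨w i, Algebra.subset_adjoin ⟨i, rfl⟩⟩ : adjoin ℂ (range w))))
  have hcs0 : cs ≠ 0 := by
    intro h0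
    have h1 : π (s i0) = 0 := by
      rw [hcs, h0]; simp
    exact hgr (zero_dvd_iff.mp (h1 ▸ map_dvd π hi0))
  let b' : Fin n → S' := fun i => π (b i)
  let U := adjoin ℂ (range b')
  have hUf : FiniteType ℂ U := by
    rw [← Subalgebra.fg_iff_finiteType]; exact ⟨(finite_range b').toFinset, by simp [U]⟩
  obtain ⟨u, hu⟩ := exists_trdeg_nat (k := ℂ) (S := U)
  have hint' : ∀ x : S', IsIntegral (adjoin U ({π ε} : Set S')) x := by
    intro x
    obtain ⟨x, rfl⟩ := hπs x
    refine int_adj π _ (π ε) ?_ (hint x)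
    rintro y ((⟨i, rfl⟩ | hy) | ⟨i, rfl⟩)
    · exact Subalgebra.algebraMap_mem (adjoin U ({π ε} : Set S')) (⟨b' i, Algebra.subset_adjoin ⟨i, rfl⟩⟩ : U)
    · rw [mem_singleton_iff.mp hy]; exact Algebra.subset_adjoin rfl
    · rw [hz i, IsScalarTower.algebraMap_apply ℂ U S']; exact Subalgebra.algebraMap_mem _ _
  refine ⟨u, ?_, ?_, ?_⟩
  · by_contra hcu
    refine key_end hI hc b' ?_ cs hcs0 ?_ ?_
    · intro f hf
      rw [aeval_hom, hb f hf, map_zero]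
    · intro θ hθ E hE
      have := congrArg π (hs θ hθ E hE)
      rw [map_zero, map_sum] at this
      rw [← this]
      refine Finset.sum_congr rfl fun i _ => ?_
      rw [map_mul, aeval_hom, hcs]
    · change _ ≤ trdeg ℂ U
      rw [hu]; exact_mod_cast (by omega : c + 1 ≤ u)
  · have := trdeg_le_add_one (U := U) (π ε) hint'
    rw [hu] at this
    refine htr.trans ?_
    gcongr
    exact_mod_cast this
  · intro f0 hf0 k hk hdvd
    refine htr.trans ?_
    gcongr
    rw [← hu]
    refine trdeg_le_add_zero (U := U) (π ε) ?_ hint'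
    refine alg_eps (U := U) (F := FractionRing S') (fun i => ⟨b' i, Algebra.subset_adjoin ⟨i, rfl⟩⟩) (π ε) z f0 hk ?_ ?_
    · intro h0
      apply hgr
      have h9 : π (aeval w f0) = 0 := by
        rw [← aeval_hom, funext hz]
        have := aeval_hom (Algebra.ofId ℂ S') z f0
        rw [aeval_eq_eval, h0, map_zero] at this
        exact this
      exact zero_dvd_iff.mp (h9 ▸ map_dvd π hdvd)
    · have := congrArg π (hbw f0 hf0)
      rw [map_zero, ← aeval_hom] at this
      rw [← this]
      congr 2
      ext i
      rw [map_sub, map_mul, hz]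
      rfl
theorem keyK {n d c D : ℕ} {I : Ideal (Po n)} (hI : Good d I) (hc : c + d = n) (hD : trdeg ℂ (Po n ⧸ I) = D) (h32 : 2 * n ≤ 3 * d)
    (h2 : n + 2 ≤ 2 * d)
    {S : Type} [CommRing S] [IsDomain S] [Algebra ℂ S] [FiniteType ℂ S] (b w : Fin n → S) (ε : S)
    (hint : ∀ x : S, IsIntegral (adjoin ℂ (range b ∪ {ε} ∪ range w)) x)
    (htd : ((2 * D : ℕ) : Cardinal) ≤ trdeg ℂ S) (hw : trdeg ℂ (adjoin ℂ (range w)) + 1 ≤ n)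
    (hb : ∀ f ∈ I, aeval b f = 0) (hbw : ∀ f ∈ I, aeval (fun i => b i - ε * w i) f = 0)
    (s : Fin n → S) (hs0 : s ≠ 0) (hsi : ∀ i, IsIntegral (adjoin ℂ (range w)) (s i))
    (hs : ∀ θ ∈ DD I, ∀ E, (∀ i, (θ (X i)).IsHomogeneous E) → ∑ i, s i * aeval b (θ (X i)) = 0) : False := by
  have hDd : d ≤ D := by have := hI.dim; rw [hD] at this; exact_mod_cast this
  have hfW : FiniteType ℂ (adjoin ℂ (range w)) := by
    rw [← Subalgebra.fg_iff_finiteType]; exact ⟨(finite_range w).toFinset, by simp⟩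
  obtain ⟨N, hN⟩ := exists_trdeg_nat (k := ℂ) (S := adjoin ℂ (range w))
  rw [hN] at hw
  have hw' : N + 1 ≤ n := by exact_mod_cast hw
  obtain ⟨i0, hi0⟩ := Function.ne_iff.mp hs0
  by_cases hf0 : ∃ f0 ∈ I, aeval w f0 ≠ 0
  · obtain ⟨f1, hf1, hf1w⟩ := hf0
    obtain ⟨k, hk⟩ : ∃ k, aeval w (homogeneousComponent k f1) ≠ 0 := by
      by_contra! h
      apply hf1w
      rw [← sum_homogeneousComponent f1, map_sum]
      exact Finset.sum_eq_zero fun k _ => h k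
    obtain ⟨u, hu, -, h3⟩ := key_fib hI hc b w ε hint hb hbw s hsi hs (s i0 * aeval w (homogeneousComponent k f1)) (mul_ne_zero hi0 hk) ⟨i0, dvd_mul_right _ _⟩
    have h4 := htd.trans (h3 _ (hI.hom f1 hf1 k) k (homogeneousComponent_isHomogeneous _ _) (dvd_mul_left _ _))
    rw [hN] at h4
    have : 2 * D ≤ u + N := by exact_mod_cast h4
    omega
  · push Not at hf0
    obtain ⟨u, hu, h3, -⟩ := key_fib hI hc b w ε hint hb hbw s hsi hs (s i0) hi0 ⟨i0, dvd_rfl⟩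
    have h4 := htd.trans h3
    rw [hN] at h4
    have h5 : 2 * D ≤ u + 1 + N := by exact_mod_cast h4
    have h6 : N ≤ D := by
      have := trdeg_quot_mono (p := I) (Q := RingHom.ker (aeval w : Po n →ₐ[ℂ] S)) (fun f hf => hf0 f hf)
      rw [← trdeg_adjoin_aeval, hN, hD] at this
      exact_mod_cast this
    omega

structure Gen {n : ℕ} (I : Ideal (Po n)) (D : ℕ) (F : Type) [Field F] [Algebra ℂ F] (a b : Fin n → F) : Prop where
  va : ∀ f ∈ I, aeval a f = 0
  vb : ∀ f ∈ I, aeval b f = 0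
  frac : ∀ x : F, ∃ u ∈ adjoin ℂ (range a ∪ range b), ∃ v ∈ adjoin ℂ (range a ∪ range b), v ≠ 0 ∧ v * x = u
  td : ((2 * D : ℕ) : Cardinal) ≤ trdeg ℂ F
  der : ∀ θ ∈ DD I, ∃ δ : Derivation ℂ F F, (∀ i, δ (a i) = 0) ∧ ∀ i, δ (b i) = aeval b (θ (X i))
  mu : ∃ μ : F →ₐ[ℂ] FractionRing (Polynomial F), ∀ i, μ (a i) = algebraMap (Polynomial F) _ (Polynomial.X * Polynomial.C (a i)) ∧
    μ (b i) = algebraMap (Polynomial F) _ (Polynomial.X * Polynomial.C (b i))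
lemma chain_rule {σ : Type} [Fintype σ] {G M : Type} [CommRing G] [Algebra ℂ G] [AddCommGroup M] [Module G M] [Module ℂ M]
    (δ : Derivation ℂ G M) (y : σ → G) (P : MvPolynomial σ ℂ) : δ (aeval y P) = ∑ i, aeval y (pderiv i P) • δ (y i) := by
  classical
  induction P using MvPolynomial.induction_on with
  | C c => simp
  | add p q hp hq => simp [hp, hq, add_smul, Finset.sum_add_distrib]
  | mul_X p j hp =>
    simp only [Derivation.leibniz, hp, pderiv_X, add_smul, Finset.sum_add_distrib, smul_eq_mul, mul_smul, map_mul, map_add, aeval_X,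
      Finset.smul_sum]
    congr 1
    rw [Finset.sum_eq_single j]
    · simp
    · intro b _ hb; simp [hb.symm]
    · simp
lemma alg_of_frac {S F : Type} [CommRing S] [CommRing F] [Algebra S F] (x : F) (u v : S) (hv : algebraMap S F v ≠ 0)
    (h : algebraMap S F v * x = algebraMap S F u) : IsAlgebraic S x := by
  refine ⟨Polynomial.C v * Polynomial.X - Polynomial.C u, ?_, ?_⟩
  · intro h0
    have := congrArg (fun p => algebraMap S F (Polynomial.coeff p 1)) h0
    simp [Polynomial.coeff_C] at this
    exact hv this
  · simp [h]
lemma trdeg_alg {U S : Type} [CommRing S] [IsDomain S] [Algebra ℂ S] [CommRing U] [IsDomain U] [Algebra ℂ U] [Algebra U S]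
    [IsScalarTower ℂ U S] [FaithfulSMul U S] [Algebra.IsAlgebraic U S] : trdeg ℂ U = trdeg ℂ S := by
  rw [← _root_.trdeg_add_eq ℂ U (A := S), _root_.trdeg_eq_zero (R := U) (A := S), add_zero]
lemma trdeg_frac {F : Type} [Field F] [Algebra ℂ F] (S : Subalgebra ℂ F) (h : ∀ x : F, ∃ u ∈ S, ∃ v ∈ S, v ≠ 0 ∧ v * x = u) :
    trdeg ℂ S = trdeg ℂ F := by
  have : Algebra.IsAlgebraic S F := ⟨fun x => by
    obtain ⟨u, hu, v, hv, hv0, hx⟩ := h x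
    exact alg_of_frac x ⟨u, hu⟩ ⟨v, hv⟩ hv0 hx⟩
  exact trdeg_alg
lemma pderiv_lt {n : ℕ} (P : Po n) (hP : 0 < P.totalDegree) (i : Fin n) : (pderiv i P).totalDegree < P.totalDegree := by
  have h1 : pderiv i P = ∑ j ∈ Finset.range (P.totalDegree + 1), pderiv i (homogeneousComponent j P) := by
    conv_lhs => rw [← sum_homogeneousComponent P]
    rw [map_sum]
  rw [h1]
  refine lt_of_le_of_lt (totalDegree_finsetSum_le (d := P.totalDegree - 1) ?_) (by omega)
  intro j hj
  have h2 := (homogeneousComponent_isHomogeneous j P).pderiv (i := i)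
  have := h2.totalDegree_le
  simp at hj
  omega
lemma pderiv_all {n : ℕ} (P : Po n) (hP : 0 < P.totalDegree) (h : ∀ i, pderiv i P = 0) : False := by
  have h1 : ∑ j ∈ Finset.range (P.totalDegree + 1), j • homogeneousComponent j P = 0 := by
    have h2 : ∑ i, X i * pderiv i P = 0 := by simp [h]
    rw [← h2]
    have h3 : ∀ i, pderiv i P = ∑ j ∈ Finset.range (P.totalDegree + 1), pderiv i (homogeneousComponent j P) := by
      intro i
      conv_lhs => rw [← sum_homogeneousComponent P]
      rw [map_sum]
    simp only [h3, Finset.mul_sum]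
    rw [Finset.sum_comm]
    refine Finset.sum_congr rfl fun j _ => ?_
    rw [(homogeneousComponent_isHomogeneous j P).sum_X_mul_pderiv]
  have h4 := congrArg (homogeneousComponent P.totalDegree) h1
  rw [map_sum, map_zero, Finset.sum_eq_single P.totalDegree] at h4
  · rw [map_nsmul, homogeneousComponent_eq_self (homogeneousComponent_isHomogeneous _ _)] at h4
    have h5 : homogeneousComponent P.totalDegree P = 0 := by
      rcases smul_eq_zero.mp h4 with h | h
      · omega
      · exact h
    have h6 : P.totalDegree ≤ P.totalDegree - 1 := by
      have h7 := sum_homogeneousComponent P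
      rw [Finset.sum_range_succ, h5, add_zero] at h7
      conv_lhs => rw [← h7]
      refine totalDegree_finsetSum_le fun j hj => ?_
      have := (homogeneousComponent_isHomogeneous j P).totalDegree_le
      simp at hj
      omega
    omega
  · intro j _ hj
    rw [map_nsmul, homogeneousComponent_of_mem (homogeneousComponent_isHomogeneous j P), if_neg hj.symm, smul_zero]
  · simp
lemma exists_min_rel {n : ℕ} {S : Type} [CommRing S] [IsDomain S] [Algebra ℂ S] (w : Fin n → S) (h : ¬ Function.Injective (aeval w : Po n →ₐ[ℂ] S)) :
    ∃ P : Po n, aeval w P = 0 ∧ ∃ i, aeval w (pderiv i P) ≠ 0 := by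
  classical
  rw [injective_iff_map_eq_zero] at h
  push Not at h
  obtain ⟨P0, h1, h2⟩ := h
  have hex : ∃ k, ∃ P : Po n, aeval w P = 0 ∧ P ≠ 0 ∧ P.totalDegree = k := ⟨_, P0, h1, h2, rfl⟩
  obtain ⟨P, hP, hP0, hk⟩ := Nat.find_spec hex
  refine ⟨P, hP, ?_⟩
  by_contra! hcon
  have hpos : 0 < P.totalDegree := by
    by_contra! h0
    rw [Nat.le_zero, totalDegree_eq_zero_iff_eq_C] at h0
    rw [h0] at hP hP0
    simp only [aeval_C] at hP
    rw [map_eq_zero_iff _ (algebraMap ℂ S).injective] at hP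
    rw [hP] at hP0
    simp at hP0
  have hz : ∀ i, pderiv i P = 0 := by
    intro i
    by_contra hne
    have hlt : (pderiv i P).totalDegree < P.totalDegree := pderiv_lt P hpos i
    exact Nat.find_min hex (hk ▸ hlt) ⟨_, hcon i, hne, rfl⟩
  exact pderiv_all P hpos hz
theorem dominance {n d c D : ℕ} {I : Ideal (Po n)} (hI : Good d I) (hc : c + d = n) (hD : trdeg ℂ (Po n ⧸ I) = D) (h32 : 2 * n ≤ 3 * d)
    (h2 : n + 2 ≤ 2 * d) {F : Type} [Field F] [Algebra ℂ F] {a b : Fin n → F} (hG : Gen I D F a b) :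
    Function.Injective (aeval (b - a) : Po n →ₐ[ℂ] F) := by
  by_contra hinj
  obtain ⟨P, hP, i0, hi0⟩ := exists_min_rel _ hinj
  let S := adjoin ℂ (range a ∪ range b)
  have hSf : FiniteType ℂ S := by
    rw [← Subalgebra.fg_iff_finiteType]; exact ⟨((finite_range a).union (finite_range b)).toFinset, by simp [S]⟩
  let b' : Fin n → S := fun i => ⟨b i, Algebra.subset_adjoin (Or.inr ⟨i, rfl⟩)⟩
  let a' : Fin n → S := fun i => ⟨a i, Algebra.subset_adjoin (Or.inl ⟨i, rfl⟩)⟩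
  let w' : Fin n → S := b' - a'
  have hv : Function.Injective S.val := Subtype.val_injective
  have hwv : ∀ f : Po n, S.val (aeval w' f) = aeval (b - a) f := fun f => (aeval_hom S.val w' f).symm
  have hbv : ∀ f : Po n, S.val (aeval b' f) = aeval b f := fun f => (aeval_hom S.val b' f).symm
  have hav : ∀ f : Po n, S.val (aeval a' f) = aeval a f := fun f => (aeval_hom S.val a' f).symm
  refine keyK hI hc hD h32 h2 b' w' 1 ?_ (by rw [trdeg_frac S hG.frac]; exact hG.td) ?_ ?_ ?_ (fun i => aeval w' (pderiv i P)) ?_ ?_ ?_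
  · intro x
    have hx : x ∈ adjoin ℂ (range b' ∪ {1} ∪ range w') := by
      have h1 : (adjoin ℂ (range b' ∪ {1} ∪ range w')).map S.val = S := by
        apply le_antisymm
        · rintro _ ⟨y, _, rfl⟩; exact y.2
        · rw [AlgHom.map_adjoin]
          apply Algebra.adjoin_le
          rintro _ (⟨i, rfl⟩ | ⟨i, rfl⟩)
          · have h2 : a i = S.val (b' i) - S.val (w' i) := by simp [w', b', a']
            rw [h2]
            exact sub_mem (Algebra.subset_adjoin ⟨_, Or.inl (Or.inl ⟨i, rfl⟩), rfl⟩) (Algebra.subset_adjoin ⟨_, Or.inr ⟨i, rfl⟩, rfl⟩)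
          · exact Algebra.subset_adjoin ⟨b' i, Or.inl (Or.inl ⟨i, rfl⟩), rfl⟩
      have h3 : S.val x ∈ (adjoin ℂ (range b' ∪ {1} ∪ range w')).map S.val := by rw [h1]; exact x.2
      obtain ⟨y, hy, hyx⟩ := h3
      rwa [← hv hyx]
    exact isIntegral_algebraMap (x := (⟨x, hx⟩ : adjoin ℂ (range b' ∪ {1} ∪ range w')))
  · rw [trdeg_adjoin_aeval]
    have : (RingHom.ker (aeval w' : Po n →ₐ[ℂ] S)).IsPrime := RingHom.ker_isPrime _
    refine (trdeg_quot_lt (RingHom.ker (aeval w' : Po n →ₐ[ℂ] S)) ?_).trans (by simp)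
    intro h0
    apply hi0
    have hPk : P ∈ RingHom.ker (aeval w' : Po n →ₐ[ℂ] S) := by
      rw [RingHom.mem_ker]; apply hv; rw [hwv, hP, map_zero]
    rw [h0, Ideal.mem_bot] at hPk
    rw [hPk]; simp
  · intro f hf; apply hv; rw [hbv, hG.vb f hf, map_zero]
  · intro f hf; apply hv
    have : (fun i => b' i - 1 * w' i) = a' := by ext i; simp [w']
    rw [this, hav, hG.va f hf, map_zero]
  · intro h0
    apply hi0
    have := congrFun h0 i0
    rw [← hwv]
    exact congrArg S.val this
  · intro i
    have : aeval w' (pderiv i P) ∈ adjoin ℂ (range w') := by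
      rw [Algebra.adjoin_range_eq_range_aeval]; exact ⟨_, rfl⟩
    exact isIntegral_algebraMap (x := (⟨_, this⟩ : adjoin ℂ (range w')))
  · intro θ hθ E hE
    obtain ⟨δ, hδa, hδb⟩ := hG.der θ hθ
    apply hv
    rw [map_zero, map_sum]
    have := chain_rule δ (b - a) P
    rw [hP, map_zero] at this
    rw [this]
    refine Finset.sum_congr rfl fun i _ => ?_
    rw [map_mul, hwv, hbv, Pi.sub_apply, map_sub, hδa, hδb, sub_zero, smul_eq_mul]
def Qs {R : Type} [CommRing R] [Algebra ℂ R] (δ : Derivation ℂ R R) (x : R) (i : ℕ) : ℕ → Module.End ℂ R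
  | 0 => (δ : R →ₗ[ℂ] R) ^ i
  | k+1 => Qs δ x i k ∘ₗ LinearMap.mulLeft ℂ x - LinearMap.mulLeft ℂ x ∘ₗ Qs δ x i k
lemma Qs_succ {R : Type} [CommRing R] [Algebra ℂ R] (δ : Derivation ℂ R R) (x : R) (i k : ℕ) (y : R) :
    Qs δ x i (k+1) y = Qs δ x i k (x * y) - x * Qs δ x i k y := rfl
lemma Qs_rec {R : Type} [CommRing R] [Algebra ℂ R] (δ : Derivation ℂ R R) (x : R) (i k : ℕ) : ∀ y : R,
    Qs δ x (i+1) (k+1) y = (k + 1 : R) * Qs δ x i k (δ x * y) + Qs δ x i (k+1) (δ y) := by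
  have h0 : ∀ y, Qs δ x (i+1) 0 y = Qs δ x i 0 (δ y) := fun y => by
    show ((δ : R →ₗ[ℂ] R) ^ (i+1)) y = ((δ : R →ₗ[ℂ] R) ^ i) (δ y)
    rw [pow_succ]; rfl
  induction k with
  | zero =>
    intro y
    rw [Qs_succ, Qs_succ, h0, h0, Derivation.leibniz, map_add, smul_eq_mul, smul_eq_mul, mul_comm y]
    push_cast; ring
  | succ k ih =>
    intro y
    rw [Qs_succ, ih, ih, Qs_succ δ x i (k+1) (δ y), Derivation.leibniz, map_add, smul_eq_mul, smul_eq_mul, mul_comm y,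
      Qs_succ δ x i k (δ x * y), mul_left_comm x (δ x) y]
    push_cast; ring
lemma Qs_diag {R : Type} [CommRing R] [Algebra ℂ R] (δ : Derivation ℂ R R) (x : R) (i : ℕ) :
    (∀ y, Qs δ x i i y = (i.factorial : R) * δ x ^ i * y) ∧ ∀ k > i, ∀ y, Qs δ x i k y = 0 := by
  induction i with
  | zero =>
    constructor
    · intro y; simp [Qs]
    · intro k hk
      induction k, hk using Nat.le_induction with
      | base => intro y; simp [Qs]
      | succ k hk ih => intro y; rw [Qs_succ, ih, ih]; simp
  | succ i ih =>
    constructor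
    · intro y
      rw [Qs_rec, ih.1, ih.2 _ (Nat.lt_succ_self i), Nat.factorial_succ]
      push_cast; ring
    · intro k hk y
      obtain ⟨k, rfl⟩ : ∃ j, k = j + 1 := ⟨k - 1, by omega⟩
      rw [Qs_rec, ih.2 _ (by omega), ih.2 _ (by omega)]; simp
lemma Qs_mem {R : Type} [CommRing R] [Algebra ℂ R] (δ : Derivation ℂ R R) (T : Subalgebra ℂ R) (hT : ∀ y ∈ T, δ y ∈ T)
    (x v : R) (hv : ∀ j, v * x ^ j ∈ T) (i k : ℕ) : ∀ j l, v * x ^ j * Qs δ x i k (v * x ^ l) ∈ T := by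
  induction k with
  | zero =>
    intro j l
    have : ∀ i, ∀ y ∈ T, ((δ : R →ₗ[ℂ] R) ^ i) y ∈ T := by
      intro i
      induction i with
      | zero => intro y hy; simpa using hy
      | succ i ih => intro y hy; rw [pow_succ]; exact ih _ (hT _ hy)
    exact mul_mem (hv j) (this i _ (hv l))
  | succ k ih =>
    intro j l
    have h : v * x ^ j * Qs δ x i (k+1) (v * x ^ l) = v * x ^ j * Qs δ x i k (v * x ^ (l+1)) - v * x ^ (j+1) * Qs δ x i k (v * x ^ l) := by
      rw [Qs_succ, show x * (v * x ^ l) = v * x ^ (l+1) by ring]; ring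
    rw [h]
    exact sub_mem (ih _ _) (ih _ _)
lemma seidenberg {R : Type} [CommRing R] [IsDomain R] [Algebra ℂ R] (δ : Derivation ℂ R R) (T : Subalgebra ℂ R) [IsNoetherianRing T]
    (hT : ∀ y ∈ T, δ y ∈ T) (x v : R) (hv0 : v ≠ 0) (hv : ∀ j, v * x ^ j ∈ T) : IsIntegral T (δ x) := by
  have h1 : ∀ i, v * v * δ x ^ i ∈ T := by
    intro i
    have := Qs_mem δ T hT x v hv i i 0 0
    rw [(Qs_diag δ x i).1] at this
    have h2 := T.smul_mem this ((i.factorial : ℂ)⁻¹)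
    convert h2 using 1
    have h3 : (i.factorial : R) = algebraMap ℂ R (i.factorial : ℂ) := by simp
    rw [h3, Algebra.smul_def]
    have h4 : algebraMap ℂ R (i.factorial : ℂ)⁻¹ * algebraMap ℂ R (i.factorial : ℂ) = 1 := by
      rw [← map_mul, inv_mul_cancel₀ (by exact_mod_cast Nat.factorial_ne_zero i), map_one]
    linear_combination (-(v * v * δ x ^ i)) * h4
  have hvT : v * v ∈ T := by simpa using h1 0
  apply IsAlmostIntegral.isIntegral
  refine ⟨⟨v * v, hvT⟩, ?_, ?_⟩
  · rw [mem_nonZeroDivisors_iff_ne_zero]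
    intro h
    exact mul_ne_zero hv0 hv0 (congrArg Subtype.val h)
  · intro i
    exact ⟨⟨_, h1 i⟩, rfl⟩
lemma exists_coeffDer {F : Type} [CommRing F] [Algebra ℂ F] (δ : Derivation ℂ F F) :
    ∃ η : Derivation ℂ (Polynomial F) (Polynomial F), (∀ x, η (Polynomial.C x) = Polynomial.C (δ x)) ∧ η Polynomial.X = 0 := by
  refine ⟨(PolynomialModule.equivPolynomialSelf (R := F)).toLinearMap.compDer δ.mapCoeffs, fun x => ?_, ?_⟩
  · ext i
    show Polynomial.coeff (PolynomialModule.equivPolynomialSelf (δ.mapCoeffs (Polynomial.C x))) i = _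
    have : Polynomial.coeff (PolynomialModule.equivPolynomialSelf (δ.mapCoeffs (Polynomial.C x))) i = (δ.mapCoeffs (Polynomial.C x)).coeff i := rfl
    rw [this, Derivation.mapCoeffs_apply, Polynomial.coeff_C, Polynomial.coeff_C]
    split_ifs <;> simp
  · show PolynomialModule.equivPolynomialSelf (δ.mapCoeffs Polynomial.X) = 0
    simp
lemma pickP {F : Type} [Field F] [Algebra ℂ F] {n : ℕ} (B : Subalgebra ℂ F) [IsNoetherianRing B]
    (hBc : ∀ x : F, IsIntegral B x → (∃ q ∈ B, q ≠ 0 ∧ q * x ∈ B) → x ∈ B) (ψ : Fin n → F)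
    (hψd : ∃ q ∈ B, q ≠ 0 ∧ ∀ i, q * ψ i ∈ B) (hne : ¬ ∀ i, ψ i ∈ B) :
    ∃ (P : Ideal B) (_ : P.IsPrime) (t π : B) (s : Fin n → B), π ∈ P ∧ (∀ i, (s i : F) = π * t * ψ i) ∧ ∃ i, s i ∉ P := by
  classical
  let An : B → Ideal B := fun t =>
    { carrier := {q | ∀ i, (q : F) * (t * ψ i) ∈ B}
      add_mem' := fun {x y} hx hy i => by
        have := add_mem (hx i) (hy i); simpa [add_mul] using this
      zero_mem' := fun i => by simp
      smul_mem' := fun c x hx i => by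
        have := mul_mem c.2 (hx i); simpa [mul_assoc] using this }
  have hAn : ∀ t q, q ∈ An t ↔ ∀ i, (q : F) * (t * ψ i) ∈ B := fun t q => Iff.rfl
  obtain ⟨P, ⟨t, ht, rfl⟩, hmax⟩ := set_has_maximal_iff_noetherian.mpr (inferInstance : IsNoetherian B B)
    {J | ∃ t : B, (¬ ∀ i, (t : F) * ψ i ∈ B) ∧ J = An t} ⟨An 1, 1, by simpa using hne, rfl⟩
  have hprime : (An t).IsPrime := by
    refine ⟨fun h => ht fun i => ?_, fun {x y} hxy => ?_⟩
    · have h1 : (1 : B) ∈ An t := by rw [h]; trivial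
      simpa using h1 i
    · by_cases hy : y ∈ An t
      · exact Or.inr hy
      · left
        have h1 : ¬ ∀ i, ((y * t : B) : F) * ψ i ∈ B := by
          intro h; apply hy; intro i; simpa [mul_assoc] using h i
        have h2 : An t ≤ An (y * t) := fun q hq i => by
          have := mul_mem y.2 (hq i)
          convert this using 1; push_cast; ring
        have h3 : An t = An (y * t) := by
          rcases h2.lt_or_eq with h | h
          · exact absurd h (hmax _ ⟨_, h1, rfl⟩)
          · exact h
        rw [h3]
        intro i
        have := hxy i
        convert this using 1; push_cast; ring
  obtain ⟨q0, hq0, hq00, hq0ψ⟩ := hψd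
  have hq0P : (⟨q0, hq0⟩ : B) ∈ An t := fun i => by
    have := mul_mem t.2 (hq0ψ i)
    convert this using 1; simp; ring
  by_contra! hcon
  apply ht
  intro i
  apply hBc
  · refine isIntegral_of_smul_mem_submodule (R := B) (M := F) (Submodule.map (Algebra.linearMap B F) (An t)) ?_ ?_ _ ?_
    · intro hbot
      have : (q0 : F) ∈ Submodule.map (Algebra.linearMap B F) (An t) := ⟨⟨q0, hq0⟩, hq0P, rfl⟩
      rw [hbot, Submodule.mem_bot] at this
      exact hq00 this
    · exact (IsNoetherian.noetherian (An t)).map _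
    · rintro _ ⟨π, hπ, rfl⟩
      have h1 := hcon (An t) hprime t π (fun i => ⟨π * (t * ψ i), hπ i⟩) hπ (fun i => by simp [mul_assoc]) i
      refine ⟨_, h1, ?_⟩
      show (π : F) * (t * ψ i) = (t * ψ i) * π
      ring
  · exact ⟨q0, hq0, hq00, by have := mul_mem t.2 (hq0ψ i); convert this using 1; ring⟩

section
variable {F : Type} [Field F] [Algebra ℂ F] {n : ℕ} {I : Ideal (Po n)} {D : ℕ} {a b : Fin n → F}
lemma homog_mem (T : Subalgebra ℂ (Polynomial F)) (hX : (Polynomial.X : Polynomial F) ∈ T) (ha : ∀ i, Polynomial.X * Polynomial.C (a i) ∈ T) (hb : ∀ i, Polynomial.X * Polynomial.C (b i) ∈ T) (v : F)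
    (hv : v ∈ adjoin ℂ (range a ∪ range b)) : ∃ N, (Polynomial.X : Polynomial F) ^ N * Polynomial.C v ∈ T := by
  induction hv using Algebra.adjoin_induction with
  | mem x hx =>
    rcases hx with ⟨i, rfl⟩ | ⟨i, rfl⟩
    · exact ⟨1, by simpa using ha i⟩
    · exact ⟨1, by simpa using hb i⟩
  | algebraMap r => exact ⟨0, by simpa using T.algebraMap_mem r⟩
  | add x y _ _ hx hy =>
    obtain ⟨N, hN⟩ := hx
    obtain ⟨M, hM⟩ := hy
    refine ⟨N + M, ?_⟩
    have := add_mem (mul_mem (pow_mem hX M) hN) (mul_mem (pow_mem hX N) hM)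
    convert this using 1; rw [map_add]; ring
  | mul x y _ _ hx hy =>
    obtain ⟨N, hN⟩ := hx
    obtain ⟨M, hM⟩ := hy
    refine ⟨N + M, ?_⟩
    have := mul_mem hN hM
    convert this using 1; rw [map_mul]; ring
lemma frac_T (hG : Gen I D F a b) (T : Subalgebra ℂ (Polynomial F)) (hX : (Polynomial.X : Polynomial F) ∈ T) (ha : ∀ i, Polynomial.X * Polynomial.C (a i) ∈ T)
    (hb : ∀ i, Polynomial.X * Polynomial.C (b i) ∈ T) (x : F) : ∃ v ∈ T, v ≠ 0 ∧ v * Polynomial.C x ∈ T := by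
  obtain ⟨u, hu, v, hv, hv0, hvx⟩ := hG.frac x
  obtain ⟨N, hN⟩ := homog_mem T hX ha hb u hu
  obtain ⟨M, hM⟩ := homog_mem T hX ha hb v hv
  refine ⟨Polynomial.X ^ N * (Polynomial.X ^ M * Polynomial.C v), mul_mem (pow_mem hX _) hM, ?_, ?_⟩
  · simp [hv0]
  · have := mul_mem (pow_mem hX M) hN
    convert this using 1
    rw [← hvx, map_mul]; ring
lemma td_T (hG : Gen I D F a b) (T : Subalgebra ℂ (Polynomial F)) (hX : (Polynomial.X : Polynomial F) ∈ T) (ha : ∀ i, Polynomial.X * Polynomial.C (a i) ∈ T)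
    (hb : ∀ i, Polynomial.X * Polynomial.C (b i) ∈ T) : ((2 * D : ℕ) : Cardinal) + 1 ≤ trdeg ℂ T := by
  have h1 : Algebra.IsAlgebraic T (Polynomial F) := by
    have h2 : ∀ x : F, Polynomial.C x ∈ Subalgebra.algebraicClosure T (Polynomial F) := by
      intro x
      obtain ⟨v, hv, hv0, hu⟩ := frac_T hG T hX ha hb x
      exact alg_of_frac (Polynomial.C x) (⟨_, hu⟩ : T) ⟨v, hv⟩ hv0 rfl
    have hX' : (Polynomial.X : Polynomial F) ∈ Subalgebra.algebraicClosure T (Polynomial F) :=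
      isAlgebraic_algebraMap (⟨Polynomial.X, hX⟩ : T)
    refine ⟨fun p => ?_⟩
    show p ∈ Subalgebra.algebraicClosure T (Polynomial F)
    induction p using Polynomial.induction_on' with
    | add p q hp hq => exact add_mem hp hq
    | monomial k x => rw [← Polynomial.C_mul_X_pow_eq_monomial]; exact mul_mem (h2 x) (pow_mem hX' k)
  rw [trdeg_alg (U := T) (S := Polynomial F), ← _root_.trdeg_add_eq ℂ F (A := Polynomial F), Polynomial.trdeg_of_isDomain]
  exact add_le_add_left hG.td 1
end
lemma int_map_sub {F S' : Type} [CommRing F] [Algebra ℂ F] [CommRing S'] [Algebra ℂ S'] (B A : Subalgebra ℂ F) (hAB : A ≤ B)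
    (ρ : B →ₐ[ℂ] S') (V : Subalgebra ℂ S') (hV : ∀ y (hy : y ∈ A), ρ ⟨y, hAB hy⟩ ∈ V) (x : B) (hx : IsIntegral A (x : F)) :
    IsIntegral V (ρ x) := by
  obtain ⟨p, hp, hpx⟩ := hx
  let j : A →+* B := (Subalgebra.inclusion hAB).toRingHom
  let k : A →+* V := ((ρ.comp (Subalgebra.inclusion hAB)).codRestrict V (fun u => hV u u.2)).toRingHom
  refine ⟨p.map k, hp.map _, ?_⟩
  rw [Polynomial.eval₂_map]
  have h1 : Polynomial.eval₂ j x p = 0 := by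
    apply (Subtype.val_injective : Function.Injective (B.val))
    refine Eq.trans ?_ (hpx.trans (map_zero B.val).symm)
    exact Polynomial.hom_eval₂ p j B.val.toRingHom x
  have h2 := Polynomial.hom_eval₂ p j ρ.toRingHom x
  rw [h1, map_zero] at h2
  exact h2.symm
lemma quot_wrap {S : Type} [CommRing S] [Algebra ℂ S] [FiniteType ℂ S] (Q : Ideal S) [Q.IsPrime] :
    ∃ (S' : Type) (_ : CommRing S') (_ : IsDomain S') (_ : Algebra ℂ S') (_ : FiniteType ℂ S') (π : S →ₐ[ℂ] S'), Function.Surjective π ∧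
      (∀ x, π x = 0 ↔ x ∈ Q) ∧ trdeg ℂ S' = trdeg ℂ (S ⧸ Q) :=
  ⟨S ⧸ Q, inferInstance, inferInstance, inferInstance, inferInstance, Ideal.Quotient.mkₐ ℂ Q, Ideal.Quotient.mkₐ_surjective _ _,
    fun _ => Ideal.Quotient.eq_zero_iff_mem, rfl⟩
lemma mul_int_zero {R S' : Type} [CommRing R] [Algebra ℂ R] [CommRing S'] [IsDomain S'] [Algebra ℂ S'] (T : Subalgebra ℂ R)
    (ρ : T →ₐ[ℂ] S') (π g : T) (hπ : ρ π = 0) (u : R) (hu : IsIntegral T u) (hg : (g : R) = π * u) : ρ g = 0 := by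
  obtain ⟨p, hp, hpu⟩ := hu
  have h1 := Polynomial.scaleRoots_eval₂_eq_zero (algebraMap T R) (s := π) hpu
  have h2 : Polynomial.eval g (p.scaleRoots π) = 0 := by
    apply (Subtype.val_injective : Function.Injective (T.val))
    refine Eq.trans ?_ (h1.trans (map_zero T.val).symm)
    rw [← Polynomial.eval₂_id]
    have := Polynomial.hom_eval₂ (p.scaleRoots π) (RingHom.id T) T.val.toRingHom g
    refine this.trans ?_
    have hg' : (algebraMap T R) π * u = T.val g := hg.symm
    rw [hg']; rfl
  have h3 := congrArg ρ h2
  rw [map_zero, ← Polynomial.eval₂_id] at h3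
  have h4 := Polynomial.hom_eval₂ (p.scaleRoots π) (RingHom.id T) ρ.toRingHom g
  have h5 : Polynomial.eval₂ (ρ.toRingHom) (ρ g) (p.scaleRoots π) = 0 := h4.symm.trans h3
  rw [← Polynomial.eval_map, Polynomial.map_scaleRoots _ _ _ (by rw [hp.leadingCoeff, map_one]; exact one_ne_zero)] at h5
  have h6 : ρ.toRingHom π = 0 := hπ
  rw [h6, Polynomial.scaleRoots_zero, (hp.map _).leadingCoeff] at h5
  simp at h5
  exact h5.1
lemma aeval_XC {F : Type} [Field F] [Algebra ℂ F] {n : ℕ} {I : Ideal (Po n)} (hI : Hmg I) {b : Fin n → F} (hb : ∀ f ∈ I, aeval b f = 0) (f : Po n)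
    (hf : f ∈ I) : aeval (fun i => Polynomial.X * Polynomial.C (b i)) f = (0 : Polynomial F) := by
  rw [← sum_homogeneousComponent f, map_sum]
  refine Finset.sum_eq_zero fun k _ => ?_
  rw [aeval_scale (homogeneousComponent_isHomogeneous k f)]
  have := aeval_hom (Polynomial.CAlgHom (R := ℂ) (A := F)) b (homogeneousComponent k f)
  rw [hb _ (hI f hf k), map_zero] at this
  have h2 : (fun i => Polynomial.C (b i)) = (fun i => (Polynomial.CAlgHom (R := ℂ) (A := F)) (b i)) := rfl
  rw [h2, this, mul_zero]
lemma aeval_XC' {F : Type} [Field F] [Algebra ℂ F] {n : ℕ} {b : Fin n → F} (f : Po n) {k : ℕ} (hf : f.IsHomogeneous k) :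
    aeval (fun i => Polynomial.X * Polynomial.C (b i)) f = (Polynomial.X : Polynomial F) ^ k * Polynomial.C (aeval b f) := by
  rw [aeval_scale hf]
  congr 1
  exact aeval_hom (Polynomial.CAlgHom (R := ℂ) (A := F)) b f

section
variable {F : Type} [Field F] [Algebra ℂ F] {n : ℕ} {I : Ideal (Po n)} {D : ℕ} {a b : Fin n → F}
def TT (a b : Fin n → F) : Subalgebra ℂ (Polynomial F) :=
  adjoin ℂ (range (fun i => Polynomial.X * Polynomial.C (b i)) ∪ {Polynomial.X} ∪ range (fun i => Polynomial.C (b i - a i)))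
lemma TT_fg : (TT a b).FG :=
  ⟨(((finite_range (fun i => (Polynomial.X : Polynomial F) * Polynomial.C (b i))).union (finite_singleton Polynomial.X)).union (finite_range (fun i => Polynomial.C (b i - a i)))).toFinset, by simp [TT]⟩
lemma TT_X : Polynomial.X ∈ TT a b := Algebra.subset_adjoin (Or.inl (Or.inr rfl))
lemma TT_b (i : Fin n) : Polynomial.X * Polynomial.C (b i) ∈ TT a b := Algebra.subset_adjoin (Or.inl (Or.inl ⟨i, rfl⟩))
lemma TT_w (i : Fin n) : Polynomial.C (b i - a i) ∈ TT a b := Algebra.subset_adjoin (Or.inr ⟨i, rfl⟩)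
lemma TT_a (i : Fin n) : Polynomial.X * Polynomial.C (a i) ∈ TT a b := by
  have := sub_mem (TT_b (a := a) (b := b) i) (mul_mem TT_X (TT_w (a := a) (b := b) i))
  convert this using 1
  rw [map_sub]; ring
lemma der_integral (hG : Gen I D F a b) (φ : F) (hφ : IsIntegral (adjoin ℂ (range (b - a))) φ)
    (θ : Derivation ℂ (Po n) (Po n)) (E : ℕ) (hE : ∀ i, (θ (MvPolynomial.X i)).IsHomogeneous E)
    (δ : Derivation ℂ F F) (hδa : ∀ i, δ (a i) = 0) (hδb : ∀ i, δ (b i) = aeval b (θ (MvPolynomial.X i))) :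
    IsIntegral (TT a b) (Polynomial.X ^ E * Polynomial.C (δ φ)) := by
  obtain ⟨η, hη, hηX⟩ := exists_coeffDer δ
  have hfi : FiniteType ℂ (TT a b) := by rw [← Subalgebra.fg_iff_finiteType]; exact TT_fg
  have hno : IsNoetherianRing (TT a b) := FiniteType.isNoetherianRing ℂ _
  have hΘ : ∀ i, Polynomial.X ^ E * Polynomial.C (δ (b i)) ∈ TT a b := by
    intro i
    rw [hδb, ← aeval_XC' _ (hE i)]
    have : (range (fun i => Polynomial.X * Polynomial.C (b i))) ⊆ (TT a b : Set (Polynomial F)) := by rintro _ ⟨i, rfl⟩; exact TT_b i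
    have h2 := Algebra.adjoin_le this
    rw [Algebra.adjoin_range_eq_range_aeval] at h2
    exact h2 ⟨_, rfl⟩
  have h1 : ∀ y ∈ TT a b, ((Polynomial.X : Polynomial F) ^ E • η) y ∈ TT a b := by
    intro y hy
    induction hy using Algebra.adjoin_induction with
    | mem x hx =>
      rcases hx with (⟨i, rfl⟩ | rfl) | ⟨i, rfl⟩
      · have := mul_mem TT_X (hΘ i)
        convert this using 1
        simp only [Derivation.smul_apply, Derivation.leibniz, hη, hηX, smul_eq_mul]; ring
      · simp [hηX]
      · have := hΘ i
        convert this using 1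
        simp only [Derivation.smul_apply, hη, smul_eq_mul, map_sub, hδa, map_zero, mul_zero, sub_zero]
    | algebraMap r => rw [Derivation.map_algebraMap]; exact zero_mem _
    | add x y _ _ hx hy => rw [map_add]; exact add_mem hx hy
    | mul x y hx0 hy0 hx hy =>
      rw [Derivation.leibniz, smul_eq_mul, smul_eq_mul]
      exact add_mem (mul_mem hx0 hy) (mul_mem hy0 hx)
  have hφT : IsIntegral (TT a b) (Polynomial.C φ) := by
    refine int_map (Polynomial.CAlgHom (R := ℂ) (A := F)) _ _ ?_ hφ
    rw [AlgHom.map_adjoin]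
    apply Algebra.adjoin_le
    rintro _ ⟨_, ⟨i, rfl⟩, rfl⟩
    exact TT_w i
  obtain ⟨v0, hv0, hv00, hv0φ⟩ := frac_T hG (TT a b) TT_X TT_a TT_b φ
  obtain ⟨v, hv, hvj⟩ := hφT.isAlmostIntegral_of_exists_smul_mem_range
    ⟨⟨v0, hv0⟩, mem_nonZeroDivisors_of_ne_zero (fun h => hv00 (congrArg Subtype.val h)), ⟨⟨_, hv0φ⟩, rfl⟩⟩
  have h2 := seidenberg ((Polynomial.X : Polynomial F) ^ E • η) (TT a b) h1 (Polynomial.C φ) v (fun h => nonZeroDivisors.ne_zero hv (Subtype.ext h)) (fun j => by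
    obtain ⟨y, hy⟩ := hvj j
    have : (v : Polynomial F) * Polynomial.C φ ^ j = y := hy.symm
    rw [this]; exact y.2)
  rw [Derivation.smul_apply, hη, smul_eq_mul] at h2
  exact h2
end
theorem unram {n d c D : ℕ} {I : Ideal (Po n)} (hI : Good d I) (hc : c + d = n) (hD : trdeg ℂ (Po n ⧸ I) = D) (h32 : 2 * n ≤ 3 * d)
    (h2 : n + 2 ≤ 2 * d) {F : Type} [Field F] [Algebra ℂ F] {a b : Fin n → F} (hG : Gen I D F a b)
    (B : Subalgebra ℂ F) (hBf : B.FG) (hBw : ∀ i, b i - a i ∈ B) (hBi : ∀ x ∈ B, IsIntegral (adjoin ℂ (range (b - a))) x)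
    (hBc : ∀ x : F, IsIntegral B x → (∃ q ∈ B, q ≠ 0 ∧ q * x ∈ B) → x ∈ B) (φ : F) (hφ : φ ∈ B) (ψ : Fin n → F)
    (hψd : ∃ q ∈ B, q ≠ 0 ∧ ∀ i, q * ψ i ∈ B) (hψ : ∀ δ : Derivation ℂ F F, δ φ = ∑ i, ψ i * δ (b i - a i)) : ∀ i, ψ i ∈ B := by
  by_contra hne
  have hBft : FiniteType ℂ B := Subalgebra.fg_iff_finiteType _ |>.mp hBf
  have hBn : IsNoetherianRing B := FiniteType.isNoetherianRing ℂ _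
  obtain ⟨P, hP, t, π, s, hπ, hs, i0, hi0⟩ := pickP B hBc ψ hψd hne
  have hπ0 : π ≠ 0 := by
    rintro rfl
    apply hi0
    have : s i0 = 0 := by apply Subtype.ext; rw [hs]; simp
    rw [this]; exact zero_mem _
  let Cg : F →ₐ[ℂ] Polynomial F := Polynomial.CAlgHom
  let T1 : Subalgebra ℂ (Polynomial F) := B.map Cg ⊔ TT a b
  have hTT1 : TT a b ≤ T1 := le_sup_right
  have hT1f : FiniteType ℂ T1 := Subalgebra.fg_iff_finiteType _ |>.mp ((hBf.map Cg).sup TT_fg)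
  have hev : ∀ y ∈ T1, Polynomial.eval 0 y ∈ B := by
    let e0 : Polynomial F →ₐ[ℂ] F := (Polynomial.aeval (0 : F)).restrictScalars ℂ
    have he0 : ∀ y, e0 y = Polynomial.eval 0 y := fun y => by simp [e0, Polynomial.coeff_zero_eq_eval_zero]
    have : T1 ≤ B.comap e0 := by
      refine sup_le ?_ (Algebra.adjoin_le ?_)
      · rintro _ ⟨y, hy, rfl⟩
        show e0 (Polynomial.C y) ∈ B
        rw [he0]; simpa using hy
      · rintro _ ((⟨i, rfl⟩ | rfl) | ⟨i, rfl⟩)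
        · show e0 _ ∈ B
          rw [he0]; simp
        · show e0 _ ∈ B
          rw [he0]; simp
        · show e0 _ ∈ B
          rw [he0]; simpa using hBw i
    intro y hy
    rw [← he0]; exact this hy
  let ev : T1 →+* B := ((Polynomial.evalRingHom (0 : F)).comp T1.subtype).codRestrict B.toSubring (fun y => hev y y.2)
  have hevv : ∀ y : T1, (ev y : F) = Polynomial.eval 0 (y : Polynomial F) := fun y => rfl
  let ιB : B →ₐ[ℂ] T1 := (Cg.comp B.val).codRestrict T1 (fun y => (le_sup_left : B.map Cg ≤ T1) ⟨y, y.2, rfl⟩)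
  have hιB : ∀ y : B, (ιB y : Polynomial F) = Polynomial.C (y : F) := fun y => rfl
  have hevι : ∀ y : B, ev (ιB y) = y := fun y => by apply Subtype.ext; rw [hevv, hιB]; simp
  have hQ'p : (P.comap ev).IsPrime := Ideal.comap_isPrime ev P
  obtain ⟨Q, hQm, hQQ'⟩ := Ideal.exists_minimalPrimes_le (I := Ideal.span {ιB π}) (J := P.comap ev) (by
    rw [Ideal.span_le]; rintro _ rfl; show ev (ιB π) ∈ P; rw [hevι]; exact hπ)
  have hQp : Q.IsPrime := hQm.isPrime
  have htd1 := pit (k := ℂ) (ιB π) Q hQm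
  have hπQ : ιB π ∈ Q := hQm.le (Ideal.mem_span_singleton_self _)
  obtain ⟨S', _, _, _, _, ρ, hρs, hρQ, htS⟩ := quot_wrap Q
  rw [← htS] at htd1
  have htd2 : ((2 * D : ℕ) : Cardinal) ≤ trdeg ℂ S' := by
    have h1 := (td_T hG T1 (hTT1 TT_X) (fun i => hTT1 (TT_a i)) (fun i => hTT1 (TT_b i))).trans htd1
    exact Cardinal.add_one_le_add_one_iff.mp h1
  let b' : Fin n → T1 := fun i => ⟨_, hTT1 (TT_b i)⟩
  let X' : T1 := ⟨_, hTT1 TT_X⟩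
  let wB : Fin n → B := fun i => ⟨_, hBw i⟩
  let w' : Fin n → T1 := fun i => ιB (wB i)
  have hv : Function.Injective T1.val := Subtype.val_injective
  have hbv : ∀ f : Po n, (aeval b' f : Polynomial F) = aeval (fun i => Polynomial.X * Polynomial.C (b i)) f := fun f => (aeval_hom T1.val b' f).symm
  have hsum : ∀ θ ∈ DD I, ∀ E, (∀ i, (θ (MvPolynomial.X i)).IsHomogeneous E) → ρ (∑ i, ιB (s i) * aeval b' (θ (MvPolynomial.X i))) = 0 := by
    intro θ hθ E hE
    obtain ⟨δ, hδa, hδb⟩ := hG.der θ hθ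
    have h1 := der_integral hG φ (hBi φ hφ) θ E hE δ hδa hδb
    have h2 : IsIntegral T1 (Polynomial.X ^ E * Polynomial.C (δ φ)) := int_map (AlgHom.id ℂ _) (TT a b) T1 (by simpa using hTT1) h1
    have h3 : IsIntegral T1 (Polynomial.C (t : F) * (Polynomial.X ^ E * Polynomial.C (δ φ))) :=
      (isIntegral_algebraMap (x := ιB t)).mul h2
    refine mul_int_zero T1 ρ (ιB π) _ ((hρQ _).mpr hπQ) _ h3 ?_
    show T1.val (∑ i, ιB (s i) * aeval b' (θ (MvPolynomial.X i))) = _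
    rw [map_sum, hψ, map_sum, Finset.mul_sum, Finset.mul_sum, Finset.mul_sum]
    refine Finset.sum_congr rfl fun i _ => ?_
    rw [map_mul]
    show (ιB (s i) : Polynomial F) * (aeval b' _ : T1) = _
    rw [hbv, aeval_XC' _ (hE i), hιB, hs, hιB, map_sub, hδa, hδb, sub_zero]
    simp only [map_mul]
    ring
  refine keyK hI hc hD h32 h2 (fun i => ρ (b' i)) (fun i => ρ (w' i)) (ρ X') ?_ htd2 ?_ ?_ ?_ (fun i => ρ (ιB (s i))) ?_ ?_ ?_
  · intro x
    obtain ⟨y, rfl⟩ := hρs x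
    refine int_map_sub T1 (TT a b) hTT1 ρ _ ?_ y ?_
    · intro y hy
      have h1 : (TT a b) ≤ ((adjoin ℂ (range (fun i => ρ (b' i)) ∪ {ρ X'} ∪ range (fun i => ρ (w' i)))).comap ρ).map T1.val := by
        refine Algebra.adjoin_le ?_
        rintro _ ((⟨i, rfl⟩ | rfl) | ⟨i, rfl⟩)
        · exact ⟨b' i, Algebra.subset_adjoin (Or.inl (Or.inl ⟨i, rfl⟩)), rfl⟩
        · exact ⟨X', Algebra.subset_adjoin (Or.inl (Or.inr rfl)), rfl⟩
        · exact ⟨w' i, Algebra.subset_adjoin (Or.inr ⟨i, rfl⟩), rfl⟩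
      obtain ⟨z, hz, hzy⟩ := h1 hy
      have : z = ⟨y, hTT1 hy⟩ := Subtype.ext hzy
      rw [← this]; exact hz
    · have h1 : T1 ≤ (integralClosure (TT a b) (Polynomial F)).restrictScalars ℂ := by
        refine sup_le ?_ ?_
        · rintro _ ⟨z, hz, rfl⟩
          refine int_map Cg _ _ ?_ (hBi z hz)
          rw [AlgHom.map_adjoin]
          apply Algebra.adjoin_le
          rintro _ ⟨_, ⟨i, rfl⟩, rfl⟩
          exact TT_w i
        · intro z hz
          exact isIntegral_algebraMap (x := (⟨z, hz⟩ : TT a b))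
      exact h1 y.2
  · rw [trdeg_adjoin_aeval]
    have : (RingHom.ker (aeval (fun i => ρ (w' i)) : Po n →ₐ[ℂ] S')).IsPrime := RingHom.ker_isPrime _
    refine (trdeg_quot_lt (RingHom.ker (aeval (fun i => ρ (w' i)) : Po n →ₐ[ℂ] S')) ?_).trans (by simp)
    have hA : adjoin ℂ (range (b - a)) ≤ B := Algebra.adjoin_le (by rintro _ ⟨i, rfl⟩; exact hBw i)
    have h1 : IsIntegral (adjoin ℂ (range wB)) π := int_map_sub B (adjoin ℂ (range (b - a))) hA (AlgHom.id ℂ B) _ (by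
      intro y hy
      have h1 : adjoin ℂ (range (b - a)) ≤ (adjoin ℂ (range wB)).map B.val := by
        apply Algebra.adjoin_le
        rintro _ ⟨i, rfl⟩
        exact ⟨wB i, Algebra.subset_adjoin ⟨i, rfl⟩, rfl⟩
      obtain ⟨z, hz, hzy⟩ := h1 hy
      have : z = ⟨y, hA hy⟩ := Subtype.ext hzy
      rw [← this]; exact hz) π (hBi _ π.2)
    obtain ⟨r, hr0, β, hβ⟩ := h1.isAlgebraic.exists_nonzero_dvd (mem_nonZeroDivisors_of_ne_zero hπ0)
    obtain ⟨r, hr⟩ := r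
    have hr' := hr
    rw [Algebra.adjoin_range_eq_range_aeval] at hr'
    obtain ⟨f, hf⟩ := hr'
    have hβ' : r = π * β := hβ
    intro h0
    have hfk : f ∈ RingHom.ker (aeval (fun i => ρ (w' i)) : Po n →ₐ[ℂ] S') := by
      rw [RingHom.mem_ker, aeval_hom ρ w', aeval_hom ιB wB]
      have hf' : aeval wB f = r := hf
      rw [hf', hβ', map_mul, map_mul, (hρQ _).mpr hπQ, zero_mul]
    rw [h0, Ideal.mem_bot] at hfk
    apply hr0
    apply Subtype.ext
    have hf' : aeval wB f = r := hf
    show r = 0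
    rw [← hf', hfk, map_zero]
  · intro f hf
    rw [aeval_hom ρ b']
    have : aeval b' f = 0 := by apply hv; rw [map_zero]; exact (hbv f).trans (aeval_XC hI.hom hG.vb f hf)
    rw [this, map_zero]
  · intro f hf
    have h1 : (fun i => ρ (b' i) - ρ X' * ρ (w' i)) = fun i => ρ (b' i - X' * w' i) := by ext i; simp
    rw [h1, aeval_hom ρ (fun i => b' i - X' * w' i)]
    have : aeval (fun i => b' i - X' * w' i) f = 0 := by
      apply hv
      rw [map_zero, ← aeval_hom T1.val]
      have h3 : (fun i => T1.val (b' i - X' * w' i)) = fun i => Polynomial.X * Polynomial.C (a i) := by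
        ext1 i
        show Polynomial.X * Polynomial.C (b i) - Polynomial.X * Polynomial.C (b i - a i) = Polynomial.X * Polynomial.C (a i)
        rw [map_sub]; ring
      rw [h3]
      exact aeval_XC hI.hom hG.va f hf
    rw [this, map_zero]
  · intro h0
    have h1 := (hρQ _).mp (congrFun h0 i0)
    have h3 : ev (ιB (s i0)) ∈ P := hQQ' h1
    rw [hevι] at h3
    exact hi0 h3
  · intro i
    have hA : (adjoin ℂ (range (b - a))).map Cg ≤ T1 :=
      (Subalgebra.map_mono (Algebra.adjoin_le (by rintro _ ⟨i, rfl⟩; exact hBw i))).trans (le_sup_left : B.map Cg ≤ T1)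
    refine int_map_sub T1 ((adjoin ℂ (range (b - a))).map Cg) hA ρ _ ?_ _ (int_map Cg _ _ le_rfl (hBi _ (s i).2))
    intro y hy
    have h1 : (adjoin ℂ (range (b - a))).map Cg ≤ ((adjoin ℂ (range (fun i => ρ (w' i)))).comap ρ).map T1.val := by
      rw [AlgHom.map_adjoin]
      refine Algebra.adjoin_le ?_
      rintro _ ⟨_, ⟨i, rfl⟩, rfl⟩
      exact ⟨w' i, Algebra.subset_adjoin ⟨i, rfl⟩, rfl⟩
    obtain ⟨z, hz, hzy⟩ := h1 hy
    have : z = ⟨y, hA hy⟩ := Subtype.ext hzy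
    rw [← this]; exact hz
  · intro θ hθ E hE
    have h1 := hsum θ hθ E hE
    rw [map_sum] at h1
    rw [← h1]
    refine Finset.sum_congr rfl fun i _ => ?_
    rw [map_mul, aeval_hom ρ b']
lemma int_toPo {n : ℕ} {F : Type} [Field F] [Algebra ℂ F] (w : Fin n → F) (x : F) (hx : IsIntegral (adjoin ℂ (range w)) x) :
    (aeval w : Po n →ₐ[ℂ] F).toRingHom.IsIntegralElem x := by
  let _ : Algebra (Po n) F := (aeval w : Po n →ₐ[ℂ] F).toRingHom.toAlgebra
  have _ : IsScalarTower ℂ (Po n) F := IsScalarTower.of_algebraMap_eq fun c => by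
    show _ = aeval w (C c); simp
  show IsIntegral (Po n) x
  have h1 : IsIntegral (integralClosure (Po n) F) x :=
    int_map (AlgHom.id ℂ F) _ ((integralClosure (Po n) F).restrictScalars ℂ) (by
      rw [AlgHom.map_adjoin]
      apply Algebra.adjoin_le
      rintro _ ⟨_, ⟨i, rfl⟩, rfl⟩
      have : algebraMap (Po n) F (X i) = w i := by show aeval w (X i) = _; simp
      show IsIntegral (Po n) (w i)
      rw [← this]; exact isIntegral_algebraMap) hx
  exact isIntegral_trans x h1
lemma int_ofPo {n : ℕ} {F : Type} [Field F] [Algebra ℂ F] (w : Fin n → F) (x : F)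
    (hx : (aeval w : Po n →ₐ[ℂ] F).toRingHom.IsIntegralElem x) : IsIntegral (adjoin ℂ (range w)) x := by
  obtain ⟨p, hp, hpx⟩ := hx
  let j : Po n →+* adjoin ℂ (range w) := ((aeval w : Po n →ₐ[ℂ] F).codRestrict _ (fun f => by
    rw [Algebra.adjoin_range_eq_range_aeval]; exact ⟨f, rfl⟩)).toRingHom
  refine ⟨p.map j, hp.map j, ?_⟩
  rw [Polynomial.eval₂_map]
  exact hpx
lemma exists_B {n : ℕ} {F : Type} [Field F] [Algebra ℂ F] (w : Fin n → F) (hw : Function.Injective (aeval w : Po n →ₐ[ℂ] F)) (φ : F)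
    (hφ : IsIntegral (adjoin ℂ (range w)) φ) : ∃ B : Subalgebra ℂ F, B.FG ∧ (∀ i, w i ∈ B) ∧ (∀ x ∈ B, IsIntegral (adjoin ℂ (range w)) x) ∧
      (∀ x : F, IsIntegral B x → (∃ q ∈ B, q ≠ 0 ∧ q * x ∈ B) → x ∈ B) ∧ φ ∈ B := by
  classical
  let _ : Algebra (Po n) F := (aeval w : Po n →ₐ[ℂ] F).toRingHom.toAlgebra
  have hmap : ∀ f, algebraMap (Po n) F f = aeval w f := fun f => rfl
  have _ : IsScalarTower ℂ (Po n) F := IsScalarTower.of_algebraMap_eq fun c => by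
    show _ = aeval w (C c); simp
  have hφ' : IsIntegral (Po n) φ := int_toPo w φ hφ
  have _ : FaithfulSMul (Po n) F := (faithfulSMul_iff_algebraMap_injective _ _).mpr hw
  let _ : Algebra (FractionRing (Po n)) F := FractionRing.liftAlgebra (Po n) F
  have _ : IsScalarTower (Po n) (FractionRing (Po n)) F := FractionRing.isScalarTower_liftAlgebra (Po n) F
  have _ : IsScalarTower ℂ (FractionRing (Po n)) F := IsScalarTower.to₁₃₄ ℂ (Po n) (FractionRing (Po n)) F
  let K := FractionRing (Po n)
  let L : IntermediateField K F := IntermediateField.adjoin K {φ}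
  have hfin : FiniteDimensional K L := IntermediateField.adjoin.finiteDimensional (hφ'.tower_top)
  have hC : Module.Finite (Po n) (integralClosure (Po n) L) := IsIntegralClosure.finite (Po n) K L (integralClosure (Po n) L)
  let g : integralClosure (Po n) L →ₐ[Po n] F := (L.val.restrictScalars (Po n)).comp (integralClosure (Po n) L).val
  let B : Subalgebra ℂ F := g.range.restrictScalars ℂ
  have hBmem : ∀ x, x ∈ B ↔ IsIntegral (Po n) x ∧ x ∈ L := by
    intro x
    constructor
    · rintro ⟨y, rfl⟩
      exact ⟨y.2.map (L.val.restrictScalars (Po n)), y.1.2⟩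
    · rintro ⟨h1, h2⟩
      refine ⟨⟨⟨x, h2⟩, ?_⟩, rfl⟩
      have hinj : Function.Injective (L.val.restrictScalars (Po n)) := L.val.injective
      exact (isIntegral_algHom_iff (L.val.restrictScalars (Po n)) hinj).mp h1
  have hwB : ∀ i, w i ∈ B := by
    intro i
    have : algebraMap (Po n) F (X i) = w i := by rw [hmap]; simp
    rw [← this]
    exact ⟨algebraMap _ _ (X i), g.commutes _⟩
  refine ⟨B, ?_, hwB, ?_, ?_, ?_⟩
  · obtain ⟨G, hGs⟩ := hC.fg_top
    refine ⟨Finset.univ.image w ∪ G.image g, le_antisymm ?_ ?_⟩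
    · apply Algebra.adjoin_le
      intro x hx
      simp only [Finset.coe_union, Finset.coe_image, Finset.coe_univ, image_univ] at hx
      rcases hx with ⟨i, rfl⟩ | ⟨y, _, rfl⟩
      · exact hwB i
      · exact ⟨y, rfl⟩
    · rintro _ ⟨y, rfl⟩
      have hy : y ∈ Submodule.span (Po n) (G : Set (integralClosure (Po n) L)) := by rw [hGs]; trivial
      show g y ∈ _
      induction hy using Submodule.span_induction with
      | mem x hx => exact Algebra.subset_adjoin (Finset.mem_coe.mpr (Finset.mem_union_right _ (Finset.mem_image_of_mem g hx)))
      | zero => rw [map_zero]; exact zero_mem _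
      | add x y _ _ hx hy => rw [map_add]; exact add_mem hx hy
      | smul f x _ hx =>
        rw [map_smul, Algebra.smul_def, hmap]
        refine mul_mem ?_ hx
        have h1 : aeval w f ∈ adjoin ℂ (range w) := by rw [Algebra.adjoin_range_eq_range_aeval]; exact ⟨f, rfl⟩
        refine Algebra.adjoin_mono ?_ h1
        rintro _ ⟨i, rfl⟩
        simp
  · intro x hx
    exact int_ofPo w x ((hBmem x).mp hx).1
  · rintro x hx ⟨q, hq, hq0, hqx⟩
    rw [hBmem]
    constructor
    · have h1 : IsIntegral (integralClosure (Po n) F) x :=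
        int_map (AlgHom.id ℂ F) _ ((integralClosure (Po n) F).restrictScalars ℂ) (by
          rintro _ ⟨y, hy, rfl⟩
          exact ((hBmem y).mp hy).1) hx
      exact isIntegral_trans x h1
    · have := L.mul_mem (L.inv_mem ((hBmem q).mp hq).2) ((hBmem _).mp hqx).2
      rwa [inv_mul_cancel_left₀ hq0] at this
  · rw [hBmem]
    exact ⟨hφ', IntermediateField.mem_adjoin_simple_self K φ⟩
lemma chain2 {n : ℕ} {G : Type} [CommRing G] [Algebra ℂ G] (δ : Derivation ℂ G G) (y : Fin n → G) (z : G)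
    (η : Fin n → Derivation ℂ (Polynomial (Po n)) (Polynomial (Po n))) (hη : ∀ i c, η i (Polynomial.C c) = Polynomial.C (pderiv i c))
    (hηX : ∀ i, η i Polynomial.X = 0) (P : Polynomial (Po n)) :
    δ (Polynomial.eval₂ (aeval y : Po n →ₐ[ℂ] G).toRingHom z P) =
      Polynomial.eval₂ (aeval y : Po n →ₐ[ℂ] G).toRingHom z P.derivative * δ z +
      ∑ i, Polynomial.eval₂ (aeval y : Po n →ₐ[ℂ] G).toRingHom z (η i P) * δ (y i) := by
  induction P using Polynomial.induction_on' with
  | add p q hp hq =>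
    simp only [Polynomial.eval₂_add, map_add, hp, hq, add_mul, Finset.sum_add_distrib]; ring
  | monomial k c =>
    rw [← Polynomial.C_mul_X_pow_eq_monomial]
    have h1 : ∀ i, η i (Polynomial.C c * Polynomial.X ^ k) = Polynomial.C (pderiv i c) * Polynomial.X ^ k := by
      intro i
      rw [Derivation.leibniz, Derivation.leibniz_pow, hη, hηX, smul_zero, smul_zero, smul_zero, zero_add, smul_eq_mul, mul_comm]
    simp only [h1, Polynomial.derivative_C_mul_X_pow, Polynomial.eval₂_mul, Polynomial.eval₂_C, Polynomial.eval₂_X_pow]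
    have h2 : ∀ f, (aeval y : Po n →ₐ[ℂ] G).toRingHom f = aeval y f := fun f => rfl
    rw [Derivation.leibniz, Derivation.leibniz_pow, h2, chain_rule]
    simp only [h2, smul_eq_mul, Finset.mul_sum, map_mul, map_natCast, nsmul_eq_mul]
    congr 1
    · ring
    · refine Finset.sum_congr rfl fun i _ => ?_
      ring
lemma exists_minP {n : ℕ} {F : Type} [Field F] [Algebra ℂ F] (w : Fin n → F) (hw : Function.Injective (aeval w : Po n →ₐ[ℂ] F)) (φ : F)
    (hφ : IsIntegral (adjoin ℂ (range w)) φ) : ∃ P : Polynomial (Po n), Polynomial.eval₂ (aeval w : Po n →ₐ[ℂ] F).toRingHom φ P = 0 ∧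
      Polynomial.eval₂ (aeval w : Po n →ₐ[ℂ] F).toRingHom φ P.derivative ≠ 0 := by
  classical
  obtain ⟨P0, hP0, hP0φ⟩ := int_toPo w φ hφ
  have hex : ∃ k, ∃ P : Polynomial (Po n), Polynomial.eval₂ (aeval w : Po n →ₐ[ℂ] F).toRingHom φ P = 0 ∧ P ≠ 0 ∧ P.natDegree = k :=
    ⟨_, P0, hP0φ, hP0.ne_zero, rfl⟩
  obtain ⟨P, hP, hPne, hk⟩ := Nat.find_spec hex
  refine ⟨P, hP, fun hd => ?_⟩
  have hdeg : P.natDegree ≠ 0 := by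
    intro h0
    rw [Polynomial.eq_C_of_natDegree_eq_zero h0] at hP hPne
    rw [Polynomial.eval₂_C] at hP
    apply hPne
    have : P.coeff 0 = 0 := hw (hP.trans (map_zero _).symm)
    rw [this, map_zero]
  have hdne : P.derivative ≠ 0 := fun h => hdeg (Polynomial.derivative_eq_zero.mp h)
  exact Nat.find_min hex (hk ▸ Polynomial.natDegree_derivative_lt hdeg) ⟨_, hd, hdne, rfl⟩
lemma mu_eval {n : ℕ} {F : Type} [Field F] [Algebra ℂ F] (w : Fin n → F) (μ : F →ₐ[ℂ] FractionRing (Polynomial F))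
    (hμ : ∀ i, μ (w i) = algebraMap (Polynomial F) _ (Polynomial.X * Polynomial.C (w i))) (x : F) (p : Polynomial F)
    (hx : μ x = algebraMap (Polynomial F) _ p) (Q : Polynomial (Po n)) :
    μ (Polynomial.eval₂ (aeval w : Po n →ₐ[ℂ] F).toRingHom x Q) = algebraMap (Polynomial F) (FractionRing (Polynomial F))
      (Polynomial.eval₂ (aeval (fun i => Polynomial.X * Polynomial.C (w i)) : Po n →ₐ[ℂ] Polynomial F).toRingHom p Q) := by
  have h1 := Polynomial.hom_eval₂ Q (aeval w : Po n →ₐ[ℂ] F).toRingHom μ.toRingHom x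
  have h2 := Polynomial.hom_eval₂ Q (aeval (fun i => Polynomial.X * Polynomial.C (w i)) : Po n →ₐ[ℂ] Polynomial F).toRingHom
    (algebraMap (Polynomial F) (FractionRing (Polynomial F))) p
  rw [h2]
  refine h1.trans ?_
  rw [← hx]
  have h3 : μ.toRingHom.comp (aeval w : Po n →ₐ[ℂ] F).toRingHom = (algebraMap (Polynomial F) (FractionRing (Polynomial F))).comp
      (aeval (fun i => Polynomial.X * Polynomial.C (w i)) : Po n →ₐ[ℂ] Polynomial F).toRingHom := by
    apply MvPolynomial.ringHom_ext
    · intro r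
      show μ (aeval w (C r)) = algebraMap (Polynomial F) _ (aeval _ (C r))
      rw [aeval_C, aeval_C, AlgHom.commutes, ← IsScalarTower.algebraMap_apply]
    · intro i
      show μ (aeval w (X i)) = algebraMap (Polynomial F) _ (aeval _ (X i))
      rw [aeval_X, aeval_X, hμ]
  rw [h3]
  rfl
lemma mu_int {n : ℕ} {F : Type} [Field F] [Algebra ℂ F] (w : Fin n → F) (μ : F →ₐ[ℂ] FractionRing (Polynomial F))
    (hμ : ∀ i, μ (w i) = algebraMap (Polynomial F) _ (Polynomial.X * Polynomial.C (w i))) (x : F)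
    (hx : IsIntegral (adjoin ℂ (range w)) x) : ∃ p : Polynomial F, μ x = algebraMap (Polynomial F) _ p ∧
      ∃ c : ℂ, p.coeff 0 = algebraMap ℂ F c := by
  obtain ⟨Q, hQ, hQx⟩ := int_toPo w x hx
  have h1 : IsIntegral (Polynomial F) (μ x) := by
    refine ⟨Q.map (aeval (fun i => Polynomial.X * Polynomial.C (w i)) : Po n →ₐ[ℂ] Polynomial F).toRingHom, hQ.map _, ?_⟩
    rw [Polynomial.eval₂_map]
    have h3 : μ.toRingHom.comp (aeval w : Po n →ₐ[ℂ] F).toRingHom = (algebraMap (Polynomial F) (FractionRing (Polynomial F))).comp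
        (aeval (fun i => Polynomial.X * Polynomial.C (w i)) : Po n →ₐ[ℂ] Polynomial F).toRingHom := by
      apply MvPolynomial.ringHom_ext
      · intro r
        show μ (aeval w (C r)) = algebraMap (Polynomial F) _ (aeval _ (C r))
        rw [aeval_C, aeval_C, AlgHom.commutes, ← IsScalarTower.algebraMap_apply]
      · intro i
        show μ (aeval w (X i)) = algebraMap (Polynomial F) _ (aeval _ (X i))
        rw [aeval_X, aeval_X, hμ]
    rw [← h3]
    refine (Polynomial.hom_eval₂ Q (aeval w : Po n →ₐ[ℂ] F).toRingHom μ.toRingHom x).symm.trans ?_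
    rw [hQx, map_zero]
  obtain ⟨p, hp⟩ := IsIntegrallyClosed.isIntegral_iff.mp h1
  refine ⟨p, hp.symm, integral_const _ ⟨Q.map (aeval (0 : Fin n → ℂ) : Po n →ₐ[ℂ] ℂ).toRingHom, hQ.map _, ?_⟩⟩
  have h4 := mu_eval w μ hμ x p hp.symm Q
  rw [hQx, map_zero] at h4
  have h5 := (IsFractionRing.injective (Polynomial F) (FractionRing (Polynomial F))) ((map_zero _).trans h4)
  have h6 := congrArg (Polynomial.evalRingHom (0 : F)) h5
  rw [Polynomial.hom_eval₂, map_zero] at h6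
  rw [Polynomial.eval₂_map, Polynomial.coeff_zero_eq_eval_zero]
  refine Eq.trans ?_ h6.symm
  congr 1
  apply MvPolynomial.ringHom_ext
  · intro r
    show algebraMap ℂ F (aeval _ (C r)) = Polynomial.eval 0 (aeval _ (C r))
    rw [aeval_C, aeval_C]; simp [IsScalarTower.algebraMap_apply ℂ F (Polynomial F)]
  · intro i
    show algebraMap ℂ F (aeval _ (X i)) = Polynomial.eval 0 (aeval _ (X i))
    simp
lemma exists_psi {n d c D : ℕ} {I : Ideal (Po n)} (hI : Good d I) (hc : c + d = n) (hD : trdeg ℂ (Po n ⧸ I) = D) (h32 : 2 * n ≤ 3 * d)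
    (h2 : n + 2 ≤ 2 * d) {F : Type} [Field F] [Algebra ℂ F] {a b : Fin n → F} (hG : Gen I D F a b) (μ : F →ₐ[ℂ] FractionRing (Polynomial F))
    (hμ : ∀ i, μ ((b - a) i) = algebraMap (Polynomial F) _ (Polynomial.X * Polynomial.C ((b - a) i))) (φ : F)
    (hφ : IsIntegral (adjoin ℂ (range (b - a))) φ) (p : Polynomial F) (hp : μ φ = algebraMap (Polynomial F) _ p) :
    ∃ ψ : Fin n → F, (∀ i, IsIntegral (adjoin ℂ (range (b - a))) (ψ i)) ∧ ∀ q : Fin n → Polynomial F,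
      (∀ i, μ (ψ i) = algebraMap (Polynomial F) _ (q i)) → p.derivative = ∑ i, Polynomial.C ((b - a) i) * q i := by
  have hw := dominance hI hc hD h32 h2 hG
  obtain ⟨P, hP, hP'⟩ := exists_minP _ hw φ hφ
  obtain ⟨B, hB1, hB2, hB3, hB4, hB5⟩ := exists_B _ hw φ hφ
  choose η hη hηX using fun i : Fin n => exists_coeffDer (pderiv i : Derivation ℂ (Po n) (Po n))
  set e := (aeval (b - a) : Po n →ₐ[ℂ] F).toRingHom with he
  have heB : ∀ Q : Polynomial (Po n), Polynomial.eval₂ e φ Q ∈ B := by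
    intro Q
    rw [Polynomial.eval₂_eq_sum]
    refine Subalgebra.sum_mem _ fun k _ => mul_mem ?_ (pow_mem hB5 k)
    have h1 : aeval (b - a) (Q.coeff k) ∈ adjoin ℂ (range (b - a)) := by rw [Algebra.adjoin_range_eq_range_aeval]; exact ⟨_, rfl⟩
    exact Algebra.adjoin_le (by rintro _ ⟨i, rfl⟩; exact hB2 i) h1
  let ψ : Fin n → F := fun i => - Polynomial.eval₂ e φ (η i P) / Polynomial.eval₂ e φ P.derivative
  have hmul : ∀ i, Polynomial.eval₂ e φ P.derivative * ψ i = - Polynomial.eval₂ e φ (η i P) := fun i => mul_div_cancel₀ _ hP'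
  have hψB := unram hI hc hD h32 h2 hG B hB1 hB2 hB3 hB4 φ hB5 ψ ⟨_, heB P.derivative, hP', fun i => by
    rw [hmul]; exact neg_mem (heB _)⟩ (fun δ => by
      have h := chain2 δ (b - a) φ η hη hηX P
      rw [← he, hP, map_zero] at h
      apply mul_left_cancel₀ hP'
      rw [Finset.mul_sum]
      simp only [← mul_assoc, hmul]
      rw [eq_comm, ← sub_eq_zero]
      simp only [neg_mul, Finset.sum_neg_distrib]
      simp only [Pi.sub_apply] at h
      linear_combination h)
  refine ⟨ψ, fun i => hB3 _ (hψB i), fun q hq => ?_⟩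
  have h := chain2 ((Polynomial.derivative' : Derivation F (Polynomial F) (Polynomial F)).restrictScalars ℂ)
    (fun i => Polynomial.X * Polynomial.C ((b - a) i)) p η hη hηX P
  have hinj := (IsFractionRing.injective (Polynomial F) (FractionRing (Polynomial F)))
  set e' := (aeval (fun i => Polynomial.X * Polynomial.C ((b - a) i)) : Po n →ₐ[ℂ] Polynomial F).toRingHom with he'
  have hme := mu_eval (b - a) μ hμ φ p hp
  rw [← he, ← he'] at hme
  have h0 : Polynomial.eval₂ e' p P = 0 := by
    apply hinj; rw [← hme, hP, map_zero, map_zero]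
  have h1 : Polynomial.eval₂ e' p P.derivative ≠ 0 := by
    intro h1
    apply hP'
    apply μ.toRingHom.injective
    show μ _ = μ _
    rw [hme, h1, map_zero, map_zero]
  have h3 : ∀ i, Polynomial.eval₂ e' p P.derivative * q i = - Polynomial.eval₂ e' p (η i P) := by
    intro i
    apply hinj
    rw [map_mul, map_neg, ← hme, ← hme, ← hq, ← map_mul, hmul, map_neg]
  rw [h0, map_zero] at h
  apply mul_left_cancel₀ h1
  have h4 : ∀ x : F, ((Polynomial.derivative' : Derivation F (Polynomial F) (Polynomial F)).restrictScalars ℂ) (Polynomial.X * Polynomial.C x) = Polynomial.C x := by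
    intro x
    show Polynomial.derivative _ = _
    simp
  simp only [h4] at h
  have h5 : ((Polynomial.derivative' : Derivation F (Polynomial F) (Polynomial F)).restrictScalars ℂ) p = p.derivative := rfl
  rw [h5] at h
  rw [Finset.mul_sum]
  have h6 : ∀ i, Polynomial.eval₂ e' p P.derivative * (Polynomial.C ((b - a) i) * q i) = - (Polynomial.eval₂ e' p (η i P) * Polynomial.C ((b - a) i)) := by
    intro i
    linear_combination Polynomial.C ((b - a) i) * h3 i
  simp only [h6, Finset.sum_neg_distrib]
  linear_combination -h
theorem alg_closed {n d c D : ℕ} {I : Ideal (Po n)} (hI : Good d I) (hc : c + d = n) (hD : trdeg ℂ (Po n ⧸ I) = D) (h32 : 2 * n ≤ 3 * d)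
    (h2 : n + 2 ≤ 2 * d) {F : Type} [Field F] [Algebra ℂ F] {a b : Fin n → F} (hG : Gen I D F a b) (φ : F)
    (hφ : IsIntegral (adjoin ℂ (range (b - a))) φ) : φ ∈ adjoin ℂ (range (b - a)) := by
  obtain ⟨μ, hμ0⟩ := hG.mu
  have hμ : ∀ i, μ ((b - a) i) = algebraMap (Polynomial F) _ (Polynomial.X * Polynomial.C ((b - a) i)) := by
    intro i
    rw [Pi.sub_apply, map_sub, (hμ0 i).1, (hμ0 i).2, ← map_sub]
    congr 1
    rw [map_sub]; ring
  have hinj := (IsFractionRing.injective (Polynomial F) (FractionRing (Polynomial F)))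
  set A := adjoin ℂ (range (b - a))
  have hind : ∀ j : ℕ, ∀ φ : F, IsIntegral A φ → ∀ p : Polynomial F, μ φ = algebraMap (Polynomial F) _ p → p.coeff j ∈ A := by
    intro j
    induction j with
    | zero =>
      intro φ hφ p hp
      obtain ⟨p', hp', c, hc⟩ := mu_int _ μ hμ φ hφ
      have : p = p' := hinj (hp.symm.trans hp')
      rw [this, hc]; exact A.algebraMap_mem c
    | succ j ih =>
      intro φ hφ p hp
      obtain ⟨ψ, hψ, hq⟩ := exists_psi hI hc hD h32 h2 hG μ hμ φ hφ p hp
      choose q hq1 hq2 using fun i => mu_int _ μ hμ (ψ i) (hψ i)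
      have h1 := congrArg (fun s => Polynomial.coeff s j) (hq q hq1)
      simp only [Polynomial.coeff_derivative, Polynomial.finsetSum_coeff, Polynomial.coeff_C_mul] at h1
      have h3 : p.coeff (j + 1) * ((j : F) + 1) ∈ A := by
        rw [h1]
        refine Subalgebra.sum_mem _ fun i _ => mul_mem (Algebra.subset_adjoin ⟨i, rfl⟩) (ih _ (hψ i) _ (hq1 i))
      have h4 := A.smul_mem h3 (((j : ℂ) + 1)⁻¹)
      have h5 : (((j : ℂ) + 1)⁻¹) • (p.coeff (j + 1) * ((j : F) + 1)) = p.coeff (j + 1) := by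
        have hj : (j : ℂ) + 1 ≠ 0 := Nat.cast_add_one_ne_zero j
        have : ((j : F) + 1) = algebraMap ℂ F ((j : ℂ) + 1) := by simp
        rw [this, mul_comm, ← Algebra.smul_def, smul_smul, inv_mul_cancel₀ hj, one_smul]
      rwa [h5] at h4
  obtain ⟨p, hp, _⟩ := mu_int _ μ hμ φ hφ
  have h1 : ∀ v ∈ adjoin ℂ (range a ∪ range b), ∃ V : Polynomial F, μ v = algebraMap (Polynomial F) _ V ∧ V.eval 1 = v := by
    intro v hv
    induction hv using Algebra.adjoin_induction with
    | mem x hx =>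
      rcases hx with ⟨i, rfl⟩ | ⟨i, rfl⟩
      · exact ⟨_, (hμ0 i).1, by simp⟩
      · exact ⟨_, (hμ0 i).2, by simp⟩
    | algebraMap r =>
      refine ⟨Polynomial.C (algebraMap ℂ F r), ?_, by simp⟩
      rw [AlgHom.commutes, IsScalarTower.algebraMap_apply ℂ (Polynomial F), IsScalarTower.algebraMap_apply ℂ F (Polynomial F)]; rfl
    | add x y _ _ hx hy =>
      obtain ⟨V, h1, h2⟩ := hx
      obtain ⟨V', h3, h4⟩ := hy
      exact ⟨V + V', by rw [map_add, map_add, h1, h3], by rw [Polynomial.eval_add, h2, h4]⟩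
    | mul x y _ _ hx hy =>
      obtain ⟨V, h1, h2⟩ := hx
      obtain ⟨V', h3, h4⟩ := hy
      exact ⟨V * V', by rw [map_mul, map_mul, h1, h3], by rw [Polynomial.eval_mul, h2, h4]⟩
  obtain ⟨u, hu, v, hv, hv0, huv⟩ := hG.frac φ
  obtain ⟨U, hU, hU1⟩ := h1 u hu
  obtain ⟨V, hV, hV1⟩ := h1 v hv
  have h6 : V * p = U := by
    apply hinj
    rw [map_mul, ← hV, ← hp, ← map_mul, huv, hU]
  have h7 : p.eval 1 = φ := by
    apply mul_left_cancel₀ hv0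
    rw [huv, ← hU1, ← h6, Polynomial.eval_mul, hV1]
  rw [← h7, Polynomial.eval_eq_sum]
  refine Subalgebra.sum_mem _ fun k _ => ?_
  show p.coeff k * 1 ^ k ∈ A
  rw [one_pow, mul_one]
  exact hind k φ hφ p hp
lemma exists_frac {σ : Type} (J : Ideal (MvPolynomial σ ℂ)) [J.IsPrime] : ∃ (F : Type) (_ : Field F) (_ : Algebra ℂ F)
    (ι : MvPolynomial σ ℂ →ₐ[ℂ] F), (∀ f, ι f = 0 ↔ f ∈ J) ∧ (∀ x : F, ∃ u v, ι v ≠ 0 ∧ ι v * x = ι u) ∧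
      ∀ (T : Type) [CommRing T] [Algebra ℂ T] (g : MvPolynomial σ ℂ →ₐ[ℂ] T), (∀ f ∈ J, g f = 0) → (∀ f, f ∉ J → IsUnit (g f)) →
        ∃ G : F →ₐ[ℂ] T, ∀ f, G (ι f) = g f := by
  let R := MvPolynomial σ ℂ ⧸ J
  have hinj := IsFractionRing.injective R (FractionRing R)
  have h0 : ∀ f, (Algebra.ofId R (FractionRing R)) (Ideal.Quotient.mk J f) = 0 ↔ f ∈ J := by
    intro f
    rw [← Ideal.Quotient.eq_zero_iff_mem]
    exact map_eq_zero_iff _ hinj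
  refine ⟨FractionRing R, inferInstance, inferInstance, ((Algebra.ofId R (FractionRing R)).restrictScalars ℂ).comp (Ideal.Quotient.mkₐ ℂ J), h0, ?_, ?_⟩
  · intro x
    obtain ⟨u, v, hv, rfl⟩ := IsFractionRing.div_surjective (A := R) x
    obtain ⟨u, rfl⟩ := Ideal.Quotient.mk_surjective u
    obtain ⟨v, rfl⟩ := Ideal.Quotient.mk_surjective v
    have hv' : algebraMap R (FractionRing R) (Ideal.Quotient.mk J v) ≠ 0 := by
      rw [map_ne_zero_iff _ hinj]; exact nonZeroDivisors.ne_zero hv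
    exact ⟨u, v, hv', mul_div_cancel₀ _ hv'⟩
  · intro T _ _ g hg hu
    let g' : R →ₐ[ℂ] T := Ideal.Quotient.liftₐ J g hg
    have hu' : ∀ y : nonZeroDivisors R, IsUnit (g' y) := by
      rintro ⟨y, hy⟩
      obtain ⟨y, rfl⟩ := Ideal.Quotient.mk_surjective y
      refine hu y fun h => nonZeroDivisors.ne_zero hy ?_
      exact Ideal.Quotient.eq_zero_iff_mem.mpr h
    refine ⟨IsLocalization.liftAlgHom (M := nonZeroDivisors R) (f := g') hu', fun f => ?_⟩
    show IsLocalization.lift _ (algebraMap R (FractionRing R) (Ideal.Quotient.mk J f)) = _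
    rw [IsLocalization.lift_eq]; rfl

abbrev P2 (n : ℕ) : Type := MvPolynomial (Fin n ⊕ Fin n) ℂ
def J2 {n : ℕ} (I : Ideal (Po n)) : Ideal (P2 n) where
  carrier := {f | ∀ x ∈ Zl I, ∀ y ∈ Zl I, eval (Sum.elim x y) f = 0}
  add_mem' := fun hf hg x hx y hy => by rw [map_add, hf x hx y hy, hg x hx y hy, add_zero]
  zero_mem' := fun x _ y _ => map_zero _
  smul_mem' := fun c f hf x hx y hy => by rw [smul_eq_mul, map_mul, hf x hx y hy, mul_zero]
def sl {n : ℕ} (x : Fin n → ℂ) : P2 n →ₐ[ℂ] Po n := aeval (Sum.elim (fun i => C (x i)) X)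
def sr {n : ℕ} (y : Fin n → ℂ) : P2 n →ₐ[ℂ] Po n := aeval (Sum.elim X (fun i => C (y i)))
lemma eval_sl {n : ℕ} (x y : Fin n → ℂ) (f : P2 n) : eval y (sl x f) = eval (Sum.elim x y) f := by
  rw [sl, eval_aev]; congr 2; funext s; cases s <;> simp
lemma eval_sr {n : ℕ} (x y : Fin n → ℂ) (f : P2 n) : eval x (sr y f) = eval (Sum.elim x y) f := by
  rw [sr, eval_aev]; congr 2; funext s; cases s <;> simp
lemma exists_nz {n : ℕ} {I : Ideal (Po n)} [I.IsPrime] {f : Po n} (hf : f ∉ I) : ∃ x ∈ Zl I, eval x f ≠ 0 := by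
  by_contra! h
  exact hf (mem_of_Zl h)
lemma J2_prime {n : ℕ} (I : Ideal (Po n)) [hI : I.IsPrime] : (J2 I).IsPrime := by
  have hnot : ∀ f, f ∉ J2 I → ∃ x ∈ Zl I, ∃ y ∈ Zl I, eval (Sum.elim x y) f ≠ 0 := by
    intro f hf
    by_contra! h
    exact hf h
  constructor
  · intro h
    have h1 : (1 : P2 n) ∈ J2 I := by rw [h]; trivial
    obtain ⟨x, hx, _⟩ := exists_nz (f := 1) ((Ideal.ne_top_iff_one I).mp hI.ne_top)
    have := h1 x hx x hx
    simp at this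
  · intro f g hfg
    by_contra! h
    obtain ⟨x1, hx1, y1, hy1, h1⟩ := hnot f h.1
    obtain ⟨x2, hx2, y2, hy2, h2⟩ := hnot g h.2
    have h3 : sr y1 f ∉ I := fun h => h1 (by rw [← eval_sr]; exact hx1 _ h)
    have h4 : sr y2 g ∉ I := fun h => h2 (by rw [← eval_sr]; exact hx2 _ h)
    obtain ⟨x, hx, h5⟩ := exists_nz (fun h => (hI.mem_or_mem h).elim h3 h4)
    rw [map_mul, eval_sr, eval_sr] at h5
    have h6 : sl x f ∉ I := fun h => h5 (by rw [← eval_sl, hy1 _ h, zero_mul])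
    have h7 : sl x g ∉ I := fun h => h5 (by rw [← eval_sl x y2, hy2 _ h, mul_zero])
    obtain ⟨y, hy, h8⟩ := exists_nz (fun h => (hI.mem_or_mem h).elim h6 h7)
    rw [← map_mul, eval_sl] at h8
    exact h8 (hfg x hx y hy)
lemma td_gen {n D : ℕ} {I : Ideal (Po n)} [hI : I.IsPrime] (hD : trdeg ℂ (Po n ⧸ I) = D) {F : Type} [Field F] [Algebra ℂ F]
    (ι : P2 n →ₐ[ℂ] F) (hι : ∀ f, ι f = 0 ↔ f ∈ J2 I) : ((2 * D : ℕ) : Cardinal) ≤ trdeg ℂ F := by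
  obtain ⟨t, ht⟩ := exists_isTranscendenceBasis ℂ (Po n ⧸ I)
  have hc : #t = D := ht.cardinalMk_eq_trdeg.trans hD
  let e : Fin D ≃ t := (Cardinal.eq.mp (by rw [hc]; simp)).some
  choose T hT using fun i : Fin D => Ideal.Quotient.mk_surjective (e i).1
  have hTi : ∀ P : Po D, P ≠ 0 → aeval T P ∉ I := by
    intro P hP h
    apply hP
    have hai := ht.1.comp e e.injective
    apply hai
    rw [map_zero, ← Ideal.Quotient.eq_zero_iff_mem.mpr h]
    have := aeval_hom (Ideal.Quotient.mkₐ ℂ I) T P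
    refine Eq.trans ?_ this
    congr 2
    funext i; exact (hT i).symm
  have hex : ∀ P : MvPolynomial (Fin D ⊕ Fin D) ℂ, P ≠ 0 → ∃ x ∈ Zl I, ∃ y ∈ Zl I,
      eval (Sum.elim (fun i => eval x (T i)) (fun i => eval y (T i))) P ≠ 0 := by
    intro P hP
    obtain ⟨s, hs⟩ : ∃ s, eval s P ≠ 0 := by
      by_contra! h
      exact hP (MvPolynomial.funext fun s => by rw [h, map_zero])
    have h1 : sr (s ∘ Sum.inr) P ≠ 0 := by
      intro h
      apply hs
      have := eval_sr (s ∘ Sum.inl) (s ∘ Sum.inr) P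
      rw [h, map_zero, Sum.elim_comp_inl_inr] at this
      exact this.symm
    obtain ⟨x, hx, h2⟩ := exists_nz (hTi _ h1)
    rw [eval_aev, eval_sr] at h2
    have h3 : sl (fun i => eval x (T i)) P ≠ 0 := by
      intro h
      apply h2
      rw [← eval_sl, h, map_zero]
    obtain ⟨y, hy, h4⟩ := exists_nz (hTi _ h3)
    rw [eval_aev, eval_sl] at h4
    exact ⟨x, hx, y, hy, h4⟩
  let T2 : Fin D ⊕ Fin D → P2 n := Sum.elim (fun i => rename Sum.inl (T i)) (fun i => rename Sum.inr (T i))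
  have hA : AlgebraicIndependent ℂ (fun s => ι (T2 s)) := by
    rw [algebraicIndependent_iff]
    intro P hP
    by_contra hne
    obtain ⟨x, hx, y, hy, h⟩ := hex P hne
    rw [aeval_hom, hι] at hP
    apply h
    have h1 := hP x hx y hy
    have h2 : eval (Sum.elim x y) (aeval T2 P) = eval (fun s => eval (Sum.elim x y) (T2 s)) P := by
      have := aeval_hom (aeval (Sum.elim x y) : P2 n →ₐ[ℂ] ℂ) T2 P
      simp only [aeval_eq_eval] at this
      exact this.symm
    rw [h2] at h1
    convert h1 using 3
    funext s
    cases s <;> simp [T2, eval_rename]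
  have := hA.cardinalMk_le_trdeg
  refine le_trans (le_of_eq ?_) this
  simp [two_mul]
lemma der_gen {n : ℕ} {I : Ideal (Po n)} [hI : I.IsPrime] {F : Type} [Field F] [Algebra ℂ F]
    (ι : P2 n →ₐ[ℂ] F) (hι : ∀ f, ι f = 0 ↔ f ∈ J2 I) (hu : ∀ (T : Type) [CommRing T] [Algebra ℂ T] (g : P2 n →ₐ[ℂ] T), (∀ f ∈ J2 I, g f = 0) →
      (∀ f, f ∉ J2 I → IsUnit (g f)) → ∃ G : F →ₐ[ℂ] T, ∀ f, G (ι f) = g f) (hf : ∀ x : F, ∃ u v, ι v ≠ 0 ∧ ι v * x = ι u)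
    (θ : Derivation ℂ (Po n) (Po n)) (hθ : θ ∈ DD I) : ∃ δ : Derivation ℂ F F, (∀ i, δ (ι (X (Sum.inl i))) = 0) ∧
      ∀ i, δ (ι (X (Sum.inr i))) = ι (rename Sum.inr (θ (X i))) := by
  let Δ : Derivation ℂ (P2 n) (P2 n) := mkDerivation ℂ (Sum.elim 0 (fun i => rename Sum.inr (θ (X i))))
  have hΔ : ∀ f ∈ J2 I, Δ f ∈ J2 I := by
    intro f hf x hx y hy
    have h1 : sl x f ∈ I := mem_of_Zl fun y hy => by rw [eval_sl]; exact hf x hx y hy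
    have h2 := hy _ (hθ _ h1)
    rw [sl, chain_rule, ← sl] at h2
    have h3 := chain_rule Δ X f
    rw [aeval_X_left_apply] at h3
    rw [h3, ← h2]
    simp only [smul_eq_mul, Fintype.sum_sum_type, map_add, map_sum, map_mul, aeval_X_left_apply, Δ, mkDerivation_X, Sum.elim_inl, Sum.elim_inr,
      Pi.zero_apply, map_zero, mul_zero, derivation_C, eval_sl, eval_rename, Sum.elim_comp_inr]
  let g : P2 n →ₐ[ℂ] TrivSqZeroExt F F := aeval (fun s => TrivSqZeroExt.inl (ι (X s)) + TrivSqZeroExt.inr (ι (Δ (X s))))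
  have hg : ∀ f, (g f).fst = ι f ∧ (g f).snd = ι (Δ f) := by
    intro f
    induction f using MvPolynomial.induction_on with
    | C c =>
      have h1 : g (C c) = algebraMap ℂ _ c := aeval_C _ c
      have h2 : ι (C c) = algebraMap ℂ F c := ι.commutes c
      rw [h1, h2, derivation_C, map_zero]; exact ⟨rfl, rfl⟩
    | add p q hp hq => simp [hp, hq]
    | mul_X p j hp =>
      have h1 : g (X j) = TrivSqZeroExt.inl (ι (X j)) + TrivSqZeroExt.inr (ι (Δ (X j))) := aeval_X _ j
      rw [map_mul, TrivSqZeroExt.fst_mul, TrivSqZeroExt.snd_mul, Derivation.leibniz, h1, hp.1, hp.2]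
      simp [mul_comm]
  obtain ⟨G, hG⟩ := hu _ g (fun f hf => TrivSqZeroExt.ext ((hg f).1.trans ((hι f).mpr hf)) ((hg f).2.trans ((hι _).mpr (hΔ f hf))))
    (fun f hf => by rw [TrivSqZeroExt.isUnit_iff_isUnit_fst, (hg f).1, isUnit_iff_ne_zero]; exact fun h => hf ((hι f).mp h))
  have hfst : ∀ x, (G x).fst = x := by
    intro x
    obtain ⟨u, v, hv, huv⟩ := hf x
    have h1 := congrArg (fun y => (G y).fst) huv
    simp only [map_mul, hG, TrivSqZeroExt.fst_mul, (hg _).1] at h1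
    exact mul_left_cancel₀ hv (h1.trans huv.symm)
  let δ : Derivation ℂ F F := Derivation.mk' ((TrivSqZeroExt.sndHom F F).restrictScalars ℂ ∘ₗ G.toLinearMap) (fun x y => by
    show (G (x * y)).snd = x • (G y).snd + y • (G x).snd
    rw [map_mul, TrivSqZeroExt.snd_mul, hfst, hfst]; simp [mul_comm])
  have hδ : ∀ f, δ (ι f) = ι (Δ f) := fun f => by
    show (G (ι f)).snd = _
    rw [hG, (hg f).2]
  refine ⟨δ, fun i => ?_, fun i => ?_⟩
  · rw [hδ]; simp [Δ, mkDerivation_X]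
  · rw [hδ]; simp [Δ, mkDerivation_X]
lemma mu_gen {n : ℕ} {I : Ideal (Po n)} (hI : Hmg I) {F : Type} [Field F] [Algebra ℂ F]
    (ι : P2 n →ₐ[ℂ] F) (hι : ∀ f, ι f = 0 ↔ f ∈ J2 I) (hu : ∀ (T : Type) [CommRing T] [Algebra ℂ T] (g : P2 n →ₐ[ℂ] T), (∀ f ∈ J2 I, g f = 0) →
      (∀ f, f ∉ J2 I → IsUnit (g f)) → ∃ G : F →ₐ[ℂ] T, ∀ f, G (ι f) = g f) :
    ∃ μ : F →ₐ[ℂ] FractionRing (Polynomial F), ∀ s, μ (ι (X s)) = algebraMap (Polynomial F) _ (Polynomial.X * Polynomial.C (ι (X s))) := by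
  have hZ : ∀ x ∈ Zl I, ∀ c : ℂ, c • x ∈ Zl I := by
    intro x hx c f hf
    rw [← sum_homogeneousComponent f, map_sum]
    refine Finset.sum_eq_zero fun k _ => ?_
    have := aeval_scale (homogeneousComponent_isHomogeneous k f) c x
    simp only [aeval_eq_eval] at this
    have h2 : (c • x) = fun i => c * x i := rfl
    rw [h2]
    refine this.trans ?_
    have h3 : eval x (homogeneousComponent k f) = 0 := hx _ (hI f hf k)
    simp [h3]
  let g0 : P2 n →ₐ[ℂ] Polynomial F := aeval (fun s => Polynomial.X * Polynomial.C (ι (X s)))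
  have hev : ∀ (c : ℂ) f, (g0 f).eval (algebraMap ℂ F c) = ι (aeval (fun s => C c * X s) f) := by
    intro c f
    induction f using MvPolynomial.induction_on with
    | C r =>
      have h1 : g0 (C r) = algebraMap ℂ _ r := aeval_C _ r
      rw [h1, aeval_C, IsScalarTower.algebraMap_apply ℂ F (Polynomial F), ι.commutes]; simp
    | add p q hp hq => simp [hp, hq]
    | mul_X p j hp =>
      have h1 : g0 (X j) = Polynomial.X * Polynomial.C (ι (X j)) := aeval_X _ j
      have h2 : ι (C c) = algebraMap ℂ F c := ι.commutes c
      simp [hp, h1, h2]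
      exact Or.inl (mul_comm _ _)
  have hg0 : ∀ f ∈ J2 I, g0 f = 0 := by
    intro f hf
    apply Polynomial.eq_zero_of_infinite_isRoot
    refine Set.Infinite.mono ?_ (Set.infinite_range_of_injective (algebraMap ℂ F).injective)
    rintro _ ⟨c, rfl⟩
    show (g0 f).eval _ = 0
    rw [hev, hι]
    intro x hx y hy
    have h2 : eval (Sum.elim x y) (aeval (fun s => C c * X s) f : P2 n) = eval (Sum.elim (c • x) (c • y)) f := by
      have := aeval_hom (aeval (Sum.elim x y) : P2 n →ₐ[ℂ] ℂ) (fun s => C c * X s) f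
      simp only [aeval_eq_eval] at this
      refine this.symm.trans ?_
      congr 2
      funext s; cases s <;> simp
    rw [h2]
    exact hf _ (hZ x hx c) _ (hZ y hy c)
  have hg1 : ∀ f, f ∉ J2 I → g0 f ≠ 0 := by
    intro f hf h
    apply hf
    have := hev 1 f
    rw [h, map_one, Polynomial.eval_zero] at this
    rw [← hι, this]
    congr 1
    simp
  obtain ⟨G, hG⟩ := hu (FractionRing (Polynomial F)) (((Algebra.ofId (Polynomial F) (FractionRing (Polynomial F))).restrictScalars ℂ).comp g0)
    (fun f hf => by
      show algebraMap (Polynomial F) _ (g0 f) = 0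
      rw [hg0 f hf, map_zero]) (fun f hf => by
      rw [isUnit_iff_ne_zero]
      show algebraMap (Polynomial F) _ (g0 f) ≠ 0
      rw [map_ne_zero_iff _ (IsFractionRing.injective _ _)]
      exact hg1 f hf)
  refine ⟨G, fun s => ?_⟩
  rw [hG]
  show algebraMap (Polynomial F) _ (g0 (X s)) = _
  congr 1
  exact aeval_X _ s
theorem exists_Gen {n D : ℕ} {I : Ideal (Po n)} [hI : I.IsPrime] (hh : Hmg I) (hD : trdeg ℂ (Po n ⧸ I) = D) :
    ∃ (F : Type) (_ : Field F) (_ : Algebra ℂ F) (a b : Fin n → F), Gen I D F a b ∧ ∀ f : P2 n, aeval (Sum.elim a b) f = 0 ↔ f ∈ J2 I := by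
  have := J2_prime I
  obtain ⟨F, _, _, ι, h1, h2, h3⟩ := exists_frac (J2 I)
  let a : Fin n → F := fun i => ι (X (Sum.inl i))
  let b : Fin n → F := fun i => ι (X (Sum.inr i))
  have hι : ∀ f, ι f = aeval (Sum.elim a b) f := by
    intro f
    rw [aeval_unique ι]
    congr 2
    funext s; cases s <;> rfl
  have ha : ∀ f : Po n, ι (rename Sum.inl f) = aeval a f := by
    intro f; rw [hι, aeval_rename]; rfl
  have hb : ∀ f : Po n, ι (rename Sum.inr f) = aeval b f := by
    intro f; rw [hι, aeval_rename]; rfl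
  refine ⟨F, inferInstance, inferInstance, a, b, ⟨?_, ?_, ?_, td_gen hD ι h1, ?_, ?_⟩, fun f => by rw [← hι]; exact h1 f⟩
  · intro f hf
    rw [← ha, h1]
    intro x hx y hy
    rw [eval_rename]; exact hx f hf
  · intro f hf
    rw [← hb, h1]
    intro x hx y hy
    rw [eval_rename]; exact hy f hf
  · intro x
    obtain ⟨u, v, hv, huv⟩ := h2 x
    have hm : ∀ f, ι f ∈ adjoin ℂ (range a ∪ range b) := by
      intro f
      rw [hι, ← Sum.elim_range, Algebra.adjoin_range_eq_range_aeval]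
      exact ⟨f, rfl⟩
    exact ⟨_, hm u, _, hm v, hv, huv⟩
  · intro θ hθ
    obtain ⟨δ, h4, h5⟩ := der_gen ι h1 h3 h2 θ hθ
    exact ⟨δ, h4, fun i => by rw [h5, hb]⟩
  · obtain ⟨μ, hμ⟩ := mu_gen hh ι h1 h3
    exact ⟨μ, fun i => ⟨hμ _, hμ _⟩⟩
lemma disj {K F L : Type} [Field K] [Field F] [Field L] [Algebra K F] [Algebra K L] [CharZero K] [FiniteDimensional K L]
    (hcl : ∀ x : F, IsIntegral K x → x ∈ range (algebraMap K F)) :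
    ∃ j : L →ₐ[K] AlgebraicClosure F, ∀ {ι : Type} [Fintype ι] (v : ι → F), LinearIndependent K v →
      ∀ c : ι → L, ∑ i, j (c i) * algebraMap F _ (v i) = 0 → c = 0 := by
  classical
  let j : L →ₐ[K] AlgebraicClosure F := IsAlgClosed.lift
  refine ⟨j, fun {ι} _ v hv c hc => ?_⟩
  let pb := Field.powerBasisOfFiniteOfSeparable K L
  set α := j pb.gen
  have hα : IsIntegral K α := (pb.isIntegral_gen).map j
  have hαF : IsIntegral F α := hα.tower_top
  have hmin : minpoly K α = minpoly K pb.gen := minpoly.algHom_eq j j.injective _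
  have hdeg : (minpoly K α).natDegree ≤ (minpoly F α).natDegree := by
    have h1 : ∀ k, (minpoly F α).coeff k ∈ range (algebraMap K F) := fun k => hcl _
      (Polynomial.isIntegral_coeff_of_dvd (minpoly K α) _ (minpoly.monic hα) (minpoly.monic hαF)
        (minpoly.dvd_map_of_isScalarTower K F α) k)
    have h2 : minpoly F α ∈ Polynomial.lifts (algebraMap K F) := by
      rw [Polynomial.lifts_iff_coeff_lifts]; exact h1
    obtain ⟨q, hq, hqd, hqm⟩ := Polynomial.lifts_and_natDegree_eq_and_monic h2 (minpoly.monic hαF)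
    rw [← hqd]
    apply Polynomial.natDegree_le_of_dvd _ hqm.ne_zero
    apply minpoly.dvd
    have := minpoly.aeval F α
    rw [← hq, Polynomial.aeval_map_algebraMap] at this
    exact this
  have hli : LinearIndependent F fun k : Fin pb.dim => α ^ (k : ℕ) := by
    have h3 : pb.dim ≤ (minpoly F α).natDegree := by
      rw [← pb.natDegree_minpoly, ← hmin]; exact hdeg
    exact (linearIndependent_pow (K := F) α).comp (Fin.castLE h3) (Fin.castLE_injective h3)
  have hexp : ∀ i, j (c i) = ∑ k : Fin pb.dim, algebraMap K _ (pb.basis.repr (c i) k) * α ^ (k : ℕ) := by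
    intro i
    conv_lhs => rw [← pb.basis.sum_repr (c i)]
    simp [map_sum, α, Algebra.smul_def, PowerBasis.coe_basis]
  have h4 : ∑ k : Fin pb.dim, (∑ i, (pb.basis.repr (c i) k) • v i) • α ^ (k : ℕ) = 0 := by
    rw [← hc]
    simp_rw [hexp, Finset.sum_smul, Finset.sum_mul]
    rw [Finset.sum_comm]
    refine Finset.sum_congr rfl fun i _ => Finset.sum_congr rfl fun k _ => ?_
    rw [Algebra.smul_def, Algebra.smul_def, map_mul, ← IsScalarTower.algebraMap_apply]
    ring
  have h5 := Fintype.linearIndependent_iff.mp hli _ h4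
  ext i
  apply pb.basis.repr.injective
  ext k
  rw [Fintype.linearIndependent_iff.mp hv _ (h5 k) i]
  simp
lemma bn {A K : Type} [CommRing A] [IsDomain A] [Field K] [Algebra A K] [IsFractionRing A K] {σ : Type} [Finite σ]
    (c : Ideal (MvPolynomial σ A)) : (∃ h : A, h ≠ 0 ∧ C h ∈ c) ∨
    ∃ (L : Type) (_ : Field L) (_ : Algebra K L) (_ : FiniteDimensional K L) (u : σ → L),
      ∀ f ∈ c, eval₂ ((algebraMap K L).comp (algebraMap A K)) u f = 0 := by
  by_cases hd : Disjoint (((nonZeroDivisors A).map (C (σ := σ)) : Submonoid _) : Set (MvPolynomial σ A)) (c : Set (MvPolynomial σ A))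
  · right
    let _ : Algebra (MvPolynomial σ A) (MvPolynomial σ K) := MvPolynomial.algebraMvPolynomial
    have h1 := (IsLocalization.map_algebraMap_ne_top_iff_disjoint ((nonZeroDivisors A).map (C (σ := σ)))
      (MvPolynomial σ K) c).mpr hd
    obtain ⟨M, hM, hcM⟩ := Ideal.exists_le_maximal _ h1
    let _ : Field (MvPolynomial σ K ⧸ M) := Ideal.Quotient.field M
    refine ⟨MvPolynomial σ K ⧸ M, inferInstance, inferInstance,
      finite_of_finite_type_of_isJacobsonRing K (MvPolynomial σ K ⧸ M), fun i => Ideal.Quotient.mk M (X i), fun f hf => ?_⟩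
    have h2 : Ideal.Quotient.mk M (map (algebraMap A K) f) = 0 := by
      rw [Ideal.Quotient.eq_zero_iff_mem]
      exact hcM (Ideal.mem_map_of_mem _ hf)
    rw [← h2]
    have h3 : (eval₂Hom ((algebraMap K (MvPolynomial σ K ⧸ M)).comp (algebraMap A K)) fun i => Ideal.Quotient.mk M (X i))
        = (Ideal.Quotient.mk M).comp (map (algebraMap A K)) := by
      apply MvPolynomial.ringHom_ext
      · intro a
        simp only [eval₂Hom_C, RingHom.comp_apply, map_C]; rfl
      · intro i; simp
    exact congrArg (fun g => g f) h3
  · left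
    rw [Set.not_disjoint_iff] at hd
    obtain ⟨_, ⟨h, hh, rfl⟩, hc⟩ := hd
    exact ⟨h, nonZeroDivisors.ne_zero hh, hc⟩
def low {R : Type} [CommRing R] {e : ℕ} (d : ℕ) (B : Finset (Fin e →₀ ℕ)) (u : Fin d × B → R) :
    Polynomial (MvPolynomial (Fin e) R) :=
  ∑ i : Fin d × B, Polynomial.monomial (i.1 : ℕ) (monomial (i.2 : Fin e →₀ ℕ) (u i))
lemma low_map {R S : Type} [CommRing R] [CommRing S] (φ : R →+* S) {e : ℕ} (d : ℕ) (B : Finset (Fin e →₀ ℕ))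
    (u : Fin d × B → R) : (low d B u).map (MvPolynomial.map φ) = low d B (fun i => φ (u i)) := by
  simp only [low, Polynomial.map_sum, Polynomial.map_monomial, MvPolynomial.map_monomial]
lemma low_deg {R : Type} [CommRing R] {e : ℕ} (d : ℕ) (B : Finset (Fin e →₀ ℕ)) (u : Fin d × B → R) :
    (low d B u).degree < d := by
  rw [low]
  refine (Polynomial.degree_sum_le _ _).trans_lt ?_
  rw [Finset.sup_lt_iff (by exact_mod_cast WithBot.bot_lt_coe d)]
  intro i _
  exact (Polynomial.degree_monomial_le _ _).trans_lt (by exact_mod_cast i.1.2)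
lemma low_coeff {R : Type} [CommRing R] {e : ℕ} (d : ℕ) (B : Finset (Fin e →₀ ℕ)) (u : Fin d × B → R) (i : Fin d × B) :
    ((low d B u).coeff i.1).coeff i.2 = u i := by
  classical
  simp only [low, Polynomial.finsetSum_coeff, coeff_sum, Polynomial.coeff_monomial]
  rw [Finset.sum_eq_single i]
  · simp
  · intro j _ hj
    split_ifs with h1
    · rw [coeff_monomial, if_neg]
      intro h2
      exact hj (Prod.ext (Fin.ext h1) (Subtype.ext h2))
    · simp
  · simp
lemma low_surj {R : Type} [CommRing R] {e : ℕ} (d : ℕ) (B : Finset (Fin e →₀ ℕ)) (P : Polynomial (MvPolynomial (Fin e) R))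
    (hP : P.degree < d) (hB : ∀ k, (P.coeff k).support ⊆ B) : P = low d B (fun i => (P.coeff i.1).coeff i.2) := by
  classical
  ext k m
  by_cases hk : k < d
  · by_cases hm : m ∈ B
    · exact (low_coeff d B (fun i => (P.coeff i.1).coeff i.2) (⟨k, hk⟩, ⟨m, hm⟩)).symm
    · have : (P.coeff k).coeff m = 0 := by
        rw [← notMem_support_iff]; exact fun h => hm (hB k h)
      rw [this]
      simp only [low, Polynomial.finsetSum_coeff, coeff_sum, Polynomial.coeff_monomial]
      symm; apply Finset.sum_eq_zero
      intro i _
      split_ifs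
      · rw [coeff_monomial, if_neg]; rintro rfl; exact hm i.2.2
      · simp
  · have h1 : (d : WithBot ℕ) ≤ k := by exact_mod_cast not_lt.mp hk
    rw [Polynomial.coeff_eq_zero_of_degree_lt (hP.trans_le h1),
      Polynomial.coeff_eq_zero_of_degree_lt ((low_deg d B _).trans_le h1)]
lemma low_monic {R : Type} [CommRing R] [Nontrivial R] {e : ℕ} (d : ℕ) (B : Finset (Fin e →₀ ℕ)) (u : Fin d × B → R) :
    (Polynomial.X ^ d + low d B u).Monic ∧ (Polynomial.X ^ d + low d B u).natDegree = d :=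
  ⟨Polynomial.monic_X_pow_add (low_deg d B u), by
    apply Polynomial.natDegree_eq_of_degree_eq_some
    rw [Polynomial.degree_add_eq_left_of_degree_lt, Polynomial.degree_X_pow]
    rw [Polynomial.degree_X_pow]; exact low_deg d B u⟩
lemma low_eval {R S : Type} [CommRing R] [CommRing S] (φ : R →+* S) {e : ℕ} (t : Fin e → S) (θ : S) (d : ℕ)
    (B : Finset (Fin e →₀ ℕ)) (u : Fin d × B → R) : (low d B u).eval₂ (eval₂Hom φ t) θ =
      ∑ i, φ (u i) * ((i.2 : Fin e →₀ ℕ).prod (fun k a => t k ^ a) * θ ^ (i.1 : ℕ)) := by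
  simp only [low, Polynomial.eval₂_finsetSum, Polynomial.eval₂_monomial, coe_eval₂Hom, eval₂_monomial]
  exact Finset.sum_congr rfl fun i _ => by ring
lemma no_fac {A K F L : Type} [CommRing A] [IsDomain A] [Field K] [Field F] [Field L] [Algebra A K] [IsFractionRing A K]
    [Algebra K F] [Algebra A F] [IsScalarTower A K F] [Algebra K L] [CharZero K] [FiniteDimensional K L]
    (hcl : ∀ x : F, IsIntegral K x → x ∈ range (algebraMap K F)) {e N : ℕ} (t : Fin e → F) (θ : F)
    (hmin : ∀ P : Polynomial (MvPolynomial (Fin e) A), P.degree < N → P.eval₂ (eval₂Hom (algebraMap A F) t) θ = 0 → P = 0)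
    (G : Polynomial (MvPolynomial (Fin e) A)) (hG : G.Monic) (hGN : G.natDegree = N)
    (hGθ : G.eval₂ (eval₂Hom (algebraMap A F) t) θ = 0)
    (f g : Polynomial (MvPolynomial (Fin e) L)) (hf : f.Monic) (hg : g.Monic)
    (hfg : f * g = G.map (MvPolynomial.map ((algebraMap K L).comp (algebraMap A K)))) : f.natDegree = 0 ∨ g.natDegree = 0 := by
  classical
  obtain ⟨j, hj⟩ := disj (L := L) hcl
  let E := AlgebraicClosure F
  let i : F →+* E := algebraMap F E
  let ev : Polynomial (MvPolynomial (Fin e) L) →+* E :=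
    Polynomial.eval₂RingHom (eval₂Hom (j : L →+* E) (fun k => i (t k))) (i θ)
  have hev : ev (f * g) = 0 := by
    rw [hfg]
    show Polynomial.eval₂ _ _ _ = 0
    rw [Polynomial.eval₂_map]
    have h1 : (eval₂Hom (j : L →+* E) (fun k => i (t k))).comp (MvPolynomial.map ((algebraMap K L).comp (algebraMap A K)))
        = i.comp (eval₂Hom (algebraMap A F) t) := by
      apply MvPolynomial.ringHom_ext
      · intro a
        simp only [RingHom.comp_apply, map_C, eval₂Hom_C, AlgHom.coe_toRingHom, AlgHom.commutes]
        show algebraMap K E (algebraMap A K a) = algebraMap F E (algebraMap A F a)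
        rw [IsScalarTower.algebraMap_apply A K F, ← IsScalarTower.algebraMap_apply K F E]
      · intro k; simp
    rw [h1, ← Polynomial.hom_eval₂, hGθ, map_zero]
  have key : ∀ Q : Polynomial (MvPolynomial (Fin e) L), Q.degree < N → ev Q = 0 → Q = 0 := by
    intro Q hQ hQ0
    let B : Finset (Fin e →₀ ℕ) := Q.support.biUnion fun k => (Q.coeff k).support
    have hB : ∀ k, (Q.coeff k).support ⊆ B := by
      intro k m hm
      rw [Finset.mem_biUnion]
      refine ⟨k, ?_, hm⟩
      rw [Polynomial.mem_support_iff]; intro h; rw [h] at hm; simp at hm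
    have hl := low_surj N B Q hQ hB
    set u := (fun i : Fin N × B => (Q.coeff i.1).coeff (i.2 : Fin e →₀ ℕ))
    let v : Fin N × B → F := fun i => (i.2 : Fin e →₀ ℕ).prod (fun k a => t k ^ a) * θ ^ (i.1 : ℕ)
    have hv : LinearIndependent K v := by
      rw [← LinearIndependent.iff_fractionRing A K, Fintype.linearIndependent_iff]
      intro c hc i
      have h2 := hmin (low N B c) (low_deg _ _ _) (by
        rw [low_eval, ← hc]; exact Finset.sum_congr rfl fun i _ => (Algebra.smul_def _ _).symm)
      rw [← low_coeff N B c i, h2]; simp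
    have h3 : u = 0 := by
      apply hj v hv
      rw [hl] at hQ0
      rw [← hQ0]
      show _ = Polynomial.eval₂ _ _ _
      rw [low_eval]
      refine Finset.sum_congr rfl fun k _ => ?_
      simp only [v, map_mul, map_pow, Finsupp.prod, map_prod]
      rfl
    rw [hl, h3]; simp [low]
  have hd : f.natDegree + g.natDegree = N := by
    rw [← hf.natDegree_mul hg, hfg, hG.natDegree_map, hGN]
  by_contra hcon
  push Not at hcon
  rw [map_mul, mul_eq_zero] at hev
  rcases hev with h | h
  · exact hf.ne_zero (key f (by rw [Polynomial.degree_eq_natDegree hf.ne_zero]; exact_mod_cast (by omega)) h)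
  · exact hg.ne_zero (key g (by rw [Polynomial.degree_eq_natDegree hg.ne_zero]; exact_mod_cast (by omega)) h)
lemma fse_map {R S : Type} [CommRing R] [CommRing S] (φ : R →+* S) {e : ℕ} (p : MvPolynomial (Fin (e + 1)) R) :
    finSuccEquiv S e (MvPolynomial.map φ p) = (finSuccEquiv R e p).map (MvPolynomial.map φ) := by
  have : ((finSuccEquiv S e).toAlgHom.toRingHom.comp (MvPolynomial.map φ)) =
      (Polynomial.mapRingHom (MvPolynomial.map φ)).comp (finSuccEquiv R e).toAlgHom.toRingHom := by
    apply MvPolynomial.ringHom_ext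
    · intro a; simp [finSuccEquiv_apply]
    · intro k
      refine Fin.cases ?_ (fun k => ?_) k
      · simp [finSuccEquiv_apply]
      · simp [finSuccEquiv_apply]
  exact congrArg (fun g => g p) this
lemma fac_bound {R S : Type} [CommRing R] [CommRing S] [IsDomain S] {e : ℕ} (G : Polynomial (MvPolynomial (Fin e) R)) :
    ∃ B : Finset (Fin e →₀ ℕ), ∀ (φ : R →+* S) (f g : Polynomial (MvPolynomial (Fin e) S)), f.Monic → g.Monic →
      f * g = G.map (MvPolynomial.map φ) → (∀ k, (f.coeff k).support ⊆ B) ∧ ∀ k, (g.coeff k).support ⊆ B := by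
  classical
  let T := ((finSuccEquiv R e).symm G).totalDegree
  let B : Finset (Fin e →₀ ℕ) := (Finset.range (T + 1)).biUnion fun k => Finset.finsuppAntidiag Finset.univ k
  have hB : ∀ p : MvPolynomial (Fin (e+1)) S, p.totalDegree ≤ T → ∀ k, ((finSuccEquiv S e p).coeff k).support ⊆ B := by
    intro p hp k m hm
    have h1 : (finSuccEquiv S e p).coeff k ≠ 0 := by intro h; rw [h] at hm; simp at hm
    have h2 := totalDegree_coeff_finSuccEquiv_add_le p k h1
    have h3 := le_totalDegree hm
    rw [Finset.mem_biUnion]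
    refine ⟨m.sum fun _ a => a, ?_, ?_⟩
    · rw [Finset.mem_range]; omega
    · rw [Finset.mem_finsuppAntidiag]
      exact ⟨by rw [Finsupp.sum_fintype _ _ (fun _ => rfl)], Finset.subset_univ _⟩
  refine ⟨B, fun φ f g hf hg hfg => ?_⟩
  obtain ⟨p, rfl⟩ := (finSuccEquiv S e).surjective f
  obtain ⟨q, rfl⟩ := (finSuccEquiv S e).surjective g
  have h4 : p * q = MvPolynomial.map φ ((finSuccEquiv R e).symm G) := by
    apply (finSuccEquiv S e).injective
    rw [map_mul, fse_map, AlgEquiv.apply_symm_apply, hfg]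
  have hp : p ≠ 0 := by rintro rfl; exact hf.ne_zero (map_zero _)
  have hq : q ≠ 0 := by rintro rfl; exact hg.ne_zero (map_zero _)
  have h5 := totalDegree_mul_of_isDomain hp hq
  have h6 : (p * q).totalDegree ≤ T := by
    rw [h4]
    apply Finset.sup_mono
    exact support_map_subset _ _
  exact ⟨hB p (by omega), hB q (by omega)⟩
def Gf {R : Type} [CommRing R] {e : ℕ} (d d' : ℕ) (B : Finset (Fin e →₀ ℕ)) (u : (Fin d × B) ⊕ (Fin d' × B) → R) :
    Polynomial (MvPolynomial (Fin e) R) :=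
  (Polynomial.X ^ d + low d B (fun i => u (Sum.inl i))) * (Polynomial.X ^ d' + low d' B (fun i => u (Sum.inr i)))
lemma Gf_map {R S : Type} [CommRing R] [CommRing S] (ψ : R →+* S) {e : ℕ} (d d' : ℕ) (B : Finset (Fin e →₀ ℕ))
    (u : (Fin d × B) ⊕ (Fin d' × B) → R) :
    (Gf d d' B u).map (MvPolynomial.map ψ) = Gf d d' B (fun i => ψ (u i)) := by
  simp only [Gf, Polynomial.map_mul, Polynomial.map_add, Polynomial.map_pow, Polynomial.map_X, low_map]
lemma irr_open {A K : Type} [CommRing A] [IsDomain A] [Field K] [Algebra A K] [IsFractionRing A K] {e : ℕ}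
    (G : Polynomial (MvPolynomial (Fin e) A)) (hG : G.Monic) (hN : 0 < G.natDegree)
    (H : ∀ (L : Type) [Field L] [Algebra K L] [FiniteDimensional K L] (f g : Polynomial (MvPolynomial (Fin e) L)),
      f.Monic → g.Monic → f * g = G.map (MvPolynomial.map ((algebraMap K L).comp (algebraMap A K))) →
        f.natDegree = 0 ∨ g.natDegree = 0) :
    ∃ h : A, h ≠ 0 ∧ ∀ φ : A →+* ℂ, φ h ≠ 0 → Irreducible (G.map (MvPolynomial.map φ)) := by
  classical
  obtain ⟨B, hB⟩ := fac_bound (S := ℂ) G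
  have step : ∀ d d' : ℕ, d ≠ 0 → d' ≠ 0 → d + d' = G.natDegree → ∃ h : A, h ≠ 0 ∧ ∀ φ : A →+* ℂ, φ h ≠ 0 →
      ∀ f g : Polynomial (MvPolynomial (Fin e) ℂ), f.Monic → g.Monic → f * g = G.map (MvPolynomial.map φ) →
      f.natDegree = d → g.natDegree = d' → False := by
    intro d d' hd hd' hdd
    let σ := (Fin d × B) ⊕ (Fin d' × B)
    let Δ : Polynomial (MvPolynomial (Fin e) (MvPolynomial σ A)) := Gf d d' B (fun i => X i) - G.map (MvPolynomial.map C)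
    let c : Ideal (MvPolynomial σ A) := Ideal.span (range fun p : ℕ × (Fin e →₀ ℕ) => (Δ.coeff p.1).coeff p.2)
    have hΔ : ∀ {S : Type} [CommRing S] (φ : A →+* S) (u : σ → S),
        Δ.map (MvPolynomial.map (eval₂Hom φ u)) = Gf d d' B u - G.map (MvPolynomial.map φ) := by
      intro S _ φ u
      rw [Polynomial.map_sub, Gf_map, Polynomial.map_map]
      congr 2
      · funext i; simp
      · ext <;> simp
    rcases bn (K := K) c with ⟨h, hh, hc⟩ | ⟨L, _, _, _, u, hu⟩
    · refine ⟨h, hh, fun φ hφ f g hf hg hfg hfd hgd => hφ ?_⟩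
      obtain ⟨h1, h2⟩ := hB φ f g hf hg hfg
      have mk : ∀ (d : ℕ) (f : Polynomial (MvPolynomial (Fin e) ℂ)), f.Monic → f.natDegree = d →
          (∀ k, (f.coeff k).support ⊆ B) → ∃ u : Fin d × B → ℂ, f = Polynomial.X ^ d + low d B u := by
        intro d f hf hd hs
        have h3 : (f - Polynomial.X ^ d).degree < (d : WithBot ℕ) := by
          have := Polynomial.degree_sub_lt_left (p := f) (q := Polynomial.X ^ d) (by
            rw [Polynomial.degree_X_pow, Polynomial.degree_eq_natDegree hf.ne_zero, hd]) hf.ne_zero (by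
            rw [hf.leadingCoeff, (Polynomial.monic_X_pow d).leadingCoeff])
          rwa [Polynomial.degree_eq_natDegree hf.ne_zero, hd] at this
        refine ⟨_, eq_add_of_sub_eq' (low_surj d B _ h3 fun k => ?_)⟩
        by_cases hk : k = d
        · subst hk
          have : f.coeff k = 1 := by rw [← hd]; exact hf
          simp [this]
        · simpa [Polynomial.coeff_X_pow, hk] using hs k
      obtain ⟨u, hu⟩ := mk d f hf hfd h1
      obtain ⟨v, hv⟩ := mk d' g hg hgd h2
      have h4 := hΔ φ (Sum.elim u v)
      have h5 : Gf d d' B (Sum.elim u v) = f * g := by rw [hu, hv]; rfl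
      rw [h5, hfg, sub_self] at h4
      have h6 : c ≤ RingHom.ker (eval₂Hom φ (Sum.elim u v)) := by
        rw [Ideal.span_le]
        rintro _ ⟨p, rfl⟩
        have := congrArg (fun P => (P.coeff p.1).coeff p.2) h4
        simpa [Polynomial.coeff_map, coeff_map] using this
      have := h6 hc
      rw [RingHom.mem_ker, eval₂Hom_C] at this
      exact this
    · exfalso
      have h4 := hΔ ((algebraMap K L).comp (algebraMap A K)) u
      have h5 : Δ.map (MvPolynomial.map (eval₂Hom ((algebraMap K L).comp (algebraMap A K)) u)) = 0 := by
        ext k m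
        rw [Polynomial.coeff_map, coeff_map]
        exact hu _ (Ideal.subset_span ⟨(k, m), rfl⟩)
      rw [h5] at h4
      have h6 := low_monic d B (fun i => u (Sum.inl i))
      have h7 := low_monic d' B (fun i => u (Sum.inr i))
      rcases H L _ _ h6.1 h7.1 (sub_eq_zero.mp h4.symm) with h | h
      · exact hd (h6.2.symm.trans h)
      · exact hd' (h7.2.symm.trans h)
  have step' : ∀ d : ℕ, ∃ h : A, h ≠ 0 ∧ (d ≠ 0 → d < G.natDegree → ∀ φ : A →+* ℂ, φ h ≠ 0 →
      ∀ f g : Polynomial (MvPolynomial (Fin e) ℂ), f.Monic → g.Monic → f * g = G.map (MvPolynomial.map φ) →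
      f.natDegree = d → g.natDegree = G.natDegree - d → False) := by
    intro d
    by_cases h : d ≠ 0 ∧ d < G.natDegree
    · obtain ⟨a, ha, hb⟩ := step d (G.natDegree - d) h.1 (by omega) (by omega)
      exact ⟨a, ha, fun _ _ => hb⟩
    · exact ⟨1, one_ne_zero, fun h1 h2 => absurd ⟨h1, h2⟩ h⟩
  choose h hh0 hh using step'
  refine ⟨∏ d ∈ Finset.range G.natDegree, h d, Finset.prod_ne_zero_iff.mpr fun d _ => hh0 d, fun φ hφ => ?_⟩
  rw [map_prod, Finset.prod_ne_zero_iff] at hφ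
  have hm := hG.map (MvPolynomial.map φ : MvPolynomial (Fin e) A →+* _)
  rw [hm.irreducible_iff_natDegree]
  have hnd : (G.map (MvPolynomial.map φ)).natDegree = G.natDegree := hG.natDegree_map _
  refine ⟨fun h1 => ?_, fun f g hf hg hfg => ?_⟩
  · rw [h1, Polynomial.natDegree_one] at hnd; omega
  · by_contra hcon
    push Not at hcon
    have hd : f.natDegree + g.natDegree = G.natDegree := by rw [← hf.natDegree_mul hg, hfg, hnd]
    exact hh f.natDegree hcon.1 (by omega) φ (hφ _ (Finset.mem_range.mpr (by omega))) f g hf hg hfg rfl (by omega)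

abbrev rho {n e : ℕ} {S : Type} [CommRing S] [Algebra ℂ S] (w : Fin n → S) (t : Fin e → S) : MvPolynomial (Fin e) (Po n) →+* S :=
  eval₂Hom (aeval w : Po n →ₐ[ℂ] S).toRingHom t
lemma rho_spec {n e : ℕ} {S T : Type} [CommRing S] [Algebra ℂ S] [CommRing T] [Algebra ℂ T] (π : S →ₐ[ℂ] T)
    (w : Fin n → S) (t : Fin e → S) (z : Fin n → ℂ) (hz : ∀ i, π (w i) = algebraMap ℂ T (z i)) :
    (π : S →+* T).comp (rho w t) = (aeval (fun i => π (t i)) : MvPolynomial (Fin e) ℂ →ₐ[ℂ] T).toRingHom.comp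
      (MvPolynomial.map (eval z)) := by
  apply MvPolynomial.ringHom_ext
  · intro a
    have h : π.comp (aeval w) = (Algebra.ofId ℂ T).comp (aeval z : Po n →ₐ[ℂ] ℂ) := by
      ext i; simp [hz]
    have := congrArg (fun g => g a) h
    simpa [algHom_C] using this
  · intro k; simp
lemma trdeg_R0 (n e : ℕ) : trdeg ℂ (MvPolynomial (Fin e) (Po n)) = ((n + e : ℕ) : Cardinal) := by
  rw [← (sumAlgEquiv ℂ (Fin e) (Fin n)).trdeg_eq, MvPolynomial.trdeg_of_isDomain]
  simp [add_comm]
lemma tau_inj {e : ℕ} {T : Type} [CommRing T] [IsDomain T] [Algebra ℂ T] (hT : (e : Cardinal) ≤ trdeg ℂ T)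
    (τ : MvPolynomial (Fin e) ℂ →ₐ[ℂ] T) (hτ : τ.IsIntegral) : Function.Injective τ := by
  have _ : (RingHom.ker τ).IsPrime := RingHom.ker_isPrime _
  by_contra hcon
  have hk : RingHom.ker τ ≠ ⊥ := fun h => hcon ((RingHom.injective_iff_ker_eq_bot _).mpr h)
  have h1 := trdeg_quot_lt (k := ℂ) (RingHom.ker τ) hk
  have h2 := trdeg_of_isIntegral (Ideal.kerLiftAlg τ) (Ideal.kerLiftAlg_injective τ) (by
    intro x
    obtain ⟨p, hp, hx⟩ := hτ x
    refine ⟨p.map (Ideal.Quotient.mk _), hp.map _, ?_⟩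
    rw [Polynomial.eval₂_map]
    exact hx)
  rw [← h2, MvPolynomial.trdeg_of_isDomain] at h1
  simp only [mk_fin, lift_natCast] at h1
  have h3 : (e : Cardinal) + 1 ≤ e := (add_le_add_left hT 1).trans h1
  have : e + 1 ≤ e := by exact_mod_cast h3
  omega
lemma fib_step {n e : ℕ} {S T : Type} [CommRing S] [Algebra ℂ S] [CommRing T] [IsDomain T] [Algebra ℂ T] (π : S →ₐ[ℂ] T)
    (hπ : Function.Surjective π) (w : Fin n → S) (t : Fin e → S) (θ : S) (h : Po n) (G : Polynomial (MvPolynomial (Fin e) (Po n)))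
    (hint : ∀ s, ∃ N : ℕ, (rho w t).IsIntegralElem (aeval w h ^ N * s)) (hGθ : G.eval₂ (rho w t) θ = 0)
    (z : Fin n → ℂ) (hz : ∀ i, π (w i) = algebraMap ℂ T (z i)) (hh : eval z h ≠ 0)
    (hirr : Irreducible (G.map (MvPolynomial.map (eval z)))) (hT : (e : Cardinal) ≤ trdeg ℂ T) :
    (∀ q, MvPolynomial.map (eval z) q ≠ 0 → π (rho w t q) ≠ 0) ∧
    ∀ P : Polynomial (MvPolynomial (Fin e) (Po n)), π (P.eval₂ (rho w t) θ) = 0 ↔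
      G.map (MvPolynomial.map (eval z)) ∣ P.map (MvPolynomial.map (eval z)) := by
  set τ : MvPolynomial (Fin e) ℂ →ₐ[ℂ] T := aeval (fun i => π (t i))
  have hsp := rho_spec π w t z hz
  have hspa : ∀ q, π (rho w t q) = τ (MvPolynomial.map (eval z) q) := fun q => congrArg (fun g => g q) hsp
  have hτ : τ.IsIntegral := by
    intro x
    obtain ⟨s, rfl⟩ := hπ x
    obtain ⟨N, p, hp, hs⟩ := hint s
    have h1 : τ.toRingHom.IsIntegralElem (π (aeval w h ^ N * s)) := by
      refine ⟨p.map (MvPolynomial.map (eval z)), hp.map _, ?_⟩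
      rw [Polynomial.eval₂_map, ← hsp]
      have := congrArg π hs
      rw [map_zero] at this
      rw [← this]
      exact (Polynomial.hom_eval₂ p (rho w t) (π : S →+* T) _).symm
    have h2 : π (aeval w h) = algebraMap ℂ T (eval z h) := by
      have := hspa (C h)
      simpa [τ, algHom_C] using this
    have h3 : π s = τ (C ((eval z h) ^ N)⁻¹) * π (aeval w h ^ N * s) := by
      rw [map_mul, map_pow, h2, algHom_C, ← mul_assoc, ← map_pow (algebraMap ℂ T), ← map_mul, inv_mul_cancel₀ (pow_ne_zero _ hh), map_one, one_mul]
    rw [h3]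
    exact RingHom.IsIntegralElem.mul _ (RingHom.isIntegralElem_map _) h1
  have hinj := tau_inj hT τ hτ
  refine ⟨fun q hq => ?_, fun P => ?_⟩
  · rw [hspa]; exact fun h0 => hq (hinj (by rw [h0, map_zero]))
  · let _ : Algebra (MvPolynomial (Fin e) ℂ) T := τ.toRingHom.toAlgebra
    have _ : FaithfulSMul (MvPolynomial (Fin e) ℂ) T := (faithfulSMul_iff_algebraMap_injective _ _).mpr hinj
    have hev : ∀ P : Polynomial (MvPolynomial (Fin e) (Po n)), π (P.eval₂ (rho w t) θ) =
        Polynomial.aeval (π θ) (P.map (MvPolynomial.map (eval z))) := by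
      intro P
      rw [Polynomial.aeval_def, Polynomial.eval₂_map]
      show _ = Polynomial.eval₂ (τ.toRingHom.comp _) _ _
      rw [← hsp]
      exact Polynomial.hom_eval₂ P (rho w t) (π : S →+* T) _
    have hi : IsIntegral (MvPolynomial (Fin e) ℂ) (π θ) := hτ _
    have hm : minpoly (MvPolynomial (Fin e) ℂ) (π θ) ∣ G.map (MvPolynomial.map (eval z)) := by
      apply minpoly.isIntegrallyClosed_dvd hi
      rw [← hev, hGθ, map_zero]
    have has := (hirr.dvd_iff.mp hm).resolve_left (minpoly.not_isUnit _ _)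
    rw [hev, minpoly.isIntegrallyClosed_dvd_iff hi]
    exact has.dvd_iff_dvd_left.symm
lemma fib_ne_top {n e : ℕ} {S : Type} [CommRing S] [IsDomain S] [Algebra ℂ S]
    (w : Fin n → S) (t : Fin e → S) (h : Po n) (hρ : Function.Injective (rho w t))
    (hint : ∀ s, ∃ N : ℕ, (rho w t).IsIntegralElem (aeval w h ^ N * s))
    (z : Fin n → ℂ) (hh : eval z h ≠ 0) : Ideal.span (range fun i => w i - algebraMap ℂ S (z i)) ≠ ⊤ := by
  classical
  intro htop
  have h1 : (1 : S) ∈ Ideal.span (range fun i => w i - algebraMap ℂ S (z i)) := by rw [htop]; trivial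
  obtain ⟨c, hc⟩ := (Ideal.mem_span_range_iff_exists_fun).mp h1
  choose N hN using fun i => hint (c i)
  let _ : Algebra (MvPolynomial (Fin e) (Po n)) S := (rho w t).toAlgebra
  let S' := integralClosure (MvPolynomial (Fin e) (Po n)) S
  have hr : ∀ p, algebraMap (MvPolynomial (Fin e) (Po n)) S p = rho w t p := fun _ => rfl
  have hk : (RingHom.ker (MvPolynomial.map (eval z) : MvPolynomial (Fin e) (Po n) →+* MvPolynomial (Fin e) ℂ)).IsPrime :=
    RingHom.ker_isPrime _
  have hinj' : Function.Injective (algebraMap (MvPolynomial (Fin e) (Po n)) S') := by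
    intro x y hxy
    exact hρ (congrArg Subtype.val hxy)
  obtain ⟨Q, hQ, hQc⟩ := Ideal.exists_ideal_over_prime_of_isIntegral_of_isDomain (S := S')
    (RingHom.ker (MvPolynomial.map (eval z) : MvPolynomial (Fin e) (Po n) →+* MvPolynomial (Fin e) ℂ))
    (by rw [(RingHom.injective_iff_ker_eq_bot _).mp hinj']; exact bot_le)
  have hmem : ∀ p : MvPolynomial (Fin e) (Po n), algebraMap _ S' p ∈ Q ↔ MvPolynomial.map (eval z) p = 0 := by
    intro p; rw [← Ideal.mem_comap, hQc, RingHom.mem_ker]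
  let M := ∑ i, N i
  have hM : ∀ i, IsIntegral (MvPolynomial (Fin e) (Po n)) (rho w t (C h) ^ M * c i) := by
    intro i
    have : M = (M - N i) + N i := (Nat.sub_add_cancel (Finset.single_le_sum (f := N) (fun _ _ => Nat.zero_le _) (Finset.mem_univ i))).symm
    rw [this, pow_add, mul_assoc]
    refine IsIntegral.mul ((isIntegral_algebraMap (x := C h)).pow _) ?_
    rw [show rho w t (C h) = aeval w h by simp [rho]]
    exact hN i
  have h2 : algebraMap (MvPolynomial (Fin e) (Po n)) S' (C h ^ M) ∈ Q := by
    have h3 : algebraMap (MvPolynomial (Fin e) (Po n)) S' (C h ^ M) = ∑ i, (⟨_, hM i⟩ : S') * algebraMap (MvPolynomial (Fin e) (Po n)) S' (C (X i - C (z i))) := by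
      apply Subtype.val_injective
      show rho w t (C h ^ M) = S'.val _
      rw [map_sum]
      simp only [map_mul]
      show _ = ∑ i, (rho w t (C h) ^ M * c i) * rho w t (C (X i - C (z i)))
      rw [map_pow]
      conv_lhs => rw [← mul_one (rho w t (C h) ^ M), ← hc, Finset.mul_sum]
      refine Finset.sum_congr rfl fun i _ => ?_
      simp [rho, mul_assoc, algHom_C]
    rw [h3]
    refine Q.sum_mem fun i _ => Q.mul_mem_left _ ((hmem _).mpr ?_)
    simp
  rw [hmem, map_pow, map_C] at h2
  exact hh (C_eq_zero.mp (eq_zero_of_pow_eq_zero h2))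
lemma fib_irr {n e : ℕ} {S : Type} [CommRing S] [IsDomain S] [Algebra ℂ S] [FiniteType ℂ S]
    (w : Fin n → S) (t : Fin e → S) (θ : S) (h : Po n) (G : Polynomial (MvPolynomial (Fin e) (Po n)))
    (hρ : Function.Injective (rho w t))
    (hint : ∀ s, ∃ N : ℕ, (rho w t).IsIntegralElem (aeval w h ^ N * s)) (hGθ : G.eval₂ (rho w t) θ = 0)
    (q : MvPolynomial (Fin e) (Po n)) (hq : ∀ s, ∃ (N : ℕ) (P : Polynomial (MvPolynomial (Fin e) (Po n))), rho w t q ^ N * s = P.eval₂ (rho w t) θ)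
    (z : Fin n → ℂ) (hh : eval z h ≠ 0)
    (hirr : Irreducible (G.map (MvPolynomial.map (eval z)))) (hqz : MvPolynomial.map (eval z) q ≠ 0) :
    (Ideal.span (range fun i => w i - algebraMap ℂ S (z i))).radical.IsPrime := by
  set J := Ideal.span (range fun i => w i - algebraMap ℂ S (z i))
  have hJ : J ≠ ⊤ := fib_ne_top w t h hρ hint z hh
  have htd : ((n + e : ℕ) : Cardinal) ≤ trdeg ℂ S := by
    rw [← trdeg_R0 n e]
    exact trdeg_le_of_injective (⟨rho w t, fun c => by
      rw [show algebraMap ℂ (MvPolynomial (Fin e) (Po n)) c = C (C c) from rfl]; simp [rho, algHom_C]⟩ : _ →ₐ[ℂ] S) hρ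
  choose N P hP using hq
  have key : ∀ r ∈ J.minimalPrimes, ∀ s, s ∈ r ↔ G.map (MvPolynomial.map (eval z)) ∣ (P s).map (MvPolynomial.map (eval z)) := by
    intro r hr s
    have _ : r.IsPrime := hr.1.1
    obtain ⟨T, _, _, _, _, π, hπ, hker, htT⟩ := quot_wrap r
    have h1 := pit_iter (k := ℂ) n (fun i => w i - algebraMap ℂ S (z i)) r hr
    rw [← htT] at h1
    have h2 : (e : Cardinal) ≤ trdeg ℂ T := by
      have h3 := htd.trans h1
      obtain ⟨D, hD⟩ := exists_trdeg_nat (k := ℂ) (S := T)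
      rw [hD] at h3 ⊢
      have : n + e ≤ D + n := by exact_mod_cast h3
      exact_mod_cast (by omega : e ≤ D)
    have h4 := fib_step π hπ w t θ h G hint hGθ z (fun i => by
      have : π (w i - algebraMap ℂ S (z i)) = 0 := (hker _).mpr (hr.1.2 (Ideal.subset_span ⟨i, rfl⟩))
      rw [map_sub, sub_eq_zero, AlgHom.commutes] at this
      exact this) hh hirr h2
    rw [← h4.2, ← hP, map_mul, map_pow, ← hker]
    constructor
    · intro h; rw [h, mul_zero]
    · intro h
      exact (mul_eq_zero.mp h).resolve_left (pow_ne_zero _ (h4.1 q hqz))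
  obtain ⟨M, hM, hJM⟩ := Ideal.exists_le_maximal J hJ
  obtain ⟨r, hr, -⟩ := Ideal.exists_minimalPrimes_le hJM
  have : J.minimalPrimes = {r} := by
    ext r'
    constructor
    · intro hr'
      exact Ideal.ext fun s => (key r' hr' s).trans (key r hr s).symm
    · rintro rfl; exact hr
  rw [← Ideal.sInf_minimalPrimes, this, sInf_singleton]
  exact hr.1.1
lemma pow_adj {A S : Type} [CommRing A] [CommRing S] [Algebra A S] (T : Subring S) (h : S)
    (hh : h ∈ T) (hA : ∀ a : A, algebraMap A S a ∈ T) (s0 : Set S) (hs0 : adjoin A s0 = ⊤)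
    (hs : ∀ s ∈ s0, h * s ∈ T) (s : S) : ∃ N : ℕ, h ^ N * s ∈ T := by
  have hp : ∀ k, h ^ k ∈ T := fun k => T.pow_mem hh k
  have : s ∈ adjoin A s0 := by rw [hs0]; trivial
  induction this using Algebra.adjoin_induction with
  | mem x hx => exact ⟨1, by simpa using hs x hx⟩
  | algebraMap a => exact ⟨0, by simpa using hA a⟩
  | add x y _ _ hx hy =>
    obtain ⟨N, hN⟩ := hx; obtain ⟨M, hM⟩ := hy
    refine ⟨N + M, ?_⟩
    have : h ^ (N + M) * (x + y) = h ^ M * (h ^ N * x) + h ^ N * (h ^ M * y) := by ring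
    rw [this]
    exact T.add_mem (T.mul_mem (hp M) hN) (T.mul_mem (hp N) hM)
  | mul x y _ _ hx hy =>
    obtain ⟨N, hN⟩ := hx; obtain ⟨M, hM⟩ := hy
    refine ⟨N + M, ?_⟩
    have : h ^ (N + M) * (x * y) = (h ^ N * x) * (h ^ M * y) := by ring
    rw [this]
    exact T.mul_mem hN hM
lemma rel_noether {A K S F : Type} [CommRing A] [IsDomain A] [Field K] [CommRing S] [Field F] [Algebra A K] [IsFractionRing A K]
    [Algebra A S] [FiniteType A S] [Algebra S F] [FaithfulSMul S F] [Algebra A F] [IsScalarTower A S F] [Algebra K F]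
    [IsScalarTower A K F] : ∃ (e : ℕ) (t : Fin e → S) (h : A), h ≠ 0 ∧ Function.Injective (eval₂Hom (algebraMap A S) t) ∧
      ∀ s, ∃ N : ℕ, (eval₂Hom (algebraMap A S) t).IsIntegralElem (algebraMap A S h ^ N * s) := by
  classical
  obtain ⟨s0, hs0⟩ := (inferInstance : FiniteType A S).out
  let i := algebraMap S F
  have hi : Function.Injective i := FaithfulSMul.algebraMap_injective S F
  let U : Subalgebra K F := adjoin K (i '' s0)
  have hU : FiniteType K U := by
    rw [← Subalgebra.fg_iff_finiteType]
    exact ⟨s0.image i, by rw [Finset.coe_image]⟩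
  obtain ⟨e, g, hg, hgi⟩ := exists_integral_inj_algHom_of_fg K U
  have hden : ∀ u ∈ U, ∃ (a : A) (s : S), a ≠ 0 ∧ algebraMap A F a * u = i s := by
    intro u hu
    have hi' : ∀ a, algebraMap A F a = i (algebraMap A S a) := fun a => IsScalarTower.algebraMap_apply A S F a
    induction hu using Algebra.adjoin_induction with
    | mem x hx => obtain ⟨s, _, rfl⟩ := hx; exact ⟨1, s, one_ne_zero, by simp⟩
    | algebraMap k =>
      obtain ⟨a, b, hb, rfl⟩ := IsFractionRing.div_surjective (A := A) k
      have hb0 := nonZeroDivisors.ne_zero hb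
      refine ⟨b, algebraMap A S a, hb0, ?_⟩
      have hb1 : algebraMap A K b ≠ 0 := by simpa using hb0
      rw [← hi', IsScalarTower.algebraMap_apply A K F b, ← map_mul, mul_div_cancel₀ _ hb1, ← IsScalarTower.algebraMap_apply]
    | add x y _ _ hx hy =>
      obtain ⟨a, s, ha, hs⟩ := hx; obtain ⟨b, r, hb, hr⟩ := hy
      refine ⟨a * b, algebraMap A S b * s + algebraMap A S a * r, mul_ne_zero ha hb, ?_⟩
      simp only [map_add, map_mul, ← hs, ← hr, ← hi']; ring
    | mul x y _ _ hx hy =>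
      obtain ⟨a, s, ha, hs⟩ := hx; obtain ⟨b, r, hb, hr⟩ := hy
      refine ⟨a * b, s * r, mul_ne_zero ha hb, ?_⟩
      simp only [map_mul, ← hs, ← hr]; ring
  choose a t ha ht using fun k => hden (g (X k)) (g (X k)).2
  let τ : MvPolynomial (Fin e) K →ₐ[K] F := aeval fun k => i (t k)
  let κ : Fin e → K := fun k => algebraMap A K (a k)
  have hκ : ∀ k, κ k ≠ 0 := fun k => by simpa [κ] using ha k
  let ψ : MvPolynomial (Fin e) K →ₐ[K] MvPolynomial (Fin e) K := aeval fun k => C (κ k) * X k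
  let ψ' : MvPolynomial (Fin e) K →ₐ[K] MvPolynomial (Fin e) K := aeval fun k => C (κ k)⁻¹ * X k
  have hψ : ψ'.comp ψ = AlgHom.id K _ := by
    ext1 k
    simp only [ψ, ψ', AlgHom.comp_apply, aeval_X, map_mul, algHom_C, MvPolynomial.algebraMap_eq, AlgHom.id_apply]
    rw [← mul_assoc, ← C_mul, mul_inv_cancel₀ (hκ k), C_1, one_mul]
  have hτ1 : τ = (U.val.comp g).comp ψ := by
    ext1 k
    simp only [τ, ψ, AlgHom.comp_apply, aeval_X, map_mul, algHom_C, ← ht]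
    rw [IsScalarTower.algebraMap_apply A K F]; rfl
  have hτ2 : U.val.comp g = τ.comp ψ' := by
    ext1 k
    simp only [τ, ψ', AlgHom.comp_apply, aeval_X, map_mul, algHom_C, ← ht]
    rw [IsScalarTower.algebraMap_apply A K F, ← mul_assoc, ← map_mul, inv_mul_cancel₀ (hκ k), map_one, one_mul]; rfl
  have hτinj : Function.Injective τ := by
    rw [hτ1]
    have : Function.Injective ψ := Function.LeftInverse.injective (g := ψ') fun x => congrArg (fun f => f x) hψ
    exact (Subtype.val_injective.comp hg).comp this
  have hτint : ∀ u ∈ U, τ.toRingHom.IsIntegralElem u := by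
    intro u hu
    obtain ⟨p, hp, hpu⟩ := hgi ⟨u, hu⟩
    refine ⟨p.map ψ'.toRingHom, hp.map _, ?_⟩
    rw [Polynomial.eval₂_map]
    have h1 : τ.toRingHom.comp ψ'.toRingHom = (U.val : U →+* F).comp g.toRingHom := by
      rw [show τ.toRingHom.comp ψ'.toRingHom = (τ.comp ψ').toRingHom from rfl, ← hτ2]; rfl
    rw [h1]
    have := congrArg U.val hpu
    rw [map_zero] at this
    rw [← this]
    exact (Polynomial.hom_eval₂ p g.toRingHom (U.val : U →+* F) ⟨u, hu⟩).symm
  let ρ := eval₂Hom (algebraMap A S) t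
  have hρτ : i.comp ρ = τ.toRingHom.comp (MvPolynomial.map (algebraMap A K)) := by
    apply MvPolynomial.ringHom_ext
    · intro x
      simp only [ρ, RingHom.comp_apply, eval₂Hom_C, map_C]
      show i _ = τ (C _)
      rw [algHom_C]
      exact (IsScalarTower.algebraMap_apply A S F x).symm.trans (IsScalarTower.algebraMap_apply A K F x)
    · intro k; simp [ρ, τ]
  have hρinj : Function.Injective ρ := by
    have h2 : Function.Injective (i.comp ρ) := by
      rw [hρτ]
      exact hτinj.comp (map_injective _ (IsFractionRing.injective A K))
    exact Function.Injective.of_comp h2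
  have hdesc : ∀ s : S, (i.comp ρ).IsIntegralElem (i s) → ρ.IsIntegralElem s := by
    rintro s ⟨p, hp, hps⟩
    refine ⟨p, hp, hi ?_⟩
    rw [Polynomial.hom_eval₂, map_zero, hps]
  have hmul : ∀ s ∈ s0, ∃ c : A, c ≠ 0 ∧ ρ.IsIntegralElem (algebraMap A S c * s) := by
    intro s hs
    let _ : Algebra (MvPolynomial (Fin e) A) (MvPolynomial (Fin e) K) := MvPolynomial.algebraMvPolynomial
    let _ : Algebra (MvPolynomial (Fin e) K) F := τ.toRingHom.toAlgebra
    let _ : Algebra (MvPolynomial (Fin e) A) F := (i.comp ρ).toAlgebra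
    have _ : IsScalarTower (MvPolynomial (Fin e) A) (MvPolynomial (Fin e) K) F := IsScalarTower.of_algebraMap_eq fun x =>
      congrArg (fun f => f x) hρτ
    obtain ⟨⟨_, c, hc, rfl⟩, hm⟩ := IsIntegral.exists_multiple_integral_of_isLocalization
      ((nonZeroDivisors A).map (C (σ := Fin e))) (Rₘ := MvPolynomial (Fin e) K) (i s)
      (hτint _ (subset_adjoin ⟨s, hs, rfl⟩))
    refine ⟨c, nonZeroDivisors.ne_zero hc, hdesc _ ?_⟩
    have h3 : i (algebraMap A S c * s) = (C c : MvPolynomial (Fin e) A) • i s := by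
      rw [Algebra.smul_def, map_mul]
      congr 1
      show _ = i (ρ (C c))
      simp [ρ]
    rw [h3]; exact hm
  choose! c hc0 hc using hmul
  have hCint : ∀ x : A, ρ.IsIntegralElem (algebraMap A S x) := fun x => by
    have := RingHom.isIntegralElem_map ρ (x := C x)
    simpa [ρ] using this
  refine ⟨e, t, ∏ s ∈ s0, c s, Finset.prod_ne_zero_iff.mpr hc0, hρinj, fun s => ?_⟩
  let _ := ρ.toAlgebra
  refine pow_adj (integralClosure (MvPolynomial (Fin e) A) S).toSubring _ (hCint _) hCint (s0 : Set S) hs0 (fun s hs => ?_) s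
  rw [← Finset.prod_erase_mul _ _ hs, map_mul, mul_assoc]
  exact RingHom.IsIntegralElem.mul _ (hCint _) (hc s hs)
lemma prim {R S : Type} [CommRing R] [IsDomain R] [CharZero R] [CommRing S] [IsDomain S] [Algebra R S] [FaithfulSMul R S]
    [FiniteType R S] (halg : ∀ s : S, IsAlgebraic R s) : ∃ (θ : S) (q : R), IsIntegral R θ ∧ q ≠ 0 ∧
      ∀ s : S, ∃ (N : ℕ) (P : Polynomial R), algebraMap R S q ^ N * s = Polynomial.aeval θ P := by
  classical
  obtain ⟨s0, hs0⟩ := (inferInstance : FiniteType R S).out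
  let F := FractionRing S
  let Q := FractionRing R
  have _ : FaithfulSMul R F := FaithfulSMul.trans R S F
  let _ : Algebra Q F := FractionRing.liftAlgebra R F
  have _ : IsScalarTower R Q F := FractionRing.isScalarTower_liftAlgebra R F
  have hi : Function.Injective (algebraMap S F) := IsFractionRing.injective S F
  have hRF : Function.Injective (algebraMap R F) := FaithfulSMul.algebraMap_injective R F
  have halgF : ∀ s : S, IsAlgebraic Q (algebraMap S F s) := fun s =>
    ((halg s).algebraMap (A := F)).extendScalars (IsFractionRing.injective R Q)
  let L := IntermediateField.adjoin Q (algebraMap S F '' s0)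
  have _ : FiniteDimensional Q L := by
    have : Finite (algebraMap S F '' s0) := (s0.finite_toSet.image _)
    apply IntermediateField.finiteDimensional_adjoin
    rintro _ ⟨s, _, rfl⟩
    exact (halgF s).isIntegral
  have _ : CharZero Q := charZero_of_injective_algebraMap (IsFractionRing.injective R Q)
  let pb := Field.powerBasisOfFiniteOfSeparable Q L
  let θ0 : F := pb.gen
  obtain ⟨x, y, hy, hxy⟩ := IsFractionRing.div_surjective (A := S) θ0
  obtain ⟨r1, hr1, y', hy'⟩ := (halg y).exists_nonzero_dvd hy
  have hy0 : algebraMap S F y ≠ 0 := by simpa using nonZeroDivisors.ne_zero hy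
  have h1 : algebraMap S F (x * y') = algebraMap R F r1 * θ0 := by
    rw [← hxy, IsScalarTower.algebraMap_apply R S F, hy', map_mul, map_mul, mul_comm (algebraMap S F y), mul_assoc, mul_div_cancel₀ _ hy0, mul_comm]
  obtain ⟨r2, hr2, hθ⟩ := (halg (x * y')).exists_integral_multiple
  let θ : S := r2 • (x * y')
  have hr : algebraMap R F (r2 * r1) ≠ 0 := by
    rw [Ne, map_eq_zero_iff _ hRF]; exact mul_ne_zero hr2 hr1
  have hθ0 : θ0 = algebraMap Q F (algebraMap R Q (r2 * r1))⁻¹ * algebraMap S F θ := by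
    have : algebraMap S F θ = algebraMap R F (r2 * r1) * θ0 := by
      simp only [θ, Algebra.smul_def, map_mul] at h1 ⊢
      rw [h1, ← IsScalarTower.algebraMap_apply, mul_assoc]
    rw [this, map_inv₀, ← IsScalarTower.algebraMap_apply, ← mul_assoc, inv_mul_cancel₀ hr, one_mul]
  have hgen : ∀ s ∈ s0, ∃ (c : R) (P : Polynomial R), c ≠ 0 ∧ algebraMap R S c * s = Polynomial.aeval θ P := by
    intro s hs
    obtain ⟨f, hf⟩ := pb.exists_eq_aeval' ⟨algebraMap S F s, IntermediateField.subset_adjoin _ _ ⟨s, hs, rfl⟩⟩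
    have hf1 : algebraMap S F s = Polynomial.aeval θ0 f := by
      have := congrArg L.val hf
      rw [← Polynomial.aeval_algHom_apply] at this
      exact this
    obtain ⟨b, hbm, hb⟩ := IsLocalization.integerNormalization_spec (nonZeroDivisors R)
      (f.comp (Polynomial.C (algebraMap R Q (r2 * r1))⁻¹ * Polynomial.X))
    refine ⟨b, IsLocalization.integerNormalization (nonZeroDivisors R)
      (f.comp (Polynomial.C (algebraMap R Q (r2 * r1))⁻¹ * Polynomial.X)), nonZeroDivisors.ne_zero hbm, hi ?_⟩
    have h3 := congrArg (Polynomial.aeval (algebraMap S F θ)) hb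
    rw [Polynomial.aeval_map_algebraMap, Polynomial.aeval_algebraMap_apply] at h3
    rw [h3, map_mul, hf1, ← IsScalarTower.algebraMap_apply, hθ0, Algebra.smul_def, map_mul (Polynomial.aeval _),
      Polynomial.aeval_comp, map_mul (Polynomial.aeval _), Polynomial.aeval_C, Polynomial.aeval_X,
      Polynomial.algebraMap_apply, Polynomial.aeval_C, ← IsScalarTower.algebraMap_apply]
  choose! c P hc0 hc using hgen
  refine ⟨θ, ∏ s ∈ s0, c s, hθ, Finset.prod_ne_zero_iff.mpr hc0, fun s => ?_⟩
  let T := (Polynomial.aeval (R := R) θ).range.toSubring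
  have hT : ∀ a : R, algebraMap R S a ∈ T := fun a => ⟨Polynomial.C a, by simp⟩
  obtain ⟨N, P, hP⟩ := pow_adj T (algebraMap R S (∏ s ∈ s0, c s)) (hT _) hT (s0 : Set S) hs0 (fun s hs => by
    rw [← Finset.prod_erase_mul _ _ hs, map_mul, mul_assoc]
    exact T.mul_mem (hT _) ⟨P s, (hc s hs).symm⟩) s
  exact ⟨N, P, hP.symm⟩
lemma fibE {n : ℕ} {S F : Type} [CommRing S] [IsDomain S] [Algebra ℂ S] [FiniteType ℂ S] [Field F] [Algebra ℂ F]
    (j : S →ₐ[ℂ] F) (hj : Function.Injective j) (w : Fin n → S) (hw : Function.Injective (aeval (fun i => j (w i)) : Po n →ₐ[ℂ] F))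
    (hcl : ∀ φ : F, IsIntegral (adjoin ℂ (range fun i => j (w i))) φ → φ ∈ adjoin ℂ (range fun i => j (w i))) :
    ∃ h : Po n, h ≠ 0 ∧ ∀ z, eval z h ≠ 0 → (Ideal.span (range fun i => w i - algebraMap ℂ S (z i))).radical.IsPrime := by
  classical
  let _ : Algebra (Po n) F := (aeval (fun i => j (w i)) : Po n →ₐ[ℂ] F).toRingHom.toAlgebra
  have hmap : ∀ f, algebraMap (Po n) F f = aeval (fun i => j (w i)) f := fun f => rfl
  have _ : IsScalarTower ℂ (Po n) F := IsScalarTower.of_algebraMap_eq fun c => by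
    show _ = aeval _ (C c); simp
  have _ : FaithfulSMul (Po n) F := (faithfulSMul_iff_algebraMap_injective _ _).mpr hw
  let K := FractionRing (Po n)
  let _ : Algebra K F := FractionRing.liftAlgebra (Po n) F
  have _ : IsScalarTower (Po n) K F := FractionRing.isScalarTower_liftAlgebra (Po n) F
  have hclK : ∀ x : F, IsIntegral K x → x ∈ range (algebraMap K F) := by
    intro x hx
    obtain ⟨⟨m, hm⟩, hmx⟩ := hx.exists_multiple_integral_of_isLocalization (nonZeroDivisors (Po n)) x
    have h1 := hcl _ (int_ofPo (fun i => j (w i)) _ hmx)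
    rw [Algebra.adjoin_range_eq_range_aeval] at h1
    obtain ⟨f, hf⟩ := h1
    have hm0 : algebraMap (Po n) F m ≠ 0 := by
      rw [hmap, Ne, map_eq_zero_iff _ hw]; exact nonZeroDivisors.ne_zero hm
    refine ⟨algebraMap (Po n) K f / algebraMap (Po n) K m, ?_⟩
    rw [map_div₀, ← IsScalarTower.algebraMap_apply, ← IsScalarTower.algebraMap_apply, div_eq_iff hm0, hmap f]
    exact hf.trans (by rw [mul_comm]; exact Algebra.smul_def m x)
  let _ : Algebra (Po n) S := (aeval w : Po n →ₐ[ℂ] S).toRingHom.toAlgebra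
  have _ : IsScalarTower ℂ (Po n) S := IsScalarTower.of_algebraMap_eq fun c => by
    show _ = aeval w (C c); simp
  let _ : Algebra S F := j.toRingHom.toAlgebra
  have _ : FaithfulSMul S F := (faithfulSMul_iff_algebraMap_injective _ _).mpr hj
  have hjw : ∀ f, j (aeval w f) = aeval (fun i => j (w i)) f := fun f => by
    rw [← AlgHom.comp_apply, MvPolynomial.comp_aeval]
  have _ : IsScalarTower (Po n) S F := IsScalarTower.of_algebraMap_eq fun f => (hjw f).symm
  have _ : FiniteType (Po n) S := FiniteType.of_restrictScalars_finiteType ℂ (Po n) S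
  obtain ⟨e, t, h1, h10, hρ, hint⟩ := rel_noether (A := Po n) (K := K) (S := S) (F := F)
  change Function.Injective (rho w t) at hρ
  change ∀ s, ∃ N : ℕ, (rho w t).IsIntegralElem (aeval w h1 ^ N * s) at hint
  have hw1 : aeval w h1 ≠ 0 := by
    intro h; apply h10; apply hw; rw [← hjw, h]; simp
  let R := MvPolynomial (Fin e) (Po n)
  let _ : Algebra R S := (rho w t).toAlgebra
  have hR : ∀ f : R, algebraMap R S f = rho w t f := fun f => rfl
  have _ : FaithfulSMul R S := (faithfulSMul_iff_algebraMap_injective _ _).mpr hρ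
  have _ : IsScalarTower (Po n) R S := IsScalarTower.of_algebraMap_eq fun f => by
    rw [hR]; show _ = rho w t (C f); simp [rho]; rfl
  have _ : FiniteType R S := FiniteType.of_restrictScalars_finiteType (Po n) R S
  have halg : ∀ s : S, IsAlgebraic R s := by
    intro s
    obtain ⟨N, hN⟩ := hint s
    have h2 : IsAlgebraic R ((C h1 ^ N : R) • s) := by
      have : IsIntegral R (aeval w h1 ^ N * s) := hN
      have h3 := this.isAlgebraic
      have h4 : (C h1 ^ N : R) • s = aeval w h1 ^ N * s := by
        rw [Algebra.smul_def, hR, map_pow]; simp [rho]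
      rwa [h4]
    exact IsAlgebraic.of_smul (mem_nonZeroDivisors_of_ne_zero (pow_ne_zero N (fun h => h10 (C_injective _ _ (h.trans C_0.symm))))) h2
  have _ : CharZero R := charZero_of_injective_algebraMap (algebraMap ℂ R).injective
  obtain ⟨θ, q, hθ, hq0, hq⟩ := prim (R := R) (S := S) halg
  let G := minpoly R θ
  have hG : G.Monic := minpoly.monic hθ
  have hGθ : G.eval₂ (rho w t) θ = 0 := minpoly.aeval R θ
  have hev : ∀ P : Polynomial R, P.eval₂ (eval₂Hom (algebraMap (Po n) F) (fun i => j (t i))) (j θ) = j (P.eval₂ (rho w t) θ) := by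
    intro P
    have : eval₂Hom (algebraMap (Po n) F) (fun i => j (t i)) = j.toRingHom.comp (rho w t) := by
      ext i
      · simp [rho, hmap]
      · simp [rho, hmap]
      · simp [rho]
    rw [this]
    exact (Polynomial.hom_eval₂ P (rho w t) j.toRingHom θ).symm
  obtain ⟨h2, h20, hirr⟩ := irr_open (A := Po n) (K := K) G hG (minpoly.natDegree_pos hθ)
    fun L _ _ _ f g hf hg hfg => no_fac (F := F) hclK (fun i => j (t i)) (j θ) (N := G.natDegree) (by
      intro P hP h0
      rw [hev, map_eq_zero_iff _ hj] at h0
      by_contra hP0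
      have := minpoly.IsIntegrallyClosed.degree_le_of_ne_zero (s := θ) hP0 h0
      rw [Polynomial.degree_eq_natDegree hG.ne_zero] at this
      exact absurd hP (not_lt.mpr this)) G hG rfl (by rw [hev, hGθ, map_zero]) f g hf hg hfg
  obtain ⟨u, hu⟩ := MvPolynomial.ne_zero_iff.mp hq0
  refine ⟨h1 * h2 * q.coeff u, mul_ne_zero (mul_ne_zero h10 h20) hu, fun z hz => ?_⟩
  rw [map_mul, map_mul] at hz
  have hz1 := left_ne_zero_of_mul (left_ne_zero_of_mul hz)
  have hz2 := right_ne_zero_of_mul (left_ne_zero_of_mul hz)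
  refine fib_irr w t θ h1 G hρ hint hGθ q (fun s => ?_) z hz1 (hirr (eval z) hz2) ?_
  · obtain ⟨N, P, hP⟩ := hq s
    exact ⟨N, P, hP⟩
  · intro h
    apply right_ne_zero_of_mul hz
    have := congrArg (MvPolynomial.coeff u) h
    rwa [coeff_map, coeff_zero] at this
theorem fib_set {n d c : ℕ} {I : Ideal (Po n)} (hI : Good d I) (hc : c + d = n) (h32 : 2 * n ≤ 3 * d) (h2 : n + 2 ≤ 2 * d) :
    ∃ h : Po n, h ≠ 0 ∧ ∀ z, eval z h ≠ 0 → (∃ x ∈ Zl I, x - z ∈ Zl I) ∧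
      ∀ p q : Po n, (∀ x ∈ Zl I, x - z ∈ Zl I → eval x p * eval x q = 0) →
        (∀ x ∈ Zl I, x - z ∈ Zl I → eval x p = 0) ∨ ∀ x ∈ Zl I, x - z ∈ Zl I → eval x q = 0 := by
  classical
  have hIp := hI.prime
  obtain ⟨D, hD⟩ := exists_trdeg_nat (k := ℂ) (S := Po n ⧸ I)
  obtain ⟨F, _, _, a, b, hG, hJ⟩ := exists_Gen hI.hom hD
  have hdom := dominance hI hc hD h32 h2 hG
  have hcl := alg_closed hI hc hD h32 h2 hG
  let S := adjoin ℂ (range (Sum.elim a b))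
  have _ : FiniteType ℂ S := (Subalgebra.fg_iff_finiteType S).mp (Subalgebra.fg_def.mpr ⟨_, Set.finite_range _, rfl⟩)
  let g : Fin n ⊕ Fin n → S := fun i => ⟨Sum.elim a b i, subset_adjoin ⟨i, rfl⟩⟩
  obtain ⟨h, h0, hh⟩ := fibE S.val Subtype.val_injective (fun i => g (Sum.inr i) - g (Sum.inl i)) hdom hcl
  let π : P2 n →ₐ[ℂ] S := aeval g
  have hπ : ∀ f, (π f : F) = aeval (Sum.elim a b) f := by
    intro f
    show S.val (aeval g f) = _
    rw [← AlgHom.comp_apply, MvPolynomial.comp_aeval]; rfl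
  have hπs : Function.Surjective π := by
    rintro ⟨s, hs⟩
    obtain ⟨f, hf⟩ := (by rw [← Algebra.adjoin_range_eq_range_aeval]; exact hs : s ∈ (aeval (Sum.elim a b) : P2 n →ₐ[ℂ] F).range)
    exact ⟨f, Subtype.ext ((hπ f).trans hf)⟩
  have hπ0 : ∀ f, π f = 0 ↔ f ∈ J2 I := fun f => by
    rw [← hJ, ← hπ, ZeroMemClass.coe_eq_zero]
  refine ⟨h, h0, fun z hz => ?_⟩
  have hP := hh z hz
  let T := Ideal.span (range fun i => g (Sum.inr i) - g (Sum.inl i) - algebraMap ℂ S (z i))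
  let P : Ideal (P2 n) := T.radical.comap π
  have hPp : P.IsPrime := Ideal.comap_isPrime _ _
  have hJP : ∀ f ∈ J2 I, f ∈ P := fun f hf => by
    show π f ∈ T.radical
    rw [(hπ0 f).mpr hf]; exact zero_mem _
  have hren : ∀ (k : Fin n → Fin n ⊕ Fin n) (u : Fin n ⊕ Fin n → ℂ) (f : Po n), eval u (rename k f) = eval (fun i => u (k i)) f :=
    fun k u f => by rw [eval_rename]; rfl
  let l : Fin n → P2 n := fun i => X (Sum.inr i) - X (Sum.inl i) - C (z i)
  have hπl : ∀ i, π (l i) = g (Sum.inr i) - g (Sum.inl i) - algebraMap ℂ S (z i) := by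
    intro i; simp [π, l]
  have hZ1 : ∀ u ∈ Zl P, (fun i => u (Sum.inr i)) ∈ Zl I ∧ (fun i => u (Sum.inr i)) - z ∈ Zl I := by
    intro u hu
    have e1 : (fun i => u (Sum.inr i)) - z = fun i => u (Sum.inl i) := by
      funext i
      have := hu (l i) (Ideal.le_radical (by rw [hπl]; exact Ideal.subset_span ⟨i, rfl⟩))
      simp only [l, map_sub, eval_X, eval_C] at this
      simp only [Pi.sub_apply]; linear_combination this
    rw [e1]
    refine ⟨fun f hf => ?_, fun f hf => ?_⟩
    · rw [← hren]; apply hu; apply hJP; intro x hx y hy; rw [hren]; exact hy f hf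
    · rw [← hren]; apply hu; apply hJP; intro x hx y hy; rw [hren]; exact hx f hf
  have hZ2 : ∀ y ∈ Zl I, y - z ∈ Zl I → Sum.elim (y - z) y ∈ Zl P := by
    intro y hy hyz f hf
    obtain ⟨k, hk⟩ := (hf : π f ∈ T.radical)
    have hT : T = (Ideal.span (range l)).map π := by
      rw [Ideal.map_span, ← Set.range_comp]
      rw [show (π ∘ l) = _ from funext hπl]
    rw [hT, ← map_pow, Ideal.mem_map_iff_of_surjective _ hπs] at hk
    obtain ⟨q, hq, hqf⟩ := hk
    have hq0 : eval (Sum.elim (y - z) y) q = 0 := by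
      have : Ideal.span (range l) ≤ RingHom.ker (eval (Sum.elim (y - z) y)) := by
        rw [Ideal.span_le]; rintro _ ⟨i, rfl⟩
        simp [l, RingHom.mem_ker]
      exact this hq
    have h3 := (hπ0 (q - f ^ k)).mp (by rw [map_sub, hqf, sub_self]) _ hyz _ hy
    rw [map_sub, hq0, zero_sub, neg_eq_zero, map_pow] at h3
    exact eq_zero_of_pow_eq_zero h3
  constructor
  · by_contra! hne
    exact hPp.ne_top ((Ideal.eq_top_iff_one _).mpr (mem_of_Zl fun u hu => absurd (hZ1 u hu).2 (hne _ (hZ1 u hu).1)))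
  · intro p q hpq
    have := hPp.mem_or_mem (x := rename Sum.inr p) (y := rename Sum.inr q) (mem_of_Zl fun u hu => by
      rw [map_mul, hren, hren]; exact hpq _ (hZ1 u hu).1 (hZ1 u hu).2)
    refine this.imp (fun h x hx hxz => ?_) (fun h x hx hxz => ?_)
    all_goals
      have := hZ2 x hx hxz _ h
      rwa [hren] at this
lemma comp_vanish {n : ℕ} (v : Fin n → ℂ) (f : Po n) (h : ∀ c : ℂ, c ≠ 0 → eval (c • v) f = 0) (k : ℕ) :
    eval v (homogeneousComponent k f) = 0 := by
  let g : Polynomial ℂ := ∑ k ∈ Finset.range (f.totalDegree + 1), Polynomial.C (eval v (homogeneousComponent k f)) * Polynomial.X ^ k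
  have hg : ∀ c, g.eval c = eval (c • v) f := by
    intro c
    conv_rhs => rw [← sum_homogeneousComponent f]
    rw [map_sum, Polynomial.eval_finsetSum]
    refine Finset.sum_congr rfl fun k _ => ?_
    have := aeval_scale (homogeneousComponent_isHomogeneous k f) c v
    rw [aeval_eq_eval, aeval_eq_eval] at this
    simp only [Polynomial.eval_mul, Polynomial.eval_C, Polynomial.eval_pow, Polynomial.eval_X]
    rw [mul_comm]; exact this.symm
  have h0 : Polynomial.X * g = 0 := Polynomial.funext fun c => by
    rw [Polynomial.eval_mul, Polynomial.eval_X, hg, Polynomial.eval_zero]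
    by_cases hc : c = 0
    · rw [hc, zero_mul]
    · rw [h c hc, mul_zero]
  have h1 : g = 0 := (mul_eq_zero.mp h0).resolve_left Polynomial.X_ne_zero
  by_cases hk : k < f.totalDegree + 1
  · have := congrArg (fun p => Polynomial.coeff p k) h1
    simpa [g, Polynomial.coeff_C_mul, Polynomial.coeff_X_pow, Finset.sum_ite_eq, hk] using this
  · rw [homogeneousComponent_eq_zero _ _ (by omega), map_zero]
def Cn {n : ℕ} (Y : Set (PrV n)) : Set (Fin n → ℂ) := {v | ∃ hv : v ≠ 0, Projectivization.mk ℂ v hv ∈ Y}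
lemma Cn_rep {n : ℕ} {Y : Set (PrV n)} {y : PrV n} : y.rep ∈ Cn Y ↔ y ∈ Y := by
  simp [Cn, Projectivization.mk_rep, Projectivization.rep_nonzero]
lemma mk_smul {n : ℕ} {v : Fin n → ℂ} (hv : v ≠ 0) {c : ℂ} (hc : c ≠ 0) :
    Projectivization.mk ℂ (c • v) (smul_ne_zero hc hv) = Projectivization.mk ℂ v hv :=
  (Projectivization.mk_eq_mk_iff' ℂ _ _ _ _).mpr ⟨c, rfl⟩
lemma Cn_smul {n : ℕ} {Y : Set (PrV n)} {v : Fin n → ℂ} (h : v ∈ Cn Y) {c : ℂ} (hc : c ≠ 0) : c • v ∈ Cn Y := by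
  obtain ⟨hv, h⟩ := h
  exact ⟨smul_ne_zero hc hv, by rwa [mk_smul hv hc]⟩
lemma exists_rep {n : ℕ} {v : Fin n → ℂ} (hv : v ≠ 0) : ∃ c : ℂ, c ≠ 0 ∧ (Projectivization.mk ℂ v hv).rep = c • v := by
  obtain ⟨a, ha⟩ := Projectivization.exists_smul_eq_mk_rep ℂ v hv
  exact ⟨a, a.ne_zero, ha.symm⟩
lemma mem_idealOf {n : ℕ} {Y : Set (PrV n)} {f : Po n} : f ∈ idealOf Y ↔ ∀ v ∈ Cn Y, eval v f = 0 := by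
  constructor
  · rintro h v ⟨hv, hY⟩
    exact h hY v hv rfl
  · rintro h x hx v hv rfl
    exact h v ⟨hv, hx⟩
lemma idealOf_hmg {n : ℕ} (Y : Set (PrV n)) : Hmg (idealOf Y) := by
  intro f hf k
  rw [mem_idealOf] at *
  exact fun v hv => comp_vanish v f (fun c hc => hf _ (Cn_smul hv hc)) k
lemma eval_smul_ne {n k : ℕ} {f : Po n} (hf : f.IsHomogeneous k) {v : Fin n → ℂ} {c : ℂ} (hc : c ≠ 0) :
    eval (c • v) f = 0 ↔ eval v f = 0 := by
  have := aeval_scale hf c v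
  rw [aeval_eq_eval, aeval_eq_eval] at this
  rw [show c • v = fun i => c * v i from rfl, this]
  simp [hc]
lemma mem_pZero {n k : ℕ} {f : Po n} (hf : f.IsHomogeneous k) {x : PrV n} : x ∈ pZero f ↔ eval x.rep f = 0 := by
  constructor
  · intro h; exact h _ x.rep_nonzero x.mk_rep
  · rintro h v hv rfl
    obtain ⟨c, hc, he⟩ := exists_rep hv
    rwa [he, eval_smul_ne hf hc] at h
lemma open_pZero {n : ℕ} (f : Po n) : IsOpen (pZero f)ᶜ := TopologicalSpace.isOpen_generateFrom_of_mem ⟨f, rfl⟩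
lemma open_basis {n : ℕ} {U : Set (PrV n)} (hU : IsOpen U) : ∀ x ∈ U, ∃ (k : ℕ) (f : Po n), f.IsHomogeneous k ∧ eval x.rep f ≠ 0 ∧
    ∀ y : PrV n, eval y.rep f ≠ 0 → y ∈ U := by
  induction hU with
  | basic s hs =>
    obtain ⟨f, rfl⟩ := hs
    intro x hx
    have : ∃ k, eval x.rep (homogeneousComponent k f) ≠ 0 := by
      by_contra! h
      refine hx fun v hv he => ?_
      subst he
      obtain ⟨c, hc, he⟩ := exists_rep hv
      rw [← sum_homogeneousComponent f, map_sum]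
      refine Finset.sum_eq_zero fun k _ => ?_
      rw [← eval_smul_ne (homogeneousComponent_isHomogeneous k f) hc, ← he, h]
    obtain ⟨k, hk⟩ := this
    refine ⟨k, _, homogeneousComponent_isHomogeneous k f, hk, fun y hy h => hy ?_⟩
    exact comp_vanish _ _ (fun c hc => h _ (smul_ne_zero hc y.rep_nonzero) (by rw [mk_smul y.rep_nonzero hc, y.mk_rep])) k
  | univ => exact fun x _ => ⟨0, 1, isHomogeneous_one _ _, by simp, fun _ _ => trivial⟩
  | inter s t _ _ h1 h2 =>
    rintro x ⟨hs, ht⟩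
    obtain ⟨k, f, hf, hx, hf'⟩ := h1 x hs
    obtain ⟨l, g, hg, hx', hg'⟩ := h2 x ht
    refine ⟨_, _, hf.mul hg, by rw [map_mul]; exact mul_ne_zero hx hx', fun y hy => ?_⟩
    rw [map_mul] at hy
    exact ⟨hf' y (left_ne_zero_of_mul hy), hg' y (right_ne_zero_of_mul hy)⟩
  | sUnion S _ h =>
    rintro x ⟨s, hs, hx⟩
    obtain ⟨k, f, hf, hx, hf'⟩ := h s hs x hx
    exact ⟨k, f, hf, hx, fun y hy => ⟨s, hs, hf' y hy⟩⟩
lemma Cn_eq {n : ℕ} {Y : Set (PrV n)} (hY : IsClosed Y) {v : Fin n → ℂ} (hv : v ≠ 0) : v ∈ Cn Y ↔ v ∈ Zl (idealOf Y) := by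
  constructor
  · exact fun h f hf => mem_idealOf.mp hf v h
  · intro h
    refine ⟨hv, ?_⟩
    by_contra hn
    obtain ⟨k, f, hf, h1, h2⟩ := open_basis hY.isOpen_compl _ hn
    obtain ⟨c, hc, he⟩ := exists_rep hv
    rw [he, Ne, eval_smul_ne hf hc] at h1
    refine h1 (h f (fun y hy => (mem_pZero hf).mpr ?_))
    by_contra h3
    exact h2 y h3 hy
lemma idealOf_prime {n : ℕ} {Y : Set (PrV n)} (hY : IsIrreducible Y) : (idealOf Y).IsPrime := by
  constructor
  · obtain ⟨y, hy⟩ := hY.1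
    rw [Ne, Ideal.eq_top_iff_one, mem_idealOf]
    intro h
    simpa using h _ (Cn_rep.mpr hy)
  · intro f g hfg
    by_contra! hn
    obtain ⟨y1, h1, h1'⟩ := Set.not_subset.mp hn.1
    obtain ⟨y2, h2, h2'⟩ := Set.not_subset.mp hn.2
    obtain ⟨y, hy, hyf, hyg⟩ := hY.2 _ _ (open_pZero f) (open_pZero g) ⟨y1, h1, h1'⟩ ⟨y2, h2, h2'⟩
    let sc : Po n →ₐ[ℂ] Polynomial ℂ := aeval (fun i => Polynomial.X * Polynomial.C (y.rep i))
    have hsc : ∀ (c : ℂ) (f : Po n), (sc f).eval c = eval (c • y.rep) f := by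
      intro c f
      have := aeval_hom (Polynomial.aeval c) (fun i => Polynomial.X * Polynomial.C (y.rep i)) f
      rw [← Polynomial.coe_aeval_eq_eval, ← aeval_eq_eval]
      refine this.symm.trans ?_
      simp [aeval_eq_eval, Pi.smul_def, mul_comm c]
    have hne : ∀ f : Po n, y ∈ (pZero f)ᶜ → sc f ≠ 0 := by
      intro f hf h0
      refine hf fun v hv he => ?_
      subst he
      obtain ⟨c, hc, he⟩ := exists_rep hv
      have := hsc c⁻¹ f
      rw [he, smul_smul, inv_mul_cancel₀ hc, one_smul, h0, Polynomial.eval_zero] at this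
      exact this.symm
    have : Polynomial.X * sc (f * g) = 0 := Polynomial.funext fun c => by
      rw [Polynomial.eval_mul, hsc, Polynomial.eval_X, Polynomial.eval_zero]
      by_cases hc : c = 0
      · rw [hc, zero_mul]
      · rw [mem_idealOf.mp hfg _ (Cn_smul (Cn_rep.mpr hy) hc), mul_zero]
    rw [map_mul] at this
    exact mul_ne_zero Polynomial.X_ne_zero (mul_ne_zero (hne f hyf) (hne g hyg)) this
lemma irr_of {n : ℕ} {T : Set (PrV n)} (hT : T.Nonempty) (h : ∀ (k l : ℕ) (f g : Po n), f.IsHomogeneous k → g.IsHomogeneous l → (∀ y ∈ T, eval y.rep f * eval y.rep g = 0) →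
    (∀ y ∈ T, eval y.rep f = 0) ∨ ∀ y ∈ T, eval y.rep g = 0) : IsIrreducible T := by
  refine ⟨hT, fun u v hu hv => ?_⟩
  rintro ⟨x, hx, hxu⟩ ⟨y, hy, hyv⟩
  obtain ⟨k, f, hf, h1, h1'⟩ := open_basis hu x hxu
  obtain ⟨l, g, hg, h2, h2'⟩ := open_basis hv y hyv
  by_contra hn
  rcases h k l f g hf hg (fun w hw => by
    by_contra h3
    exact hn ⟨w, hw, h1' w (left_ne_zero_of_mul h3), h2' w (right_ne_zero_of_mul h3)⟩) with h3 | h3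
  · exact h1 (h3 x hx)
  · exact h2 (h3 y hy)
lemma trdeg_lt' {n : ℕ} {p q : Ideal (Po n)} [p.IsPrime] [q.IsPrime] (h : p < q) : trdeg ℂ (Po n ⧸ q) + 1 ≤ trdeg ℂ (Po n ⧸ p) := by
  let π := Ideal.Quotient.mk p
  have hs : Function.Surjective π := Ideal.Quotient.mk_surjective
  have hk : RingHom.ker π ≤ q := by rw [Ideal.mk_ker]; exact h.le
  have hp : (q.map π).IsPrime := Ideal.map_isPrime_of_surjective hs hk
  have h1 := trdeg_quot_lt (k := ℂ) (q.map π) (by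
    intro h0
    rw [Ideal.map_eq_bot_iff_le_ker, Ideal.mk_ker] at h0
    exact absurd h0 (not_le_of_gt h))
  rwa [(DoubleQuot.quotQuotEquivQuotOfLEₐ ℂ h.le).trdeg_eq] at h1
lemma idealOf_lt {n : ℕ} {Z W : Set (PrV n)} (hZ : IsClosed Z) (h : Z ⊂ W) : idealOf W < idealOf Z := by
  refine lt_of_le_of_ne (fun f hf y hy => hf (h.1 hy)) fun he => h.2 fun w hw => ?_
  have h1 : w.rep ∈ Zl (idealOf W) := fun f hf => mem_idealOf.mp hf _ (Cn_rep.mpr hw)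
  rw [he, ← Cn_eq hZ w.rep_nonzero] at h1
  exact Cn_rep.mp h1
lemma dim_le {n m : ℕ} {Y : Set (PrV n)} (hcl : IsClosed Y) (hdim : pdim Y = ((m : ℕ∞) : WithBot ℕ∞)) (hirr : IsIrreducible Y) :
    ((m + 1 : ℕ) : Cardinal) ≤ trdeg ℂ (Po n ⧸ idealOf Y) := by
  have hex : ∃ l : LTSeries (TopologicalSpace.IrreducibleCloseds Y), l.length = m :=
    Order.le_krullDim_iff.mp (le_of_eq hdim.symm)
  obtain ⟨l, rfl⟩ := hex
  let Z : Fin (l.length + 1) → Set (PrV n) := fun i => Subtype.val '' (l i : Set Y)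
  have hZc : ∀ i, IsClosed (Z i) := fun i => (hcl.isClosedEmbedding_subtypeVal).isClosedMap _ (l i).isClosed'
  have hZi : ∀ i, IsIrreducible (Z i) := fun i => (l i).isIrreducible'.image _ continuous_subtype_val.continuousOn
  have key : ∀ k (hk : k < l.length + 1), ((k + 1 : ℕ) : Cardinal) ≤ trdeg ℂ (Po n ⧸ idealOf (Z ⟨k, hk⟩)) := by
    intro k
    induction k with
    | zero =>
      intro hk
      have := idealOf_prime (hZi ⟨0, hk⟩)
      let M : Ideal (Po n) := RingHom.ker (eval (0 : Fin n → ℂ))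
      have hM : M.IsPrime := RingHom.ker_isPrime _
      obtain ⟨y, hy⟩ := (hZi ⟨0, hk⟩).1
      have hlt : idealOf (Z ⟨0, hk⟩) < M := by
        refine lt_of_le_of_ne (fun f hf => ?_) fun he => y.rep_nonzero ?_
        · have h1 := mem_idealOf.mp (idealOf_hmg _ f hf 0) _ (Cn_rep.mpr hy)
          rw [homogeneousComponent_zero, eval_C] at h1
          show eval 0 f = 0
          simpa [constantCoeff_eq] using h1
        · funext i
          have : X i ∈ idealOf (Z ⟨0, hk⟩) := by rw [he]; simp [M, RingHom.mem_ker]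
          simpa using mem_idealOf.mp this _ (Cn_rep.mpr hy)
      have := trdeg_lt' hlt
      refine le_trans ?_ this
      push_cast; simp
    | succ k ih =>
      intro hk
      have _ := idealOf_prime (hZi ⟨k + 1, hk⟩)
      have _ := idealOf_prime (hZi ⟨k, by omega⟩)
      have hlt : Z ⟨k, by omega⟩ ⊂ Z ⟨k + 1, hk⟩ := by
        have h1 : l ⟨k, by omega⟩ < l ⟨k + 1, hk⟩ := l.strictMono (by simp [Fin.lt_def])
        exact (Subtype.val_injective.image_strictMono) h1
      have h2 := trdeg_lt' (idealOf_lt (hZc _) hlt)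
      refine le_trans ?_ h2
      have := ih (by omega)
      push_cast at this ⊢
      gcongr
  have h1 := key l.length (by omega)
  have _ := idealOf_prime hirr
  refine h1.trans (trdeg_quot_mono fun f hf y hy => ?_)
  obtain ⟨y', _, rfl⟩ := hy
  exact hf y'.2
lemma Tan_smul {n : ℕ} {Y : Set (PrV n)} {c : ℂ} (hc : c ≠ 0) (a : Fin n → ℂ) : Tan (idealOf Y) (c • a) ≤ Tan (idealOf Y) a := by
  intro v hv f hf
  have h1 : aeval (fun i => C c⁻¹ * X i) f ∈ idealOf Y := mem_idealOf.mpr fun u hu => by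
    rw [eval_aev]
    simpa [Pi.smul_def] using mem_idealOf.mp hf _ (Cn_smul hu (inv_ne_zero hc))
  have h2 := hv _ h1
  rw [chain_rule, map_sum] at h2
  have h3 : ∀ i, eval (c • a) (aeval (fun i => C c⁻¹ * X i) (pderiv i f) • dv v (C c⁻¹ * X i)) = c⁻¹ * (eval a (pderiv i f) * v i) := by
    intro i
    rw [smul_eq_mul, map_mul, eval_aev, Derivation.leibniz]
    have : (fun i => eval (c • a) (C c⁻¹ * X i)) = a := by
      funext j; simp [hc]
    rw [this]
    have e1 : dv v (C c⁻¹) = 0 := (dv v).map_algebraMap _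
    have e2 : dv v (X i) = C (v i) := by simp [dv]
    rw [e1, e2]; simp; ring
  rw [Finset.sum_congr rfl fun i _ => h3 i, ← Finset.mul_sum] at h2
  rw [eval_dv]
  exact (mul_eq_zero.mp h2).resolve_left (inv_ne_zero hc)
lemma affTangent_eq {n : ℕ} (Y : Set (PrV n)) (v : Fin n → ℂ) : affTangent Y v = Tan (idealOf Y) v := by
  ext w
  simp only [affTangent, Submodule.mem_iInf, LinearMap.mem_ker]
  refine forall₂_congr fun f _ => ?_
  rw [eval_dv]
  simp [jacLin]
theorem good_of {r m : ℕ} {Y : Set (Pr r)} (hcl : IsClosed Y) (hirr : IsIrreducible Y) (hsm : IsSmoothSet Y)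
    (hnd : NondegenerateSet Y) (hdim : pdim Y = ((m : ℕ∞) : WithBot ℕ∞)) : Good (m + 1) (idealOf Y) where
  prime := idealOf_prime hirr
  hom := idealOf_hmg Y
  smooth := by
    intro a ha ha0
    obtain ⟨_, hY⟩ := (Cn_eq hcl ha0).mpr ha
    have h1 := hsm _ hY
    obtain ⟨c, hc, he⟩ := exists_rep ha0
    rw [IsSmoothPt, hdim, affTangent_eq, he] at h1
    have h2 : Tan (idealOf Y) (c • a) = Tan (idealOf Y) a := by
      refine le_antisymm (Tan_smul hc a) ?_
      have := Tan_smul (Y := Y) (inv_ne_zero hc) (c • a)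
      rwa [smul_smul, inv_mul_cancel₀ hc, one_smul] at this
    rw [h2] at h1
    exact_mod_cast h1
  nondeg := by
    intro s hs
    by_contra h0
    refine hnd {x | (∑ i, s i • LinearMap.proj (R := ℂ) (φ := fun _ => ℂ) i) x.rep = 0} ⟨_, ?_, rfl⟩ fun y hy => ?_
    · intro h
      refine h0 (funext fun i => ?_)
      have := congrArg (fun φ => φ (Pi.single i 1)) h
      simpa [Pi.single_apply] using this
    · have := mem_idealOf.mp hs _ (Cn_rep.mpr hy)
      rw [eval_lin] at this
      simpa using this
  dim := dim_le hcl hdim hirr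
lemma dense_pZero {r : ℕ} {h : Po (r + 1)} (h0 : h ≠ 0) : Dense (pZero h : Set (Pr r))ᶜ := by
  rw [dense_iff_inter_open]
  rintro V hV ⟨x, hx⟩
  obtain ⟨k, f, hf, h1, h2⟩ := open_basis hV x hx
  have hne : X 0 * (f * h) ≠ 0 := mul_ne_zero (X_ne_zero _) (mul_ne_zero (fun h => h1 (by rw [h, map_zero])) h0)
  obtain ⟨v, hv⟩ : ∃ v, eval v (X 0 * (f * h)) ≠ 0 := by
    by_contra! hn
    exact hne (MvPolynomial.funext fun v => by rw [hn, map_zero])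
  rw [map_mul, map_mul, eval_X] at hv
  have hv0 : v ≠ 0 := fun h => left_ne_zero_of_mul hv (by rw [h]; rfl)
  refine ⟨Projectivization.mk ℂ v hv0, h2 _ ?_, fun hn => right_ne_zero_of_mul (right_ne_zero_of_mul hv) (hn v hv0 rfl)⟩
  obtain ⟨c, hc, he⟩ := exists_rep hv0
  rw [he, Ne, eval_smul_ne hf hc]
  exact left_ne_zero_of_mul (right_ne_zero_of_mul hv)
def Tz {n : ℕ} (W : Set (Fin n → ℂ)) (z : Fin n → ℂ) : Set (PrV n) := {w | ∃ b ∈ W, ∃ s t : ℂ, w.rep = s • b + t • z}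
lemma Tz_irr {n : ℕ} {W : Set (Fin n → ℂ)} {z : Fin n → ℂ} (hz : z ≠ 0) (hW : W.Nonempty)
    (h : ∀ p q : Po n, (∀ b ∈ W, eval b p * eval b q = 0) → (∀ b ∈ W, eval b p = 0) ∨ ∀ b ∈ W, eval b q = 0) :
    IsIrreducible (Tz W z) := by
  have hzT : Projectivization.mk ℂ z hz ∈ Tz W z := by
    obtain ⟨b, hb⟩ := hW
    obtain ⟨c, hc, he⟩ := exists_rep hz
    exact ⟨b, hb, 0, c, by rw [he]; simp⟩
  refine irr_of ⟨_, hzT⟩ fun k l f g hf hg hfg => ?_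
  have hall : ∀ b ∈ W, ∀ s t : ℂ, eval (s • b + t • z) f * eval (s • b + t • z) g = 0 := by
    intro b hb s t
    rw [← map_mul]
    by_cases hu : s • b + t • z = 0
    · have h1 := hfg _ hzT
      have h2 := aeval_scale (hf.mul hg) 0 (Projectivization.mk ℂ z hz).rep
      rw [aeval_eq_eval, aeval_eq_eval] at h2
      rw [map_mul (eval (Projectivization.mk ℂ z hz).rep), h1, mul_zero] at h2
      rw [hu, ← h2]
      congr 2; funext i; simp
    · obtain ⟨c, hc, he⟩ := exists_rep hu
      rw [← eval_smul_ne (hf.mul hg) hc, ← he, map_mul]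
      exact hfg _ ⟨b, hb, c * s, c * t, by rw [he, smul_add, smul_smul, smul_smul]⟩
  by_contra! hn
  obtain ⟨⟨w1, ⟨b1, hb1, s1, t1, e1⟩, h1⟩, ⟨w2, ⟨b2, hb2, s2, t2, e2⟩, h2⟩⟩ := hn
  let e : (Fin n → ℂ) → Po n → Po 2 := fun b => aeval (fun i => X 0 * C (b i) + X 1 * C (z i))
  have he : ∀ b f (u : Fin 2 → ℂ), eval u (e b f) = eval (u 0 • b + u 1 • z) f := by
    intro b f u
    simp only [e]; rw [eval_aev]; congr 2; funext i; simp
  have hne : e b1 f * e b2 g ≠ 0 := mul_ne_zero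
    (fun h => h1 (by rw [e1, show eval (s1 • b1 + t1 • z) f = eval ![s1, t1] (e b1 f) by rw [he]; rfl, h, map_zero]))
    (fun h => h2 (by rw [e2, show eval (s2 • b2 + t2 • z) g = eval ![s2, t2] (e b2 g) by rw [he]; rfl, h, map_zero]))
  obtain ⟨u, hu⟩ : ∃ u, eval u (e b1 f * e b2 g) ≠ 0 := by
    by_contra! hn
    exact hne (MvPolynomial.funext fun v => by rw [hn, map_zero])
  rw [map_mul, he, he] at hu
  let p : Po n → Po n := fun f => aeval (fun i => C (u 0) * X i + C (u 1 * z i)) f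
  have hp : ∀ f b, eval b (p f) = eval (u 0 • b + u 1 • z) f := by
    intro f b
    simp only [p]; rw [eval_aev]; congr 2; funext i; simp
  rcases h (p f) (p g) (fun b hb => by rw [hp, hp]; exact hall b hb _ _) with h3 | h3
  · exact left_ne_zero_of_mul hu (by rw [← hp]; exact h3 b1 hb1)
  · exact right_ne_zero_of_mul hu (by rw [← hp]; exact h3 b2 hb2)
def secU {r : ℕ} (Y : Set (Pr r)) (z : Pr r) : Set (Pr r) := ⋃ x ∈ Y, ⋃ y ∈ Y, ⋃ _ : x ≠ y, ⋃ _ : z ∈ lineThrough x y, lineThrough x y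
lemma Zl_smul {n : ℕ} {Y : Set (PrV n)} (hY : IsClosed Y) {v : Fin n → ℂ} (h : v ∈ Zl (idealOf Y)) {c : ℂ} (hc : c ≠ 0) :
    c • v ∈ Zl (idealOf Y) := by
  by_cases hv : v = 0
  · rw [hv] at h ⊢; rwa [smul_zero]
  · rw [← Cn_eq hY hv] at h
    rw [← Cn_eq hY (smul_ne_zero hc hv)]
    exact Cn_smul h hc
lemma rep_of_mk {n : ℕ} {v : Fin n → ℂ} (hv : v ≠ 0) : ∃ c : ℂ, c ≠ 0 ∧ v = c • (Projectivization.mk ℂ v hv).rep := by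
  obtain ⟨c, hc, he⟩ := exists_rep hv
  exact ⟨c⁻¹, inv_ne_zero hc, by rw [he, smul_smul, inv_mul_cancel₀ hc, one_smul]⟩
lemma secU_eq {r : ℕ} {Y : Set (Pr r)} (hY : IsClosed Y) {z : Fin (r + 1) → ℂ} (hz : z ≠ 0) (hzY : z ∉ Zl (idealOf Y)) :
    secU Y (Projectivization.mk ℂ z hz) = Tz {b | b ∈ Zl (idealOf Y) ∧ b - z ∈ Zl (idealOf Y)} z := by
  obtain ⟨c, hc, hzc⟩ := rep_of_mk hz
  ext w
  simp only [secU, mem_iUnion, exists_prop]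
  constructor
  · rintro ⟨x, hx, y, hy, hxy, hzl, hw⟩
    obtain ⟨α, β, h1⟩ := Submodule.mem_span_pair.mp hzl
    obtain ⟨α', β', h2⟩ := Submodule.mem_span_pair.mp hw
    have hxZ : x.rep ∈ Zl (idealOf Y) := (Cn_eq hY x.rep_nonzero).mp (Cn_rep.mpr hx)
    have hyZ : y.rep ∈ Zl (idealOf Y) := (Cn_eq hY y.rep_nonzero).mp (Cn_rep.mpr hy)
    have hz1 : z = (c * α) • x.rep + (c * β) • y.rep := by rw [mul_smul, mul_smul, ← smul_add, h1]; exact hzc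
    have hα : α ≠ 0 := by
      rintro rfl
      rw [mul_zero, zero_smul, zero_add] at hz1
      apply hzY; rw [hz1]; refine Zl_smul hY hyZ fun h => hz ?_
      rw [hz1, h, zero_smul]
    have hβ : β ≠ 0 := by
      rintro rfl
      rw [mul_zero, zero_smul, add_zero] at hz1
      apply hzY; rw [hz1]; refine Zl_smul hY hxZ fun h => hz ?_
      rw [hz1, h, zero_smul]
    refine ⟨(c * β) • y.rep, ⟨Zl_smul hY hyZ (mul_ne_zero hc hβ), ?_⟩, β' / (c * β) - α' / (c * α), α' / (c * α), ?_⟩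
    · rw [hz1, sub_add_cancel_right, ← neg_smul]
      exact Zl_smul hY hxZ (neg_ne_zero.mpr (mul_ne_zero hc hα))
    · rw [← h2, hz1]
      funext i
      simp only [Pi.add_apply, Pi.smul_apply, smul_eq_mul]
      field_simp; ring
  · rintro ⟨b, ⟨hb, hbz⟩, s, t, hw⟩
    have hb0 : b ≠ 0 := by
      rintro rfl
      apply hzY
      have := Zl_smul hY hbz (neg_ne_zero.mpr one_ne_zero : (-1 : ℂ) ≠ 0)
      simpa using this
    have hbz0 : b - z ≠ 0 := fun h => hzY (by rwa [sub_eq_zero.mp h] at hb)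
    obtain ⟨c1, hc1, e1⟩ := rep_of_mk hb0
    obtain ⟨c2, hc2, e2⟩ := rep_of_mk hbz0
    have e3 : z = (-c2) • (Projectivization.mk ℂ (b - z) hbz0).rep + c1 • (Projectivization.mk ℂ b hb0).rep := by
      rw [neg_smul, ← e2, ← e1]; abel
    refine ⟨_, ((Cn_eq hY hbz0).mpr hbz).2, _, ((Cn_eq hY hb0).mpr hb).2, ?_, ?_, ?_⟩
    · intro h
      obtain ⟨a, ha⟩ := (Projectivization.mk_eq_mk_iff' ℂ _ _ _ _).mp h
      have hza : z = (1 - a) • b := by rw [sub_smul, one_smul, ha]; abel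
      apply hzY; rw [hza]; refine Zl_smul hY hb fun h => hz ?_
      rw [hza, h, zero_smul]
    · refine Submodule.mem_span_pair.mpr ⟨c⁻¹ * (-c2), c⁻¹ * c1, ?_⟩
      rw [mul_smul, mul_smul, ← smul_add, ← e3]
      rw [inv_smul_eq_iff₀ hc]; exact hzc
    · refine Submodule.mem_span_pair.mpr ⟨t * (-c2), s * c1 + t * c1, ?_⟩
      rw [hw]
      rw [add_smul, mul_smul, mul_smul, mul_smul, add_left_comm, ← smul_add, ← e3, ← e1]
lemma finish {r : ℕ} {Y : Set (Pr r)} (U : Set (Pr r)) (hU : IsOpen U) (hd : Dense U) (h : ∀ z ∈ U, z ∈ secU Y z ∧ IsIrreducible (secU Y z)) :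
    secantVariety Y = Set.univ ∧ ISC Y := by
  refine ⟨(hd.mono fun z hz => ?_).closure_eq, U, hU, hd, fun z hz => (h z hz).2.closure⟩
  have := (h z hz).1
  simp only [secU, mem_iUnion, exists_prop] at this ⊢
  obtain ⟨x, hx, y, hy, hxy, hz, -⟩ := this
  exact ⟨x, hx, y, hy, hxy, hz⟩
lemma finish' {r : ℕ} {Y : Set (Pr r)} (hY : IsClosed Y) (h : Po (r + 1)) (h0 : h ≠ 0)
    (hh : ∀ z, eval z h ≠ 0 → z ∉ Zl (idealOf Y) ∧ ∃ W : Set (Fin (r + 1) → ℂ), W.Nonempty ∧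
      Tz W z = Tz {b | b ∈ Zl (idealOf Y) ∧ b - z ∈ Zl (idealOf Y)} z ∧
      ∀ p q : Po (r + 1), (∀ b ∈ W, eval b p * eval b q = 0) → (∀ b ∈ W, eval b p = 0) ∨ ∀ b ∈ W, eval b q = 0) :
    secantVariety Y = Set.univ ∧ ISC Y := by
  refine finish _ (open_pZero h) (dense_pZero h0) fun z hz => ?_
  obtain ⟨v, hv, rfl, hvh⟩ : ∃ (v : Fin (r + 1) → ℂ) (hv : v ≠ 0), Projectivization.mk ℂ v hv = z ∧ eval v h ≠ 0 := by
    by_contra! hn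
    exact hz hn
  obtain ⟨h1, W, ⟨b, hb⟩, h2, h3⟩ := hh v hvh
  rw [secU_eq hY hv h1, ← h2]
  obtain ⟨c, hc, he⟩ := exists_rep hv
  exact ⟨⟨b, hb, 0, c, by rw [he]; simp⟩, Tz_irr hv ⟨b, hb⟩ h3⟩
lemma key_root {n D : ℕ} {F : Po n} (hF : F.IsHomogeneous D) (hD : 2 ≤ D) {z b : Fin n → ℂ} (hz : eval z F ≠ 0)
    (hb : eval b F = 0) (hd : eval b (dv z F) ≠ 0) : ∃ ε : ℂ, ε ≠ 0 ∧ eval (b - ε • z) F = 0 := by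
  by_contra! hn
  let y : Fin n → Polynomial ℂ := fun i => Polynomial.C (b i) - Polynomial.X * Polynomial.C (z i)
  let φ : Polynomial ℂ := aeval y F
  have hev : ∀ t : ℂ, φ.eval t = eval (b - t • z) F := by
    intro t
    have := aeval_hom (Polynomial.aeval t) y F
    rw [← Polynomial.coe_aeval_eq_eval]
    refine this.symm.trans ?_
    rw [aeval_eq_eval]
    congr 2
    ext i; simp [y]; ring
  have h0 : φ.eval 0 = 0 := by rw [hev]; simpa using hb
  obtain ⟨ψ, hψ⟩ : Polynomial.X ∣ φ := by rw [Polynomial.X_dvd_iff, Polynomial.coeff_zero_eq_eval_zero]; exact h0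
  have h1 : ψ.eval 0 = - eval b (dv z F) := by
    have e1 : (Polynomial.derivative φ).eval 0 = ψ.eval 0 := by
      rw [hψ, Polynomial.derivative_mul]; simp
    have e2 := chain_rule (Polynomial.derivative' (R := ℂ)) y F
    rw [Polynomial.derivative'_apply] at e2
    change Polynomial.derivative φ = _ at e2
    rw [← e1, e2, eval_dv, Polynomial.eval_finsetSum, ← Finset.sum_neg_distrib]
    refine Finset.sum_congr rfl fun i _ => ?_
    have e3 : Polynomial.eval 0 (aeval y (pderiv i F)) = eval b (pderiv i F) := by
      have := aeval_hom (Polynomial.aeval (0:ℂ)) y (pderiv i F)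
      rw [← Polynomial.coe_aeval_eq_eval]
      refine this.symm.trans ?_
      rw [aeval_eq_eval]
      congr 2
      ext i; simp [y]
    rw [smul_eq_mul, Polynomial.eval_mul, e3]
    simp [y]
  have h2 : ψ.degree = 0 := by
    by_contra h
    obtain ⟨t, ht⟩ := IsAlgClosed.exists_root ψ h
    by_cases ht0 : t = 0
    · rw [ht0, Polynomial.IsRoot, h1] at ht
      exact hd (neg_eq_zero.mp ht)
    · apply hn t ht0
      rw [← hev, hψ, Polynomial.eval_mul, ht.eq_zero, mul_zero]
  obtain ⟨a, ha⟩ : ∃ a, ψ = Polynomial.C a := ⟨_, Polynomial.eq_C_of_degree_eq_zero h2⟩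
  let y2 : Fin n → Polynomial ℂ := fun i => Polynomial.X * Polynomial.C (b i) - Polynomial.C (z i)
  let p : Polynomial ℂ := aeval y2 F
  have hp : ∀ t : ℂ, p.eval t = eval (t • b - z) F := by
    intro t
    have := aeval_hom (Polynomial.aeval t) y2 F
    rw [← Polynomial.coe_aeval_eq_eval]
    refine this.symm.trans ?_
    rw [aeval_eq_eval]
    congr 2
    ext i; simp [y2]; ring
  have h3 : Polynomial.X * (p - Polynomial.C a * Polynomial.X ^ (D - 1)) = 0 := by
    apply Polynomial.funext
    intro s
    by_cases hs : s = 0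
    · simp [hs]
    · have e4 : eval (s • b - z) F = s ^ D * eval (b - s⁻¹ • z) F := by
        have := aeval_scale hF s (b - s⁻¹ • z)
        rw [aeval_eq_eval, aeval_eq_eval] at this
        refine Eq.trans ?_ this
        congr 2
        ext i; simp; field_simp
      have e5 : p.eval s = a * s ^ (D - 1) := by
        rw [hp, e4, ← hev, hψ, ha]
        obtain ⟨k, rfl⟩ : ∃ k, D = k + 1 := ⟨D - 1, by omega⟩
        simp; field_simp; ring
      simp [e5]
  have h4 : p = Polynomial.C a * Polynomial.X ^ (D - 1) := sub_eq_zero.mp ((mul_eq_zero.mp h3).resolve_left Polynomial.X_ne_zero)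
  have h5 := hp 0
  rw [h4] at h5
  apply hz
  have h6 : eval ((-1 : ℂ) • z) F = 0 := by
    have : (0:ℂ) • b - z = (-1 : ℂ) • z := by simp
    rw [← this, ← h5]
    simp; right; omega
  exact (eval_smul_ne hF (by norm_num)).mp h6
lemma trdeg_Po (n : ℕ) : trdeg ℂ (Po n) = n := by
  rw [MvPolynomial.trdeg_of_isDomain]; simp
lemma hyper_gen {n d : ℕ} {I : Ideal (Po n)} (hI : Good d I) (hd : d + 1 = n) (hb : I ≠ ⊥) :
    ∃ D F, F.IsHomogeneous D ∧ 2 ≤ D ∧ F ≠ 0 ∧ I = Ideal.span {F} := by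
  have hp := hI.prime
  obtain ⟨f, hf, hfp⟩ := hp.exists_mem_prime_of_ne_bot hb
  have hs : I = Ideal.span {f} := by
    by_contra hne
    have hlt : Ideal.span {f} < I := lt_of_le_of_ne ((Ideal.span_singleton_le_iff_mem _).mpr hf) (Ne.symm hne)
    have hsp : (Ideal.span {f}).IsPrime := (Ideal.span_singleton_prime hfp.ne_zero).mpr hfp
    have h1 := trdeg_lt' hlt
    have h2 := trdeg_quot_lt (k := ℂ) (Ideal.span {f}) (by rw [Ne, Ideal.span_singleton_eq_bot]; exact hfp.ne_zero)
    have h3 := hI.dim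
    have h4 : (d : Cardinal) + 1 + 1 ≤ n := by
      rw [← trdeg_Po n]
      refine le_trans ?_ h2
      gcongr
      refine le_trans ?_ h1
      gcongr
    have : d + 1 + 1 ≤ n := by exact_mod_cast h4
    omega
  let F := homogeneousComponent f.totalDegree f
  have hFI : F ∈ I := hI.hom f hf _
  have hF0 : F ≠ 0 := by
    obtain ⟨e, he, h1⟩ := Finset.exists_mem_eq_sup f.support (support_nonempty.mpr hfp.ne_zero) (fun s => s.sum fun _ e => e)
    intro h
    have h2 : coeff e F = coeff e f := by
      rw [coeff_homogeneousComponent, if_pos]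
      exact h1.symm
    rw [h, coeff_zero] at h2
    exact mem_support_iff.mp he h2.symm
  have hFh : F.IsHomogeneous f.totalDegree := homogeneousComponent_isHomogeneous _ _
  have hIF : I = Ideal.span {F} := by
    have h1 := hFI
    rw [hs, Ideal.mem_span_singleton] at h1
    obtain ⟨g, hg⟩ := h1
    have hg0 : g ≠ 0 := by rintro rfl; exact hF0 (by rw [hg, mul_zero])
    have h2 := totalDegree_mul_of_isDomain hfp.ne_zero hg0
    rw [← hg, hFh.totalDegree hF0] at h2
    have h3 : g = C (coeff 0 g) := totalDegree_eq_zero_iff_eq_C.mp (by omega)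
    have hu : IsUnit g := by
      rw [h3]; apply IsUnit.map
      rw [isUnit_iff_ne_zero]
      intro h; rw [h, C_0] at h3; exact hg0 h3
    rw [hs, hg]
    exact (Ideal.span_singleton_mul_right_unit hu f).symm
  refine ⟨_, F, hFh, ?_, hF0, hIF⟩
  by_contra hlt
  rcases (by omega : f.totalDegree = 0 ∨ f.totalDegree = 1) with h | h
  · have h3 : f = C (coeff 0 f) := totalDegree_eq_zero_iff_eq_C.mp h
    apply hfp.not_isUnit
    rw [h3]; apply IsUnit.map
    rw [isUnit_iff_ne_zero]
    intro h; rw [h, C_0] at h3; exact hfp.ne_zero h3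
  · rw [h] at hFh
    obtain ⟨s, hs⟩ : ∃ s, F = lin s := by
      refine ⟨fun i => coeff 0 (pderiv i F), ?_⟩
      have h1 := hFh.sum_X_mul_pderiv
      rw [one_smul] at h1
      conv_lhs => rw [← h1]
      refine Finset.sum_congr rfl fun i _ => ?_
      have h2 : pderiv i F = C (coeff 0 (pderiv i F)) :=
        totalDegree_eq_zero_iff_eq_C.mp (Nat.le_zero.mp (hFh.pderiv (i := i)).totalDegree_le)
      conv_lhs => rw [h2]
      exact mul_comm _ _
    rw [hs] at hFI
    have := hI.nondeg s hFI
    exact hF0 (by rw [hs, this]; simp [lin])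
lemma case_hyper {r d : ℕ} {Y : Set (Pr r)} (hY : IsClosed Y) (hne : Y.Nonempty) (hI : Good d (idealOf Y)) (hd : d + 1 = r + 1)
    (hb : idealOf Y ≠ ⊥) : secantVariety Y = Set.univ ∧ ISC Y := by
  have hp := hI.prime
  obtain ⟨D, F, hF, hD, hF0, hIF⟩ := hyper_gen hI hd hb
  have hFI : F ∈ idealOf Y := by rw [hIF]; exact Ideal.mem_span_singleton_self F
  have hZ : ∀ a, a ∈ Zl (idealOf Y) ↔ eval a F = 0 := by
    intro a
    refine ⟨fun h => h F hFI, fun h g hg => ?_⟩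
    rw [hIF, Ideal.mem_span_singleton] at hg
    obtain ⟨k, rfl⟩ := hg
    rw [map_mul, h, zero_mul]
  obtain ⟨y, hy⟩ := hne
  have ha : y.rep ∈ Zl (idealOf Y) := (Cn_eq hY y.rep_nonzero).mp (Cn_rep.mpr hy)
  have hT : Tan (idealOf Y) y.rep ≠ ⊤ := by
    intro h
    have h1 := hI.smooth _ ha y.rep_nonzero
    rw [h, finrank_top, Module.finrank_fin_fun] at h1
    omega
  obtain ⟨v, hv⟩ : ∃ v, eval y.rep (dv v F) ≠ 0 := by
    by_contra! hn
    apply hT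
    rw [_root_.eq_top_iff]
    intro v _ g hg
    rw [hIF, Ideal.mem_span_singleton] at hg
    obtain ⟨k, rfl⟩ := hg
    rw [Derivation.leibniz, map_add, smul_eq_mul, smul_eq_mul, map_mul, map_mul, hn v, (hZ _).mp ha]
    ring
  let s : Fin (r+1) → ℂ := fun i => eval y.rep (pderiv i F)
  have hs : ∀ z, eval z (lin s) = eval y.rep (dv z F) := by
    intro z; rw [eval_lin, eval_dv]
  have hs0 : lin s ≠ 0 := by
    intro h; apply hv; rw [← hs, h, map_zero]
  refine finish' hY (F * lin s) (mul_ne_zero hF0 hs0) fun z hz => ?_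
  rw [map_mul, hs] at hz
  have hz1 := left_ne_zero_of_mul hz
  have hz2 := right_ne_zero_of_mul hz
  refine ⟨fun h => hz1 ((hZ _).mp h), {b | b ∈ Zl (idealOf Y) ∧ ∃ ε : ℂ, ε ≠ 0 ∧ b - ε • z ∈ Zl (idealOf Y)}, ?_, ?_, ?_⟩
  · obtain ⟨ε, h1, h2⟩ := key_root hF hD hz1 ((hZ _).mp ha) hz2
    exact ⟨y.rep, ha, ε, h1, (hZ _).mpr h2⟩
  · ext w; constructor
    · rintro ⟨b, ⟨hb, ε, hε, hbz⟩, p, q, hw⟩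
      refine ⟨ε⁻¹ • b, ⟨Zl_smul hY hb (inv_ne_zero hε), ?_⟩, p * ε, q, ?_⟩
      · have := Zl_smul hY hbz (inv_ne_zero hε)
        rwa [smul_sub, inv_smul_smul₀ hε] at this
      · rw [hw, mul_smul, smul_inv_smul₀ hε]
    · rintro ⟨b, ⟨hb, hbz⟩, p, q, hw⟩
      exact ⟨b, ⟨hb, 1, one_ne_zero, by rwa [one_smul]⟩, p, q, hw⟩
  · intro p q hpq
    have h1 : dv z F * (p * q) ∈ idealOf Y := by
      apply mem_of_Zl
      intro b hb
      rw [map_mul, map_mul]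
      by_cases hd : eval b (dv z F) = 0
      · rw [hd, zero_mul]
      · obtain ⟨ε, h1, h2⟩ := key_root hF hD hz1 ((hZ _).mp hb) hd
        rw [hpq b ⟨hb, ε, h1, (hZ _).mpr h2⟩, mul_zero]
    have h2 := (hp.mem_or_mem h1).resolve_left fun h => hz2 (ha _ h)
    rcases hp.mem_or_mem h2 with h | h
    · exact Or.inl fun b hb => hb.1 _ h
    · exact Or.inr fun b hb => hb.1 _ h
lemma case_bot {r : ℕ} {Y : Set (Pr r)} (hr : 1 ≤ r) (hY : IsClosed Y) (hirr : IsIrreducible Y)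
    (hb : idealOf Y = ⊥) : secantVariety Y = Set.univ ∧ ISC Y := by
  have hu : Y = Set.univ := by
    rw [eq_univ_iff_forall]
    intro y
    rw [← Cn_rep, Cn_eq hY y.rep_nonzero, hb]
    intro f hf
    rw [Ideal.mem_bot] at hf
    rw [hf, map_zero]
  subst hu
  have hz : ∀ z : Pr r, ∃ y : Pr r, y ≠ z := by
    intro z
    by_contra! hn
    have h0 : ∀ i, Pi.single i (1:ℂ) ≠ (0 : Fin (r+1) → ℂ) := fun i h => by
      have := congrFun h i
      simp at this
    have h1 := (hn (Projectivization.mk ℂ _ (h0 0))).trans (hn (Projectivization.mk ℂ _ (h0 (Fin.last r)))).symm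
    rw [Projectivization.mk_eq_mk_iff'] at h1
    obtain ⟨a, ha⟩ := h1
    have hne : (0 : Fin (r+1)) ≠ Fin.last r := by
      intro h; have := congrArg Fin.val h; simp at this; omega
    have := congrFun ha 0
    simp [hne] at this
  have hs : ∀ z : Pr r, secU (Set.univ : Set (Pr r)) z = Set.univ := by
    intro z
    rw [eq_univ_iff_forall]
    intro w
    simp only [secU, mem_iUnion, exists_prop]
    by_cases hw : w = z
    · obtain ⟨y, hy⟩ := hz z
      refine ⟨z, mem_univ _, y, mem_univ _, hy.symm, ?_, ?_⟩
      · exact Submodule.subset_span (by simp)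
      · rw [hw]; exact Submodule.subset_span (by simp)
    · refine ⟨z, mem_univ _, w, mem_univ _, Ne.symm hw, ?_, ?_⟩
      · exact Submodule.subset_span (by simp)
      · exact Submodule.subset_span (by simp)
  refine finish Set.univ isOpen_univ dense_univ fun z _ => ?_
  rw [hs]
  exact ⟨mem_univ _, hirr⟩
theorem main_thm (r m : ℕ) (Y : Set (Pr r)) (hcl : IsClosed Y) (hirr : IsIrreducible Y) (hsm : IsSmoothSet Y)
    (hnd : NondegenerateSet Y) (hdim : pdim Y = ((m:ℕ∞):WithBot ℕ∞)) (hbig : 2*(r-1) < 3*m) : secantVariety Y = Set.univ ∧ ISC Y := by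
  have hI := good_of hcl hirr hsm hnd hdim
  have hp := hI.prime
  have h1 : m + 1 ≤ r + 1 := by
    have h3 := hI.dim.trans (trdeg_le_of_surjective (Ideal.Quotient.mkₐ ℂ (idealOf Y)) Ideal.Quotient.mk_surjective)
    rw [trdeg_Po] at h3
    exact_mod_cast h3
  by_cases hb : idealOf Y = ⊥
  · exact case_bot (by omega) hcl hirr hb
  have h2 : m + 2 ≤ r + 1 := by
    have := trdeg_quot_lt (k := ℂ) (idealOf Y) hb
    rw [trdeg_Po] at this
    have h3 : ((m + 1 : ℕ) : Cardinal) + 1 ≤ (r + 1 : ℕ) := le_trans (by gcongr; exact hI.dim) this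
    exact_mod_cast h3
  by_cases hc : m + 2 = r + 1
  · exact case_hyper hcl hirr.1 hI hc hb
  obtain ⟨h, h0, hh⟩ := fib_set hI (c := r - m) (by omega) (by omega) (by omega)
  obtain ⟨g, hg, hg0⟩ := Submodule.exists_mem_ne_zero_of_ne_bot hb
  refine finish' hcl (h * g) (mul_ne_zero h0 hg0) fun z hz => ?_
  rw [map_mul] at hz
  obtain ⟨⟨x, hx, hxz⟩, hi⟩ := hh z (left_ne_zero_of_mul hz)
  refine ⟨fun hZ => right_ne_zero_of_mul hz (hZ g hg), {b | b ∈ Zl (idealOf Y) ∧ b - z ∈ Zl (idealOf Y)}, ⟨x, hx, hxz⟩, rfl, fun p q hpq => ?_⟩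
  rcases hi p q (fun x h1 h2 => hpq x ⟨h1, h2⟩) with h | h
  · exact Or.inl fun b hb => h b hb.1 hb.2
  · exact Or.inr fun b hb => h b hb.1 hb.2
end

/-- **Corollary 3.**  Let `Y ⊆ ℙ^r` be smooth and nondegenerate with
`dim Y > (2/3)(r-1)`.  Then `Y` is non-projectable and has the irreducible secant cone
(ISC) property. -/
theorem nonprojectable_and_isc_of_smooth
    (r m : ℕ) (Y : Set (Pr r))
    (hcl : IsClosed Y) (hirr : IsIrreducible Y) (hsm : IsSmoothSet Y)
    (hnd : NondegenerateSet Y)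
    (hdim : pdim Y = ((m : ℕ∞) : WithBot ℕ∞))
    (hbig : 2 * (r - 1) < 3 * m) :
    secantVariety Y = Set.univ ∧ ISC Y := by
  exact main_thm r m Y hcl hirr hsm hnd hdim hbig

end
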